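/- Let M be a number field containing a primitive third root of unity ζ. (1) For every nonzero α ∈ O_M and all β, β′ ∈ O_M coprime to 3: if β ≡ β′ (mod 27αO_M), then (α/βO_M)_{M,3} = (α/β′O_M)_{M,3}. (2) There exists a function μ assigning to each ordered pair of residue classes in O_M/27O_M an element of {1, ζ, ζ²} such that for all α, β ∈ O_M that are both coprime to 3, (α/βO_M)_{M,3} = μ(α mod 27O_M, β mod 27O_M) · (β/αO_M)_{M,3}. -/

import Mathlib

open NumberField

/-- The cubic residue symbol `χ γ 𝔞 = (γ/𝔞)_{M,3}` on a ring of integers `R` containing a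
primitive third root of unity `ζ`: on a prime `𝔮 ∤ 3` it is the unique element of
`{1, ζ, ζ²}` congruent to `γ^((N(𝔮)-1)/3)` mod `𝔮` (and `0` if `γ ∈ 𝔮`), and it is extended
completely multiplicatively to ideals coprime to `3`. -/
def IsCubicResidueSymbol {R : Type*} [CommRing R] (ζ : R) (χ : R → Ideal R → R) : Prop :=
  (∀ γ : R, ∀ 𝔮 : Ideal R, 𝔮.IsPrime → (3 : R) ∉ 𝔮 →
    ((γ ∈ 𝔮 → χ γ 𝔮 = 0) ∧
     (γ ∉ 𝔮 → (χ γ 𝔮 = 1 ∨ χ γ 𝔮 = ζ ∨ χ γ 𝔮 = ζ ^ 2) ∧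
        χ γ 𝔮 - γ ^ ((Nat.card (R ⧸ 𝔮) - 1) / 3) ∈ 𝔮))) ∧
  (∀ γ : R, χ γ ⊤ = 1) ∧
  (∀ γ : R, ∀ 𝔞 𝔟 : Ideal R, Ideal.span {(3 : R)} ⊔ 𝔞 = ⊤ → Ideal.span {(3 : R)} ⊔ 𝔟 = ⊤ →
    χ γ (𝔞 * 𝔟) = χ γ 𝔞 * χ γ 𝔟)

namespace CubicRec

set_option linter.unusedSectionVars false

/-! ### The cubic character of a finite field, written additively -/

section FiniteField
variable {F : Type*} [Field F] [Finite F]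

open Classical in
/-- The cubic residue character of a finite field `F` containing the primitive third root of
unity `z`, written additively: `a ^ ((#F - 1) / 3) = z ^ fcub z a`, and `fcub z 0 = 0`. -/
noncomputable def fcub (z a : F) : ZMod 3 :=
  if a = 0 then 0 else
  if h : ∃ c : ZMod 3, a ^ ((Nat.card F - 1) / 3) = z ^ c.val then h.choose else 0

lemma fcub_zero (z : F) : fcub z 0 = 0 := if_pos rfl

lemma pow_val_add {R : Type*} [Monoid R] {z : R} (hz : z ^ 3 = 1) (c d : ZMod 3) :
    z ^ (c + d).val = z ^ c.val * z ^ d.val := by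
  rw [ZMod.val_add, ← pow_add, ← Nat.mod_add_div (c.val + d.val) 3, pow_add, pow_mul, hz]
  simp

lemma pow_val_inj {R : Type*} [CommMonoid R] {z : R} (hz : IsPrimitiveRoot z 3) {c d : ZMod 3}
    (h : z ^ c.val = z ^ d.val) : c = d :=
  ZMod.val_injective 3 (hz.pow_inj c.val_lt d.val_lt h)

lemma three_dvd_card_sub_one {z : F} (hz : IsPrimitiveRoot z 3) : 3 ∣ Nat.card F - 1 := by
  have := Fintype.ofFinite F
  rw [Nat.card_eq_fintype_card]
  exact hz.dvd_of_pow_eq_one _ (FiniteField.pow_card_sub_one_eq_one z (hz.ne_zero (by norm_num)))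

lemma fcub_spec {z : F} (hz : IsPrimitiveRoot z 3) {a : F} (ha : a ≠ 0) :
    a ^ ((Nat.card F - 1) / 3) = z ^ (fcub z a).val := by
  have h : ∃ c : ZMod 3, a ^ ((Nat.card F - 1) / 3) = z ^ c.val := by
    have h1 : (a ^ ((Nat.card F - 1) / 3)) ^ 3 = 1 := by
      have := Fintype.ofFinite F
      rw [← pow_mul, Nat.div_mul_cancel (three_dvd_card_sub_one hz), Nat.card_eq_fintype_card]
      exact FiniteField.pow_card_sub_one_eq_one a ha
    obtain ⟨i, hi, h⟩ := hz.eq_pow_of_pow_eq_one h1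
    exact ⟨(i : ZMod 3), by rw [ZMod.val_natCast, Nat.mod_eq_of_lt hi, h]⟩
  rw [fcub, if_neg ha, dif_pos h]
  exact h.choose_spec

lemma fcub_eq {z : F} (hz : IsPrimitiveRoot z 3) {a : F} (ha : a ≠ 0) {c : ZMod 3}
    (h : a ^ ((Nat.card F - 1) / 3) = z ^ c.val) : fcub z a = c :=
  pow_val_inj hz (by rw [← fcub_spec hz ha, h])

lemma fcub_mul {z : F} (hz : IsPrimitiveRoot z 3) {a b : F} (ha : a ≠ 0) (hb : b ≠ 0) :
    fcub z (a * b) = fcub z a + fcub z b :=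
  fcub_eq hz (mul_ne_zero ha hb) (by
    rw [mul_pow, fcub_spec hz ha, fcub_spec hz hb, pow_val_add hz.pow_eq_one])

lemma fcub_one {z : F} (hz : IsPrimitiveRoot z 3) : fcub z 1 = 0 :=
  fcub_eq hz one_ne_zero (by simp)

lemma fcub_pow {z : F} (hz : IsPrimitiveRoot z 3) {a : F} (ha : a ≠ 0) (n : ℕ) :
    fcub z (a ^ n) = n * fcub z a := by
  induction n with
  | zero => simp [fcub_one hz]
  | succ n ih => rw [pow_succ, fcub_mul hz (pow_ne_zero _ ha) ha, ih]; push_cast; ring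

lemma fcub_neg_one {z : F} (hz : IsPrimitiveRoot z 3) : fcub z (-1) = 0 := by
  have h : fcub z ((-1) ^ 3) = _ := fcub_pow hz (neg_ne_zero.mpr one_ne_zero) 3
  rw [Odd.neg_one_pow (by decide)] at h
  rw [h, show ((3 : ℕ) : ZMod 3) = 0 from rfl, zero_mul]

lemma fcub_neg {z : F} (hz : IsPrimitiveRoot z 3) (a : F) : fcub z (-a) = fcub z a := by
  rcases eq_or_ne a 0 with rfl | ha
  · simp
  · rw [← neg_one_mul, fcub_mul hz (neg_ne_zero.mpr one_ne_zero) ha, fcub_neg_one hz, zero_add]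

lemma card_ext {F' : Type*} [Field F'] [Finite F'] [Algebra F F'] :
    Nat.card F' = Nat.card F ^ Module.finrank F F' := by
  have := Fintype.ofFinite F
  have := Fintype.ofFinite F'
  rw [Nat.card_eq_fintype_card, Nat.card_eq_fintype_card]
  exact Module.card_eq_pow_finrank

lemma fcub_norm {F' : Type*} [Field F'] [Finite F'] [Algebra F F'] {z : F}
    (hz : IsPrimitiveRoot z 3) {x : F'} (hx : x ≠ 0) :
    fcub z (Algebra.norm F x) = fcub (algebraMap F F' z) x := by
  have hz' : IsPrimitiveRoot (algebraMap F F' z) 3 := hz.map_of_injective (algebraMap F F').injective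
  refine fcub_eq hz (by rwa [Algebra.norm_ne_zero_iff]) ?_
  apply (algebraMap F F').injective
  rw [map_pow, map_pow, ← fcub_spec hz' hx, FiniteField.algebraMap_norm_eq_pow, ← pow_mul]
  congr 1
  have h1 : 1 < Nat.card F := Finite.one_lt_card
  have h3 := three_dvd_card_sub_one hz
  have h2 : Nat.card F - 1 ∣ Nat.card F' - 1 := by
    rw [card_ext (F := F) (F' := F')]
    simpa using Nat.sub_dvd_pow_sub_pow (Nat.card F) 1 (Module.finrank F F')
  obtain ⟨m, hm⟩ := h2
  obtain ⟨n, hn⟩ := h3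
  rw [hm, Nat.mul_div_cancel_left _ (by omega), hn, Nat.mul_div_cancel_left _ (by norm_num),
    mul_assoc, Nat.mul_div_cancel_left _ (by norm_num), mul_comm]

lemma fcub_algebraMap {F' : Type*} [Field F'] [Finite F'] [Algebra F F'] {z : F}
    (hz : IsPrimitiveRoot z 3) {x : F} (hx : x ≠ 0) :
    fcub (algebraMap F F' z) (algebraMap F F' x) = Module.finrank F F' * fcub z x := by
  rw [← fcub_norm hz (by simpa using hx), Algebra.norm_algebraMap, fcub_pow hz hx]

lemma fcub_equiv {F' : Type*} [Field F'] [Finite F'] (e : F ≃+* F') {z : F}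
    (hz : IsPrimitiveRoot z 3) (x : F) : fcub (e z) (e x) = fcub z x := by
  have hz' : IsPrimitiveRoot (e z) 3 := hz.map_of_injective e.injective
  have hc : Nat.card F' = Nat.card F := (Nat.card_congr e.toEquiv).symm
  rcases eq_or_ne x 0 with rfl | hx
  · simp [fcub_zero]
  · exact fcub_eq hz' (by simpa using hx) (by
      rw [hc, ← map_pow, fcub_spec hz hx, map_pow])

end FiniteField

end CubicRec

namespace CubicRec

set_option linter.unusedSectionVars false

open IsDedekindDomain

section Place
variable {K : Type*} [Field K] [NumberField K]

noncomputable instance residueField (v : HeightOneSpectrum (𝓞 K)) : Field (𝓞 K ⧸ v.asIdeal) :=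
  Ideal.Quotient.field _

instance finite_residueField (v : HeightOneSpectrum (𝓞 K)) : Finite (𝓞 K ⧸ v.asIdeal) :=
  Ideal.finiteQuotientOfFreeOfNeBot _ v.ne_bot

/-- The cubic residue character at the place `v`, written additively. -/
noncomputable def rcub (ζ : 𝓞 K) (v : HeightOneSpectrum (𝓞 K)) (a : 𝓞 K) : ZMod 3 :=
  fcub (Ideal.Quotient.mk v.asIdeal ζ) (Ideal.Quotient.mk v.asIdeal a)

lemma exists_unif (v : HeightOneSpectrum (𝓞 K)) : ∃ π : 𝓞 K, π ∈ v.asIdeal ∧ π ∉ v.asIdeal ^ 2 := by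
  have h : v.asIdeal ^ 2 < v.asIdeal ^ 1 :=
    Ideal.pow_right_strictAnti v.asIdeal v.ne_bot v.isPrime.ne_top (by norm_num)
  rw [pow_one] at h
  obtain ⟨x, hx, hx'⟩ := SetLike.exists_of_lt h
  exact ⟨x, hx, hx'⟩

/-- A uniformizer at `v`. -/
noncomputable def unif (v : HeightOneSpectrum (𝓞 K)) : 𝓞 K := (exists_unif v).choose

lemma unif_mem (v : HeightOneSpectrum (𝓞 K)) : unif v ∈ v.asIdeal := (exists_unif v).choose_spec.1

lemma unif_notMem (v : HeightOneSpectrum (𝓞 K)) : unif v ∉ v.asIdeal ^ 2 :=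
  (exists_unif v).choose_spec.2

lemma unif_ne_zero (v : HeightOneSpectrum (𝓞 K)) : unif v ≠ 0 := fun h =>
  unif_notMem v (h ▸ zero_mem _)

lemma exists_mul_mem_span {v : HeightOneSpectrum (𝓞 K)} {π : 𝓞 K} (hπ : π ∈ v.asIdeal)
    (hπ2 : π ∉ v.asIdeal ^ 2) : ∃ d ∉ v.asIdeal, ∀ a ∈ v.asIdeal, π ∣ a * d := by
  obtain ⟨J, hJ⟩ := Ideal.dvd_span_singleton.mpr hπ
  have hJv : ¬ J ≤ v.asIdeal := by
    intro h
    apply hπ2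
    rw [← Ideal.span_singleton_le_iff_mem, hJ, pow_two]
    exact Ideal.mul_mono_right h
  obtain ⟨d, hd, hdv⟩ := SetLike.not_le_iff_exists.mp hJv
  refine ⟨d, hdv, fun a ha => ?_⟩
  rw [← Ideal.mem_span_singleton, hJ]
  exact Ideal.mul_mem_mul ha hd

lemma exists_dec_nat (v : HeightOneSpectrum (𝓞 K)) {π : 𝓞 K} (hπ : π ∈ v.asIdeal)
    (hπ2 : π ∉ v.asIdeal ^ 2) {a : 𝓞 K} (ha : a ≠ 0) :
    ∃ n : ℕ, ∃ b ∉ v.asIdeal, ∃ d ∉ v.asIdeal, a * d = π ^ n * b := by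
  obtain ⟨d, hd, hdv⟩ := exists_mul_mem_span hπ hπ2
  have key : ∀ m : ℕ, ∀ a, a ∉ v.asIdeal ^ m →
      ∃ n : ℕ, ∃ b ∉ v.asIdeal, ∃ d ∉ v.asIdeal, a * d = π ^ n * b := by
    intro m
    induction m with
    | zero => intro a ha; simp at ha
    | succ m ih =>
      intro a ha
      by_cases hav : a ∈ v.asIdeal
      · obtain ⟨a', ha'⟩ := hdv a hav
        have : a' ∉ v.asIdeal ^ m := by
          intro h
          have h1 : a * d ∈ v.asIdeal ^ (m + 1) := by
            rw [ha', pow_succ']; exact Ideal.mul_mem_mul hπ h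
          rw [mul_comm] at h1
          rcases Ideal.IsPrime.mul_mem_pow v.asIdeal h1 with h | h
          · exact hd h
          · exact ha h
        obtain ⟨n, b, hb, d', hd', h⟩ := ih a' this
        refine ⟨n + 1, b, hb, d * d', fun h => ?_, ?_⟩
        · exact (v.isPrime.mem_or_mem h).elim hd hd'
        · rw [← mul_assoc, ha', mul_assoc, h]; ring
      · exact ⟨0, a, hav, 1, (Ideal.ne_top_iff_one _).mp v.isPrime.ne_top, by ring⟩
  obtain ⟨m, hm⟩ : ∃ m : ℕ, a ∉ v.asIdeal ^ m := by
    by_contra! h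
    apply ha
    have : a ∈ (⨅ i : ℕ, v.asIdeal ^ i) := by simpa using h
    rwa [Ideal.iInf_pow_eq_bot_of_isDomain _ v.isPrime.ne_top] at this
  exact key m a hm

/-- `x = π ^ n * b / d` with `b` and `d` outside the prime `v`. -/
structure IsDec (v : HeightOneSpectrum (𝓞 K)) (π : 𝓞 K) (x : K) (n : ℤ) (b d : 𝓞 K) : Prop where
  hb : b ∉ v.asIdeal
  hd : d ∉ v.asIdeal
  eq : x * d = (π : K) ^ n * b

lemma mul_notMem {v : HeightOneSpectrum (𝓞 K)} {a b : 𝓞 K} (ha : a ∉ v.asIdeal)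
    (hb : b ∉ v.asIdeal) : a * b ∉ v.asIdeal := fun h => (v.isPrime.mem_or_mem h).elim ha hb

lemma one_notMem (v : HeightOneSpectrum (𝓞 K)) : (1 : 𝓞 K) ∉ v.asIdeal :=
  (Ideal.ne_top_iff_one _).mp v.isPrime.ne_top

lemma ne_zero_of_notMem {v : HeightOneSpectrum (𝓞 K)} {a : 𝓞 K} (ha : a ∉ v.asIdeal) : a ≠ 0 :=
  fun h => ha (h ▸ zero_mem _)

lemma coe_ne_zero_of_notMem {v : HeightOneSpectrum (𝓞 K)} {a : 𝓞 K} (ha : a ∉ v.asIdeal) :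
    (a : K) ≠ 0 := by
  exact_mod_cast ne_zero_of_notMem ha

lemma exists_isDec (v : HeightOneSpectrum (𝓞 K)) {π : 𝓞 K} (hπ : π ∈ v.asIdeal)
    (hπ2 : π ∉ v.asIdeal ^ 2) {x : K} (hx : x ≠ 0) : ∃ n b d, IsDec v π x n b d := by
  obtain ⟨r, s, hs, rfl⟩ := IsFractionRing.div_surjective (𝓞 K) x
  have hs0 : s ≠ 0 := nonZeroDivisors.ne_zero hs
  have hr0 : r ≠ 0 := by rintro rfl; simp at hx
  obtain ⟨n, b, hb, d, hd, h⟩ := exists_dec_nat v hπ hπ2 hr0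
  obtain ⟨n', b', hb', d', hd', h'⟩ := exists_dec_nat v hπ hπ2 hs0
  have hπ0 : π ≠ 0 := fun h => hπ2 (h ▸ zero_mem _)
  refine ⟨n - n', b * d', d * b', mul_notMem hb hd', mul_notMem hd hb', ?_⟩
  have e : (r : K) * d = (π : K) ^ n * b := by exact_mod_cast congrArg (algebraMap (𝓞 K) K) h
  have e' : (s : K) * d' = (π : K) ^ n' * b' := by exact_mod_cast congrArg (algebraMap (𝓞 K) K) h'
  have hsK : (s : K) ≠ 0 := by exact_mod_cast hs0
  have hπK : (π : K) ≠ 0 := by exact_mod_cast hπ0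
  rw [zpow_sub₀ hπK, zpow_natCast, zpow_natCast]
  change (r : K) / s * _ = _
  push_cast
  field_simp
  linear_combination ((π : K) ^ n' * b') * e - (π : K) ^ n * b * e'

lemma IsDec.mul {v : HeightOneSpectrum (𝓞 K)} {π : 𝓞 K} (hπ : π ≠ 0) {x x' : K} {n n' : ℤ}
    {b d b' d' : 𝓞 K} (h : IsDec v π x n b d) (h' : IsDec v π x' n' b' d') :
    IsDec v π (x * x') (n + n') (b * b') (d * d') := by
  refine ⟨mul_notMem h.hb h'.hb, mul_notMem h.hd h'.hd, ?_⟩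
  have hπK : (π : K) ≠ 0 := by exact_mod_cast hπ
  rw [zpow_add₀ hπK]
  push_cast
  linear_combination (x' * d') * h.eq + (π : K) ^ n * b * h'.eq

lemma IsDec.unique {v : HeightOneSpectrum (𝓞 K)} {π : 𝓞 K} (hπ : π ∈ v.asIdeal) (hπ0 : π ≠ 0)
    {x : K} {n n' : ℤ} {b d b' d' : 𝓞 K} (h : IsDec v π x n b d) (h' : IsDec v π x n' b' d') :
    n = n' ∧ b * d' = b' * d := by
  have hπK : (π : K) ≠ 0 := by exact_mod_cast hπ0
  have main : ∀ {n n' : ℤ} {b d b' d' : 𝓞 K}, IsDec v π x n b d → IsDec v π x n' b' d' → n ≤ n' := by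
    intro n n' b d b' d' h h'
    by_contra! hlt
    obtain ⟨m, rfl⟩ : ∃ m : ℕ, n = n' + (m + 1) := ⟨(n - n' - 1).toNat, by omega⟩
    have e : (π : K) ^ (m + 1) * b * d' = b' * d := by
      have h1 := h.eq
      have h2 := h'.eq
      rw [zpow_add₀ hπK] at h1
      have : (π : K) ^ n' ≠ 0 := zpow_ne_zero _ hπK
      apply mul_left_cancel₀ this
      have h3 : (π : K) ^ ((m : ℤ) + 1) = (π : K) ^ (m + 1) := by
        rw [← zpow_natCast]; push_cast; rfl
      rw [h3] at h1
      linear_combination (-(d' : K)) * h1 + (d : K) * h2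
    have e' : π ^ (m + 1) * b * d' = b' * d := by exact_mod_cast e
    apply mul_notMem h'.hb h.hd
    rw [← e', mul_assoc, pow_succ, mul_assoc]
    exact Ideal.mul_mem_left _ _ (Ideal.mul_mem_right _ _ hπ)
  have hn : n = n' := le_antisymm (main h h') (main h' h)
  refine ⟨hn, ?_⟩
  subst hn
  have : (b : K) * d' = b' * d := by
    have : (π : K) ^ n ≠ 0 := zpow_ne_zero _ hπK
    apply mul_left_cancel₀ this
    linear_combination (-(d' : K)) * h.eq + (d : K) * h'.eq
  exact_mod_cast this

open Classical in
/-- The normalised valuation at `v`; `ord v 0 = 0`. -/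
noncomputable def ord (v : HeightOneSpectrum (𝓞 K)) (x : K) : ℤ :=
  if h : ∃ n b d, IsDec v (unif v) x n b d then h.choose else 0

open Classical in
/-- The extension of the cubic residue character at `v` to all of `K` which vanishes at the chosen
uniformizer (and at `0`). -/
noncomputable def lg (ζ : 𝓞 K) (v : HeightOneSpectrum (𝓞 K)) (x : K) : ZMod 3 :=
  if h : ∃ n b d, IsDec v (unif v) x n b d then
    rcub ζ v h.choose_spec.choose - rcub ζ v h.choose_spec.choose_spec.choose else 0

/-- The hypothesis that `ζ` is a primitive third root of unity, and that `v` does not divide `3`. -/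
structure Good (ζ : 𝓞 K) (v : HeightOneSpectrum (𝓞 K)) : Prop where
  prim : IsPrimitiveRoot ζ 3
  three : (3 : 𝓞 K) ∉ v.asIdeal

lemma sq_add_self_add_one {R : Type*} [CommRing R] [IsDomain R] {ζ : R} (h : IsPrimitiveRoot ζ 3) :
    ζ ^ 2 + ζ + 1 = 0 := by
  have := h.geom_sum_eq_zero (by norm_num)
  simp [Finset.sum_range_succ] at this
  linear_combination this

lemma isPrimitiveRoot_of_ne_one {F : Type*} [CommMonoid F] {z : F} (h3 : z ^ 3 = 1)
    (h1 : z ≠ 1) : IsPrimitiveRoot z 3 := by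
  have := orderOf_eq_prime h3 h1
  exact this ▸ IsPrimitiveRoot.orderOf z

variable {ζ : 𝓞 K} {v : HeightOneSpectrum (𝓞 K)}

lemma Good.mk_prim (h : Good ζ v) : IsPrimitiveRoot (Ideal.Quotient.mk v.asIdeal ζ) 3 := by
  refine isPrimitiveRoot_of_ne_one (by rw [← RingHom.map_pow, h.prim.pow_eq_one, RingHom.map_one]) ?_
  intro h1
  apply h.three
  rw [← Ideal.Quotient.eq_zero_iff_mem]
  have h2 := congrArg (Ideal.Quotient.mk v.asIdeal) (sq_add_self_add_one h.prim)
  simp only [map_add, map_pow, h1, map_one, map_zero] at h2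
  rw [← h2, map_ofNat]; norm_num

lemma mk_ne_zero {a : 𝓞 K} (ha : a ∉ v.asIdeal) : Ideal.Quotient.mk v.asIdeal a ≠ 0 := by
  rwa [Ne, Ideal.Quotient.eq_zero_iff_mem]

lemma rcub_mul (h : Good ζ v) {a b : 𝓞 K} (ha : a ∉ v.asIdeal) (hb : b ∉ v.asIdeal) :
    rcub ζ v (a * b) = rcub ζ v a + rcub ζ v b := by
  rw [rcub, map_mul, fcub_mul h.mk_prim (mk_ne_zero ha) (mk_ne_zero hb)]; rfl

lemma rcub_one (h : Good ζ v) : rcub ζ v 1 = 0 := by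
  rw [rcub, map_one, fcub_one h.mk_prim]

lemma rcub_neg (h : Good ζ v) (a : 𝓞 K) : rcub ζ v (-a) = rcub ζ v a := by
  rw [rcub, map_neg, fcub_neg h.mk_prim]; rfl

lemma rcub_congr {a b : 𝓞 K} (hab : a - b ∈ v.asIdeal) : rcub ζ v a = rcub ζ v b := by
  rw [rcub, rcub, Ideal.Quotient.eq.mpr hab]

lemma ord_eq {x : K} {n : ℤ} {b d : 𝓞 K} (h : IsDec v (unif v) x n b d) : ord v x = n := by
  have hx : ∃ n b d, IsDec v (unif v) x n b d := ⟨n, b, d, h⟩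
  rw [ord, dif_pos hx]
  exact (hx.choose_spec.choose_spec.choose_spec.unique (unif_mem v) (unif_ne_zero v) h).1

lemma lg_eq (hg : Good ζ v) {x : K} {n : ℤ} {b d : 𝓞 K} (h : IsDec v (unif v) x n b d) :
    lg ζ v x = rcub ζ v b - rcub ζ v d := by
  have hx : ∃ n b d, IsDec v (unif v) x n b d := ⟨n, b, d, h⟩
  rw [lg, dif_pos hx]
  have h' := hx.choose_spec.choose_spec.choose_spec
  have := congrArg (rcub ζ v) (h'.unique (unif_mem v) (unif_ne_zero v) h).2
  rw [rcub_mul hg h'.hb h.hd, rcub_mul hg h.hb h'.hd] at this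
  linear_combination this

lemma exists_dec (v : HeightOneSpectrum (𝓞 K)) {x : K} (hx : x ≠ 0) :
    ∃ n b d, IsDec v (unif v) x n b d := exists_isDec v (unif_mem v) (unif_notMem v) hx

lemma ord_mul (v : HeightOneSpectrum (𝓞 K)) {x y : K} (hx : x ≠ 0) (hy : y ≠ 0) :
    ord v (x * y) = ord v x + ord v y := by
  obtain ⟨n, b, d, h⟩ := exists_dec v hx
  obtain ⟨n', b', d', h'⟩ := exists_dec v hy
  rw [ord_eq h, ord_eq h', ord_eq (h.mul (unif_ne_zero v) h')]

lemma lg_mul (hg : Good ζ v) {x y : K} (hx : x ≠ 0) (hy : y ≠ 0) :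
    lg ζ v (x * y) = lg ζ v x + lg ζ v y := by
  obtain ⟨n, b, d, h⟩ := exists_dec v hx
  obtain ⟨n', b', d', h'⟩ := exists_dec v hy
  rw [lg_eq hg h, lg_eq hg h', lg_eq hg (h.mul (unif_ne_zero v) h'), rcub_mul hg h.hb h'.hb,
    rcub_mul hg h.hd h'.hd]
  ring

lemma isDec_of_notMem {π a : 𝓞 K} (ha : a ∉ v.asIdeal) : IsDec v π (a : K) 0 a 1 :=
  ⟨ha, one_notMem v, by simp⟩

lemma ord_of_notMem {a : 𝓞 K} (ha : a ∉ v.asIdeal) : ord v (a : K) = 0 := ord_eq (isDec_of_notMem ha)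

lemma lg_of_notMem (hg : Good ζ v) {a : 𝓞 K} (ha : a ∉ v.asIdeal) : lg ζ v (a : K) = rcub ζ v a := by
  rw [lg_eq hg (isDec_of_notMem ha), rcub_one hg, sub_zero]

lemma ord_one : ord v (1 : K) = 0 := by
  simpa using ord_of_notMem (one_notMem v)

lemma ord_unif : ord v (unif v : K) = 1 := ord_eq (b := 1) (d := 1) ⟨one_notMem v, one_notMem v, by simp⟩

lemma lg_unif (hg : Good ζ v) : lg ζ v (unif v : K) = 0 := by
  rw [lg_eq hg (n := 1) (b := 1) (d := 1) ⟨one_notMem v, one_notMem v, by simp⟩, sub_self]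

end Place

end CubicRec

namespace CubicRec

set_option linter.unusedSectionVars false

open IsDedekindDomain

section Tame
variable {K : Type*} [Field K] [NumberField K] {ζ : 𝓞 K} {v : HeightOneSpectrum (𝓞 K)}

lemma unif_pow_notMem (v : HeightOneSpectrum (𝓞 K)) (n : ℕ) : unif v ^ n ∉ v.asIdeal ^ (n + 1) := by
  intro h
  rw [← Ideal.span_singleton_le_iff_mem, ← Ideal.dvd_iff_le, ← Ideal.span_singleton_pow] at h
  have h1 : emultiplicity v.asIdeal (Ideal.span {unif v}) = (1 : ℕ) := by
    rw [emultiplicity_eq_coe, Ideal.dvd_span_singleton, Ideal.dvd_span_singleton, pow_one]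
    exact ⟨unif_mem v, unif_notMem v⟩
  have h2 := le_emultiplicity_of_pow_dvd h
  rw [emultiplicity_pow v.prime, h1] at h2
  norm_cast at h2
  omega

lemma mem_pow_iff {a : 𝓞 K} (ha : a ≠ 0) (m : ℕ) : a ∈ v.asIdeal ^ m ↔ (m : ℤ) ≤ ord v (a : K) := by
  obtain ⟨n, b, hb, d, hd, h⟩ := exists_dec_nat v (unif_mem v) (unif_notMem v) ha
  have ho : ord v (a : K) = n := by
    refine ord_eq (b := b) (d := d) ⟨hb, hd, ?_⟩
    rw [zpow_natCast]
    exact_mod_cast congrArg (algebraMap (𝓞 K) K) h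
  rw [ho, Nat.cast_le]
  constructor
  · intro ham
    by_contra! hlt
    have h1 : unif v ^ n * b ∈ v.asIdeal ^ (n + 1) := by
      rw [← h]
      exact Ideal.mul_mem_right _ _ (Ideal.pow_le_pow_right hlt ham)
    exact (Ideal.IsPrime.mul_mem_pow v.asIdeal (by rwa [mul_comm] at h1)).elim hb (unif_pow_notMem v n)
  · intro hmn
    have h1 : d * a ∈ v.asIdeal ^ m := by
      rw [mul_comm, h]
      exact Ideal.mul_mem_right _ _ (Ideal.pow_le_pow_right hmn (Ideal.pow_mem_pow (unif_mem v) n))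
    exact (Ideal.IsPrime.mul_mem_pow v.asIdeal h1).resolve_left hd

lemma ord_nonneg {a : 𝓞 K} (ha : a ≠ 0) : 0 ≤ ord v (a : K) := by
  have := (mem_pow_iff (v := v) ha 0).mp (by simp)
  simpa using this

lemma mem_iff {a : 𝓞 K} (ha : a ≠ 0) : a ∈ v.asIdeal ↔ ord v (a : K) ≠ 0 := by
  have h := mem_pow_iff (v := v) ha 1
  rw [pow_one] at h
  have := ord_nonneg (v := v) ha
  rw [h]; push_cast; omega

lemma lg_one (hg : Good ζ v) : lg ζ v (1 : K) = 0 := by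
  have := lg_of_notMem hg (one_notMem v)
  rw [rcub_one hg] at this
  exact_mod_cast this

lemma ord_inv {x : K} (hx : x ≠ 0) : ord v x⁻¹ = - ord v x := by
  have := ord_mul v hx (inv_ne_zero hx)
  rw [mul_inv_cancel₀ hx, ord_one] at this
  omega

lemma lg_inv (hg : Good ζ v) {x : K} (hx : x ≠ 0) : lg ζ v x⁻¹ = - lg ζ v x := by
  have := lg_mul hg hx (inv_ne_zero hx)
  rw [mul_inv_cancel₀ hx, lg_one hg] at this
  linear_combination -this

lemma ord_pow {x : K} (hx : x ≠ 0) (n : ℕ) : ord v (x ^ n) = n * ord v x := by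
  induction n with
  | zero => simp [ord_one]
  | succ n ih => rw [pow_succ, ord_mul v (pow_ne_zero _ hx) hx, ih]; push_cast; ring

lemma lg_pow (hg : Good ζ v) {x : K} (hx : x ≠ 0) (n : ℕ) : lg ζ v (x ^ n) = n * lg ζ v x := by
  induction n with
  | zero => simp [lg_one hg]
  | succ n ih => rw [pow_succ, lg_mul hg (pow_ne_zero _ hx) hx, ih]; push_cast; ring

lemma ord_zpow {x : K} (hx : x ≠ 0) (n : ℤ) : ord v (x ^ n) = n * ord v x := by
  obtain ⟨m, rfl | rfl⟩ := n.eq_nat_or_neg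
  · rw [zpow_natCast, ord_pow hx]
  · rw [zpow_neg, zpow_natCast, ord_inv (pow_ne_zero _ hx), ord_pow hx]; ring

lemma lg_zpow (hg : Good ζ v) {x : K} (hx : x ≠ 0) (n : ℤ) : lg ζ v (x ^ n) = n * lg ζ v x := by
  obtain ⟨m, rfl | rfl⟩ := n.eq_nat_or_neg
  · rw [zpow_natCast, lg_pow hg hx]; push_cast; rfl
  · rw [zpow_neg, zpow_natCast, lg_inv hg (pow_ne_zero _ hx), lg_pow hg hx]; push_cast; ring

lemma ord_neg (x : K) : ord v (-x) = ord v x := by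
  rcases eq_or_ne x 0 with rfl | hx
  · simp
  have h : (-1 : 𝓞 K) ∉ v.asIdeal := by rw [neg_mem_iff]; exact one_notMem v
  have := ord_of_notMem h
  push_cast at this
  rw [← neg_one_mul, ord_mul v (by simp) hx, this, zero_add]

lemma lg_neg (hg : Good ζ v) (x : K) : lg ζ v (-x) = lg ζ v x := by
  rcases eq_or_ne x 0 with rfl | hx
  · simp
  have h : (-1 : 𝓞 K) ∉ v.asIdeal := by rw [neg_mem_iff]; exact one_notMem v
  have := lg_of_notMem hg h
  rw [rcub_neg hg, rcub_one hg] at this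
  push_cast at this
  rw [← neg_one_mul, lg_mul hg (by simp) hx, this, zero_add]

open Classical in
/-- The cubic tame symbol at `v`, written additively; it is declared to be `0` if `v` divides `3`. -/
noncomputable def tame (ζ : 𝓞 K) (v : HeightOneSpectrum (𝓞 K)) (x y : K) : ZMod 3 :=
  if (3 : 𝓞 K) ∈ v.asIdeal then 0 else lg ζ v x * ord v y - ord v x * lg ζ v y

lemma tame_of_mem (h : (3 : 𝓞 K) ∈ v.asIdeal) (x y : K) : tame ζ v x y = 0 := if_pos h

lemma tame_of_good (h : Good ζ v) (x y : K) :
    tame ζ v x y = lg ζ v x * ord v y - ord v x * lg ζ v y := if_neg h.three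

lemma good_or (hζ : IsPrimitiveRoot ζ 3) (v : HeightOneSpectrum (𝓞 K)) :
    (3 : 𝓞 K) ∈ v.asIdeal ∨ Good ζ v := by
  by_cases h : (3 : 𝓞 K) ∈ v.asIdeal
  · exact Or.inl h
  · exact Or.inr ⟨hζ, h⟩

lemma tame_swap (x y : K) : tame ζ v x y = - tame ζ v y x := by
  unfold tame
  split_ifs
  · simp
  · ring

lemma tame_mul_left (hζ : IsPrimitiveRoot ζ 3) {x x' : K} (hx : x ≠ 0) (hx' : x' ≠ 0) (y : K) :
    tame ζ v (x * x') y = tame ζ v x y + tame ζ v x' y := by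
  rcases good_or hζ v with h | h
  · simp [tame_of_mem h]
  · rw [tame_of_good h, tame_of_good h, tame_of_good h, lg_mul h hx hx', ord_mul v hx hx']
    push_cast; ring

lemma tame_neg_left (hζ : IsPrimitiveRoot ζ 3) (x y : K) : tame ζ v (-x) y = tame ζ v x y := by
  rcases good_or hζ v with h | h
  · simp [tame_of_mem h]
  · rw [tame_of_good h, tame_of_good h, lg_neg h, ord_neg]

lemma tame_self (x : K) : tame ζ v x x = 0 := by
  unfold tame
  split_ifs
  · rfl
  · ring

lemma tame_steinberg (hζ : IsPrimitiveRoot ζ 3) {x : K} (hx : x ≠ 0) (hx1 : 1 - x ≠ 0) :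
    tame ζ v x (1 - x) = 0 := by
  rcases good_or hζ v with hg | hg
  · exact tame_of_mem hg _ _
  obtain ⟨n, b, d, h⟩ := exists_dec v hx
  rw [tame_of_good hg, ord_eq h, lg_eq hg h]
  have hπK : (unif v : K) ≠ 0 := by exact_mod_cast unif_ne_zero v
  rcases lt_trichotomy n 0 with hn | rfl | hn
  · obtain ⟨m, rfl⟩ : ∃ m : ℕ, n = -(m + 1) := ⟨(-n - 1).toNat, by omega⟩
    have hdec : IsDec v (unif v) (1 - x) (-(m + 1)) (unif v ^ (m + 1) * d - b) d := by
      refine ⟨fun hh => h.hb ?_, h.hd, ?_⟩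
      · have : b = unif v ^ (m + 1) * d - (unif v ^ (m + 1) * d - b) := by ring
        rw [this]
        exact sub_mem (Ideal.mul_mem_right _ _ (Ideal.pow_mem_of_mem _ (unif_mem v) _ (by omega))) hh
      · have := h.eq
        rw [zpow_neg] at this ⊢
        have e : (unif v : K) ^ ((m : ℤ) + 1) = (unif v : K) ^ (m + 1) := by
          rw [← zpow_natCast]; push_cast; rfl
        rw [e] at this ⊢
        push_cast
        rw [mul_sub, ← this]
        field_simp
    rw [ord_eq hdec, lg_eq hg hdec, ← rcub_neg hg b]
    have : rcub ζ v (unif v ^ (m + 1) * d - b) = rcub ζ v (-b) := rcub_congr (by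
      have : unif v ^ (m + 1) * d - b - -b = unif v ^ (m + 1) * d := by ring
      rw [this]
      exact Ideal.mul_mem_right _ _ (Ideal.pow_mem_of_mem _ (unif_mem v) _ (by omega)))
    rw [this]; ring
  · by_cases hdb : d - b ∈ v.asIdeal
    · rw [rcub_congr (ζ := ζ) hdb]; simp
    · have hdec : IsDec v (unif v) (1 - x) 0 (d - b) d := by
        refine ⟨hdb, h.hd, ?_⟩
        have := h.eq
        rw [zpow_zero] at this ⊢
        push_cast
        linear_combination -this
      rw [ord_eq hdec]; simp
  · obtain ⟨m, rfl⟩ : ∃ m : ℕ, n = m + 1 := ⟨(n - 1).toNat, by omega⟩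
    have hdec : IsDec v (unif v) (1 - x) 0 (d - unif v ^ (m + 1) * b) d := by
      refine ⟨fun hh => h.hd ?_, h.hd, ?_⟩
      · have : d = (d - unif v ^ (m + 1) * b) + unif v ^ (m + 1) * b := by ring
        rw [this]
        exact add_mem hh (Ideal.mul_mem_right _ _ (Ideal.pow_mem_of_mem _ (unif_mem v) _ (by omega)))
      · have := h.eq
        have e : (unif v : K) ^ ((m : ℤ) + 1) = (unif v : K) ^ (m + 1) := by
          rw [← zpow_natCast]; push_cast; rfl
        rw [e] at this
        rw [zpow_zero]
        push_cast
        linear_combination -this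
    rw [ord_eq hdec, lg_eq hg hdec]
    have : rcub ζ v (d - unif v ^ (m + 1) * b) = rcub ζ v d := rcub_congr (by
      have : d - unif v ^ (m + 1) * b - d = - (unif v ^ (m + 1) * b) := by ring
      rw [this, neg_mem_iff]
      exact Ideal.mul_mem_right _ _ (Ideal.pow_mem_of_mem _ (unif_mem v) _ (by omega)))
    rw [this]; simp

lemma ord_unif' {π : 𝓞 K} (hπ : π ∈ v.asIdeal) (hπ2 : π ∉ v.asIdeal ^ 2) : ord v (π : K) = 1 := by
  have h0 : π ≠ 0 := fun h => hπ2 (h ▸ zero_mem _)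
  have h1 := (mem_pow_iff (v := v) h0 1).mp (by simpa using hπ)
  have h2 := mt (mem_pow_iff (v := v) h0 2).mpr hπ2
  push_cast at h1 h2
  omega

lemma IsDec.ord_lg (hg : Good ζ v) {π : 𝓞 K} (hπ : π ∈ v.asIdeal) (hπ2 : π ∉ v.asIdeal ^ 2)
    {x : K} (hx : x ≠ 0) {n : ℤ} {b d : 𝓞 K} (h : IsDec v π x n b d) :
    ord v x = n ∧ lg ζ v x = n * lg ζ v (π : K) + (rcub ζ v b - rcub ζ v d) := by
  have h0 : π ≠ 0 := fun h => hπ2 (h ▸ zero_mem _)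
  have hπK : (π : K) ≠ 0 := by exact_mod_cast h0
  have hb := coe_ne_zero_of_notMem h.hb
  have hd := coe_ne_zero_of_notMem h.hd
  have e1 := congrArg (ord v) h.eq
  have e2 := congrArg (lg ζ v) h.eq
  rw [ord_mul v hx hd, ord_mul v (zpow_ne_zero _ hπK) hb, ord_of_notMem h.hb, ord_of_notMem h.hd,
    ord_zpow hπK, ord_unif' hπ hπ2] at e1
  rw [lg_mul hg hx hd, lg_mul hg (zpow_ne_zero _ hπK) hb, lg_of_notMem hg h.hb,
    lg_of_notMem hg h.hd, lg_zpow hg hπK] at e2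
  exact ⟨by omega, by linear_combination e2⟩

lemma tame_eq_of_isDec (hg : Good ζ v) {π : 𝓞 K} (hπ : π ∈ v.asIdeal) (hπ2 : π ∉ v.asIdeal ^ 2)
    {x x' : K} (hx : x ≠ 0) (hx' : x' ≠ 0) {n n' : ℤ} {b d b' d' : 𝓞 K} (h : IsDec v π x n b d)
    (h' : IsDec v π x' n' b' d') :
    tame ζ v x x' = (rcub ζ v b - rcub ζ v d) * n' - n * (rcub ζ v b' - rcub ζ v d') := by
  obtain ⟨e1, e2⟩ := h.ord_lg hg hπ hπ2 hx
  obtain ⟨e1', e2'⟩ := h'.ord_lg hg hπ hπ2 hx'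
  rw [tame_of_good hg, e1, e2, e1', e2']; ring

lemma finite_mem {a : 𝓞 K} (ha : a ≠ 0) : {v : HeightOneSpectrum (𝓞 K) | a ∈ v.asIdeal}.Finite := by
  have := Ideal.finite_factors (I := Ideal.span {a}) (by simpa using ha)
  simpa [Ideal.dvd_span_singleton] using this

lemma finite_ord {x : K} (hx : x ≠ 0) : {v : HeightOneSpectrum (𝓞 K) | ord v x ≠ 0}.Finite := by
  obtain ⟨r, s, hs, rfl⟩ := IsFractionRing.div_surjective (𝓞 K) x
  have hs0 : s ≠ 0 := nonZeroDivisors.ne_zero hs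
  have hr0 : r ≠ 0 := by rintro rfl; simp at hx
  refine ((finite_mem hr0).union (finite_mem hs0)).subset ?_
  intro v hv
  by_contra hcon
  simp only [Set.mem_union, Set.mem_ofPred_eq, not_or] at hcon
  apply hv
  have hsK := coe_ne_zero_of_notMem hcon.2
  have hrK := coe_ne_zero_of_notMem hcon.1
  change ord v ((r : K) / s) = 0
  rw [div_eq_mul_inv, ord_mul v hrK (inv_ne_zero hsK), ord_inv hsK, ord_of_notMem hcon.1,
    ord_of_notMem hcon.2]; rfl

lemma finite_tame {x y : K} (hx : x ≠ 0) (hy : y ≠ 0) :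
    (Function.support fun v => tame ζ v x y).Finite := by
  refine ((finite_ord hx).union (finite_ord hy)).subset ?_
  intro v hv
  by_contra hcon
  simp only [Set.mem_union, Set.mem_ofPred_eq, not_or, not_not] at hcon
  apply hv
  change tame ζ v x y = 0
  unfold tame
  split_ifs
  · rfl
  · simp [hcon.1, hcon.2]

/-- The sum of the cubic tame symbols over all places not above `3`. -/
noncomputable def FS (ζ : 𝓞 K) (x y : K) : ZMod 3 := ∑ᶠ v, tame ζ v x y

lemma FS_swap (x y : K) : FS ζ x y = - FS ζ y x := by
  rw [FS, FS, ← finsum_neg_distrib]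
  exact finsum_congr fun _ => tame_swap x y

lemma FS_mul_left (hζ : IsPrimitiveRoot ζ 3) {x x' y : K} (hx : x ≠ 0) (hx' : x' ≠ 0) (hy : y ≠ 0) :
    FS ζ (x * x') y = FS ζ x y + FS ζ x' y := by
  rw [FS, FS, FS, ← finsum_add_distrib (finite_tame hx hy) (finite_tame hx' hy)]
  exact finsum_congr fun v => tame_mul_left hζ hx hx' y

lemma FS_mul_right (hζ : IsPrimitiveRoot ζ 3) {x x' y : K} (hx : x ≠ 0) (hx' : x' ≠ 0) (hy : y ≠ 0) :
    FS ζ y (x * x') = FS ζ y x + FS ζ y x' := by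
  rw [FS_swap, FS_mul_left hζ hx hx' hy, FS_swap x, FS_swap x']; ring

lemma FS_self (x : K) : FS ζ x x = 0 := by
  rw [FS]; simp only [tame_self, finsum_zero]

lemma FS_neg_left (hζ : IsPrimitiveRoot ζ 3) (x y : K) : FS ζ (-x) y = FS ζ x y :=
  finsum_congr fun _ => tame_neg_left hζ x y

lemma FS_neg_right (hζ : IsPrimitiveRoot ζ 3) (x y : K) : FS ζ x (-y) = FS ζ x y := by
  rw [FS_swap, FS_neg_left hζ, ← FS_swap]

lemma FS_steinberg (hζ : IsPrimitiveRoot ζ 3) {x : K} (hx : x ≠ 0) (hx1 : 1 - x ≠ 0) :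
    FS ζ x (1 - x) = 0 := by
  rw [FS]; simp only [tame_steinberg hζ hx hx1, finsum_zero]

lemma FS_one_left (hζ : IsPrimitiveRoot ζ 3) {y : K} (hy : y ≠ 0) : FS ζ 1 y = 0 := by
  have := FS_mul_left hζ (one_ne_zero (α := K)) one_ne_zero hy
  rw [one_mul] at this
  linear_combination -this

lemma FS_one_right (hζ : IsPrimitiveRoot ζ 3) {y : K} (hy : y ≠ 0) : FS ζ y 1 = 0 := by
  rw [FS_swap, FS_one_left hζ hy, neg_zero]

lemma FS_inv_left (hζ : IsPrimitiveRoot ζ 3) {x y : K} (hx : x ≠ 0) (hy : y ≠ 0) :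
    FS ζ x⁻¹ y = - FS ζ x y := by
  have := FS_mul_left hζ hx (inv_ne_zero hx) hy
  rw [mul_inv_cancel₀ hx, FS_one_left hζ hy] at this
  linear_combination -this

lemma FS_div_left (hζ : IsPrimitiveRoot ζ 3) {x x' y : K} (hx : x ≠ 0) (hx' : x' ≠ 0) (hy : y ≠ 0) :
    FS ζ (x / x') y = FS ζ x y - FS ζ x' y := by
  rw [div_eq_mul_inv, FS_mul_left hζ hx (inv_ne_zero hx') hy, FS_inv_left hζ hx' hy, sub_eq_add_neg]

lemma FS_div_right (hζ : IsPrimitiveRoot ζ 3) {x x' y : K} (hx : x ≠ 0) (hx' : x' ≠ 0) (hy : y ≠ 0) :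
    FS ζ y (x / x') = FS ζ y x - FS ζ y x' := by
  rw [FS_swap, FS_div_left hζ hx hx' hy, FS_swap x, FS_swap x']; ring

lemma FS_pow_left (hζ : IsPrimitiveRoot ζ 3) {x y : K} (hx : x ≠ 0) (hy : y ≠ 0) (n : ℕ) :
    FS ζ (x ^ n) y = n * FS ζ x y := by
  induction n with
  | zero => simp [FS_one_left hζ hy]
  | succ n ih => rw [pow_succ, FS_mul_left hζ (pow_ne_zero _ hx) hx hy, ih]; push_cast; ring

/-- The relation obtained from the Steinberg relation for `y / x`. -/
lemma FS_sub (hζ : IsPrimitiveRoot ζ 3) {x y : K} (hx : x ≠ 0) (hy : y ≠ 0) (hxy : x - y ≠ 0) :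
    FS ζ x (x - y) = FS ζ y (x - y) + FS ζ x y := by
  have e : 1 - y / x = (x - y) / x := by field_simp
  have h := FS_steinberg hζ (div_ne_zero hy hx) (by rw [e]; exact div_ne_zero hxy hx)
  rw [e, FS_div_right hζ hxy hx (div_ne_zero hy hx), FS_div_left hζ hy hx hxy,
    FS_div_left hζ hy hx hx, FS_self] at h
  rw [FS_swap x y]
  linear_combination -h

end Tame

end CubicRec

namespace CubicRec

set_option linter.unusedSectionVars false

open IsDedekindDomain

section Transport
variable {K L : Type*} [Field K] [NumberField K] [Field L] [NumberField L]

/-- Transport of a place along a field isomorphism. -/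
noncomputable def placeComap (e : K ≃+* L) (w : HeightOneSpectrum (𝓞 L)) : HeightOneSpectrum (𝓞 K) where
  asIdeal := w.asIdeal.comap (RingOfIntegers.mapRingEquiv e)
  isPrime := Ideal.comap_isPrime _ _
  ne_bot h := w.ne_bot (by
    rw [eq_bot_iff]
    intro x hx
    have : (RingOfIntegers.mapRingEquiv e).symm x ∈
        w.asIdeal.comap (RingOfIntegers.mapRingEquiv e) := by
      rw [Ideal.mem_comap, RingEquiv.apply_symm_apply]; exact hx
    rw [h, Ideal.mem_bot] at this
    simpa using this)

lemma mem_placeComap {e : K ≃+* L} {w : HeightOneSpectrum (𝓞 L)} {a : 𝓞 K} :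
    a ∈ (placeComap e w).asIdeal ↔ RingOfIntegers.mapRingEquiv e a ∈ w.asIdeal := Iff.rfl

lemma placeComap_bijective (e : K ≃+* L) : Function.Bijective (placeComap e) := by
  refine Function.bijective_iff_has_inverse.mpr ⟨placeComap e.symm, fun w => ?_, fun w => ?_⟩
  · ext x
    rw [mem_placeComap, mem_placeComap]
    exact Iff.of_eq (congrArg (· ∈ w.asIdeal) ((RingOfIntegers.mapRingEquiv e).apply_symm_apply x))
  · ext x
    rw [mem_placeComap, mem_placeComap]
    exact Iff.of_eq (congrArg (· ∈ w.asIdeal) ((RingOfIntegers.mapRingEquiv e).symm_apply_apply x))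

lemma three_mem_placeComap {e : K ≃+* L} {w : HeightOneSpectrum (𝓞 L)} :
    (3 : 𝓞 K) ∈ (placeComap e w).asIdeal ↔ (3 : 𝓞 L) ∈ w.asIdeal := by
  rw [mem_placeComap, map_ofNat]

lemma rcub_placeComap {e : K ≃+* L} {w : HeightOneSpectrum (𝓞 L)} {ζ : 𝓞 K}
    (hg : Good ζ (placeComap e w)) (a : 𝓞 K) :
    rcub (RingOfIntegers.mapRingEquiv e ζ) w (RingOfIntegers.mapRingEquiv e a) =
      rcub ζ (placeComap e w) a := by
  let E : (𝓞 K ⧸ (placeComap e w).asIdeal) ≃+* (𝓞 L ⧸ w.asIdeal) :=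
    Ideal.quotientEquiv _ _ (RingOfIntegers.mapRingEquiv e)
      (Ideal.map_comap_of_surjective _ (RingOfIntegers.mapRingEquiv e).surjective _).symm
  exact fcub_equiv E hg.mk_prim (Ideal.Quotient.mk _ a)

lemma IsDec.map {e : K ≃+* L} {w : HeightOneSpectrum (𝓞 L)} {π : 𝓞 K} {x : K} {n : ℤ} {b d : 𝓞 K}
    (h : IsDec (placeComap e w) π x n b d) :
    IsDec w (RingOfIntegers.mapRingEquiv e π) (e x) n (RingOfIntegers.mapRingEquiv e b)
      (RingOfIntegers.mapRingEquiv e d) := by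
  refine ⟨h.hb, h.hd, ?_⟩
  have := congrArg e h.eq
  simpa using this

lemma tame_map (e : K ≃+* L) (w : HeightOneSpectrum (𝓞 L)) {ζ : 𝓞 K} (hζ : IsPrimitiveRoot ζ 3)
    {x y : K} (hx : x ≠ 0) (hy : y ≠ 0) :
    tame (RingOfIntegers.mapRingEquiv e ζ) w (e x) (e y) = tame ζ (placeComap e w) x y := by
  have hζ' : IsPrimitiveRoot (RingOfIntegers.mapRingEquiv e ζ) 3 :=
    hζ.map_of_injective (RingOfIntegers.mapRingEquiv e).injective
  rcases good_or hζ (placeComap e w) with h | h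
  · rw [tame_of_mem h, tame_of_mem (three_mem_placeComap.mp h)]
  have h' : Good (RingOfIntegers.mapRingEquiv e ζ) w := ⟨hζ', mt three_mem_placeComap.mpr h.three⟩
  obtain ⟨n, b, d, hd⟩ := exists_dec (placeComap e w) hx
  obtain ⟨n', b', d', hd'⟩ := exists_dec (placeComap e w) hy
  have hu2 : RingOfIntegers.mapRingEquiv e (unif (placeComap e w)) ∉ w.asIdeal ^ 2 := by
    intro hh
    apply unif_notMem (placeComap e w)
    have e1 : (placeComap e w).asIdeal = w.asIdeal.map (RingOfIntegers.mapRingEquiv e).symm :=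
      Ideal.comap_symm (RingOfIntegers.mapRingEquiv e).symm
    rw [e1, ← Ideal.map_pow]
    simpa using Ideal.mem_map_of_mem (RingOfIntegers.mapRingEquiv e).symm hh
  rw [tame_eq_of_isDec h (unif_mem _) (unif_notMem _) hx hy hd hd',
    tame_eq_of_isDec h' (mem_placeComap.mp (unif_mem _)) hu2 (by simpa) (by simpa) hd.map hd'.map]
  simp only [rcub_placeComap h]

lemma FS_map (e : K ≃+* L) {ζ : 𝓞 K} (hζ : IsPrimitiveRoot ζ 3) {x y : K} (hx : x ≠ 0) (hy : y ≠ 0) :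
    FS (RingOfIntegers.mapRingEquiv e ζ) (e x) (e y) = FS ζ x y := by
  rw [FS, FS]
  exact finsum_eq_of_bijective _ (placeComap_bijective e) (fun w => tame_map e w hζ hx hy)

end Transport

section Eval
variable {K : Type*} [Field K] [NumberField K] {ζ : 𝓞 K} {v : HeightOneSpectrum (𝓞 K)}

lemma rcub_sq (h : Good ζ v) (a : 𝓞 K) : rcub (ζ ^ 2) v a = - rcub ζ v a := by
  have h2 : IsPrimitiveRoot (Ideal.Quotient.mk v.asIdeal (ζ ^ 2)) 3 := by
    rw [map_pow]; exact h.mk_prim.pow_of_coprime 2 (by norm_num)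
  by_cases ha : a ∈ v.asIdeal
  · rw [rcub, rcub, Ideal.Quotient.eq_zero_iff_mem.mpr ha, fcub_zero, fcub_zero, neg_zero]
  · refine fcub_eq h2 (mk_ne_zero ha) ?_
    rw [fcub_spec h.mk_prim (mk_ne_zero ha), map_pow, ← pow_mul]
    change _ ^ (rcub ζ v a).val = _
    have hz := h.mk_prim.pow_eq_one
    generalize rcub ζ v a = c
    rw [← Nat.mod_add_div (2 * (-c).val) 3, pow_add, pow_mul, hz, one_pow, mul_one]
    congr 1
    revert c
    decide

lemma good_sq (h : Good ζ v) : Good (ζ ^ 2) v := ⟨h.prim.pow_of_coprime 2 (by norm_num), h.three⟩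

lemma tame_sq (hζ : IsPrimitiveRoot ζ 3) {x y : K} (hx : x ≠ 0) (hy : y ≠ 0) :
    tame (ζ ^ 2) v x y = - tame ζ v x y := by
  rcases good_or hζ v with h | h
  · rw [tame_of_mem h, tame_of_mem h, neg_zero]
  obtain ⟨n, b, d, hd⟩ := exists_dec v hx
  obtain ⟨n', b', d', hd'⟩ := exists_dec v hy
  rw [tame_eq_of_isDec h (unif_mem _) (unif_notMem _) hx hy hd hd',
    tame_eq_of_isDec (good_sq h) (unif_mem _) (unif_notMem _) hx hy hd hd']
  simp only [rcub_sq h]; ring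

lemma FS_sq (hζ : IsPrimitiveRoot ζ 3) {x y : K} (hx : x ≠ 0) (hy : y ≠ 0) :
    FS (ζ ^ 2) x y = - FS ζ x y := by
  rw [FS, FS, ← finsum_neg_distrib]
  exact finsum_congr fun _ => tame_sq hζ hx hy

open Classical in
/-- The cubic residue symbol of `a` modulo the prime-to-`3` part of `b`, written additively. -/
noncomputable def SS (ζ a b : 𝓞 K) : ZMod 3 :=
  ∑ᶠ v : HeightOneSpectrum (𝓞 K), if (3 : 𝓞 K) ∈ v.asIdeal then 0 else rcub ζ v a * ord v (b : K)

lemma coprime_notMem {a b : 𝓞 K} (hab : IsCoprime a b) (ha : a ∈ v.asIdeal) : b ∉ v.asIdeal := by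
  intro hb
  obtain ⟨r, s, h⟩ := hab
  apply one_notMem v
  rw [← h]
  exact add_mem (Ideal.mul_mem_left _ _ ha) (Ideal.mul_mem_left _ _ hb)

lemma coprime_of_forall {a b : 𝓞 K} (ha : a ≠ 0)
    (h : ∀ v : HeightOneSpectrum (𝓞 K), a ∈ v.asIdeal → b ∉ v.asIdeal) : IsCoprime a b := by
  rw [← Ideal.isCoprime_span_singleton_iff, Ideal.isCoprime_iff_sup_eq]
  by_contra hne
  obtain ⟨m, hm, hle⟩ := Ideal.exists_le_maximal _ hne
  have hma : a ∈ m := hle (Ideal.mem_sup_left (Ideal.mem_span_singleton_self a))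
  have hmb : b ∈ m := hle (Ideal.mem_sup_right (Ideal.mem_span_singleton_self b))
  exact h ⟨m, hm.isPrime, fun hb => ha (by rw [hb] at hma; simpa using hma)⟩ hma hmb

lemma finite_SS (ζ a : 𝓞 K) {b : 𝓞 K} (hb : b ≠ 0) : (Function.support fun
    v : HeightOneSpectrum (𝓞 K) => (open Classical in if (3 : 𝓞 K) ∈ v.asIdeal then (0 : ZMod 3)
      else rcub ζ v a * ord v (b : K))).Finite := by
  refine (finite_ord (K := K) (x := b) (by exact_mod_cast hb)).subset ?_
  intro v hv hcon
  apply hv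
  change ord v (b : K) = 0 at hcon
  simp [hcon]

lemma FS_eq_SS (hζ : IsPrimitiveRoot ζ 3) {a b : 𝓞 K} (ha : a ≠ 0) (hb : b ≠ 0)
    (hab : IsCoprime a b) : FS ζ (a : K) b = SS ζ a b - SS ζ b a := by
  rw [FS, SS, SS, ← finsum_sub_distrib (finite_SS ζ a hb) (finite_SS ζ b ha)]
  refine finsum_congr fun v => ?_
  rcases good_or hζ v with h | h
  · rw [tame_of_mem h, if_pos h, if_pos h, sub_zero]
  rw [tame_of_good h, if_neg h.three, if_neg h.three]
  by_cases hav : a ∈ v.asIdeal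
  · have hbv := coprime_notMem hab hav
    rw [ord_of_notMem hbv, lg_of_notMem h hbv]; simp; ring
  · rw [ord_of_notMem hav, lg_of_notMem h hav]
    by_cases hbv : b ∈ v.asIdeal
    · simp
    · rw [ord_of_notMem hbv]; simp

lemma SS_mul_left (hζ : IsPrimitiveRoot ζ 3) {a a' b : 𝓞 K} (hb : b ≠ 0) (ha : IsCoprime a b)
    (ha' : IsCoprime a' b) : SS ζ (a * a') b = SS ζ a b + SS ζ a' b := by
  rw [SS, SS, SS, ← finsum_add_distrib (finite_SS ζ a hb) (finite_SS ζ a' hb)]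
  refine finsum_congr fun v => ?_
  rcases good_or hζ v with h | h
  · simp [h]
  simp only [if_neg h.three]
  by_cases hbv : b ∈ v.asIdeal
  · rw [rcub_mul h (coprime_notMem ha.symm hbv) (coprime_notMem ha'.symm hbv)]; ring
  · rw [ord_of_notMem hbv]; simp

lemma SS_mul_right {a b b' : 𝓞 K} (hb : b ≠ 0) (hb' : b' ≠ 0) :
    SS ζ a (b * b') = SS ζ a b + SS ζ a b' := by
  rw [SS, SS, SS, ← finsum_add_distrib (finite_SS ζ a hb) (finite_SS ζ a hb')]
  refine finsum_congr fun v => ?_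
  split_ifs
  · simp
  · push_cast
    rw [ord_mul v (by exact_mod_cast hb) (by exact_mod_cast hb')]; push_cast; ring

lemma SS_congr {a a' b : 𝓞 K} (h : b ∣ a - a') : SS ζ a b = SS ζ a' b := by
  refine finsum_congr fun v => ?_
  split_ifs
  · rfl
  by_cases hbv : b ∈ v.asIdeal
  · rw [rcub_congr (ζ := ζ) (Ideal.mem_of_dvd _ h hbv)]
  · rw [ord_of_notMem hbv]; simp

lemma SS_one_left (hζ : IsPrimitiveRoot ζ 3) (b : 𝓞 K) : SS ζ 1 b = 0 := by
  rw [SS, ← finsum_zero (α := HeightOneSpectrum (𝓞 K))]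
  refine finsum_congr fun v => ?_
  rcases good_or hζ v with h | h
  · simp [h]
  · rw [rcub_one h]; simp

end Eval

end CubicRec

namespace CubicRec
set_option linter.unusedSectionVars false
open IsDedekindDomain Polynomial

section Res
variable {R S : Type*} [CommRing R] [CommRing S]

/-- The resultant in its natural degrees. -/
noncomputable def res (f g : R[X]) : R := resultant f g

lemma res_eq {f : R[X]} (hf : f.Monic) (g : R[X]) {n : ℕ} (hn : g.natDegree ≤ n) :
    resultant f g f.natDegree n = res f g := by
  obtain ⟨k, rfl⟩ := Nat.exists_eq_add_of_le hn
  rw [resultant_add_right_deg _ _ _ _ _ le_rfl, hf.coeff_natDegree, one_pow, one_mul, res]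

lemma res_map {f : R[X]} (hf : f.Monic) (g : R[X]) (φ : R →+* S) :
    φ (res f g) = res (f.map φ) (g.map φ) := by
  nontriviality S
  rw [← res_eq (hf.map φ) (g.map φ) natDegree_map_le, hf.natDegree_map, resultant_map_map, res]

lemma res_mul_right {f : R[X]} (hf : f.Monic) (g h : R[X]) : res f (g * h) = res f g * res f h := by
  rw [← res_eq hf (g * h) natDegree_mul_le, resultant_mul_right _ _ _ _ le_rfl]; rfl

lemma res_C (f : R[X]) (r : R) : res f (C r) = r ^ f.natDegree := by
  rw [res, natDegree_C, resultant_C_zero_right]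

lemma res_one (f : R[X]) : res f 1 = 1 := by rw [← C_1, res_C, one_pow]

lemma res_C_mul {f : R[X]} (hf : f.Monic) (r : R) (g : R[X]) :
    res f (C r * g) = r ^ f.natDegree * res f g := by rw [res_mul_right hf, res_C]

lemma res_add_mul {f : R[X]} (hf : f.Monic) (g p : R[X]) : res f (g + f * p) = res f g := by
  have h1 : (g + f * p).natDegree ≤ g.natDegree + (f.natDegree + p.natDegree) :=
    natDegree_add_le_of_degree_le (by omega) (natDegree_mul_le.trans (by omega))
  rw [← res_eq hf _ h1, ← res_eq hf g (n := g.natDegree + (f.natDegree + p.natDegree)) (by omega),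
    resultant_add_mul_right _ _ _ _ _ (by omega) le_rfl]

lemma res_mul_left [Nontrivial R] {f g : R[X]} (hf : f.Monic) (hg : g.Monic) (h : R[X]) :
    res (f * g) h = res f h * res g h := by
  rw [res, res, res, hf.natDegree_mul hg, resultant_mul_left _ _ _ _ le_rfl]

lemma res_pow_left [Nontrivial R] {f : R[X]} (hf : f.Monic) (g : R[X]) (n : ℕ) :
    res (f ^ n) g = res f g ^ n := by
  induction n with
  | zero => rw [pow_zero, pow_zero, res, natDegree_one, resultant_zero_left_deg]; simp
  | succ n ih => rw [pow_succ, res_mul_left (hf.pow n) hf, ih, pow_succ]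

lemma res_X_sub_C [Nontrivial R] (r : R) (g : R[X]) : res (X - C r) g = g.eval r := by
  rw [res, natDegree_X_sub_C, resultant_X_sub_C_left _ _ _ le_rfl]

lemma res_X [Nontrivial R] (g : R[X]) : res X g = g.eval 0 := by simpa using res_X_sub_C 0 g

lemma res_comm (f g : R[X]) : ∃ k : ℕ, res f g = (-1) ^ k * res g f :=
  ⟨_, resultant_comm _ _ _ _⟩

lemma det_aeval {K ι : Type*} [Field K] [Fintype ι] [DecidableEq ι] (A : Matrix ι ι K) (f : K[X]) :
    (aeval A f).det = res A.charpoly f := by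
  have key : ∀ {E : Type _} [Field E] (A : Matrix ι ι E) (s : Multiset E) (c : E),
      (aeval A (C c * (s.map fun r => X - C r).prod)).det = res A.charpoly (C c * (s.map fun r => X - C r).prod) := by
    intro E _ A s c
    have hm := A.charpoly_monic
    rw [res_C_mul hm, map_mul, Matrix.det_mul, aeval_C, A.charpoly_natDegree_eq_dim]
    congr 1
    · rw [Matrix.algebraMap_eq_diagonal, Matrix.det_diagonal]; simp
    · induction s using Multiset.induction_on with
      | empty => simp [res_one]
      | cons r s ih =>
        rw [Multiset.map_cons, Multiset.prod_cons, map_mul, Matrix.det_mul, ih, res_mul_right hm]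
        congr 1
        rw [res, natDegree_X_sub_C, resultant_X_sub_C_right _ _ _ le_rfl,
          A.charpoly_natDegree_eq_dim, Matrix.eval_charpoly, ← Matrix.det_neg]
        simp [Matrix.algebraMap_eq_diagonal, Matrix.scalar_apply]
        rfl
  let φ := algebraMap K (AlgebraicClosure K)
  apply φ.injective
  rw [res_map A.charpoly_monic, ← Matrix.charpoly_map, RingHom.map_det]
  have hs := (IsAlgClosed.splits (f.map φ)).eq_prod_roots
  have h2 : φ.mapMatrix (aeval A f) = aeval (A.map φ) (f.map φ) := by
    have := Polynomial.hom_eval₂ f (algebraMap K _) (φ.mapMatrix (m := ι)) A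
    rw [aeval_def, this, aeval_def, eval₂_map]
    congr 1
    ext c i j
    by_cases hij : i = j <;> simp [Matrix.algebraMap_eq_diagonal, hij]
  rw [h2, hs]
  exact key _ _ _

lemma norm_aeval {K L : Type*} [Field K] [Field L] [Algebra K L] [FiniteDimensional K L] (s : L)
    (f : K[X]) : Algebra.norm K (aeval s f) =
      res (minpoly K s ^ Module.finrank (IntermediateField.adjoin K {s}) L) f := by
  classical
  have hs : IsIntegral K s := Algebra.IsIntegral.isIntegral s
  let pb := IntermediateField.adjoin.powerBasis hs
  have h1 : aeval s f = algebraMap (IntermediateField.adjoin K {s}) L (aeval pb.gen f) := by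
    rw [← aeval_algebraMap_apply]; rfl
  rw [h1, ← Algebra.norm_norm (S := IntermediateField.adjoin K {s}), Algebra.norm_algebraMap, map_pow,
    res_pow_left (minpoly.monic hs)]
  congr 1
  rw [Algebra.norm_eq_matrix_det pb.basis, ← Polynomial.aeval_algHom_apply, det_aeval,
    charpoly_leftMulMatrix]
  congr 1
  exact IntermediateField.minpoly_gen K s
end Res
end CubicRec

namespace CubicRec
set_option linter.unusedSectionVars false
open IsDedekindDomain Polynomial UniqueFactorizationMonoid

variable {B K : Type*} [Field B] [NumberField B] [Field K] [NumberField K] [Algebra B K]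

/-- The place of the base field below a given one. -/
noncomputable def below (B : Type*) [Field B] [NumberField B] [Algebra B K]
    (w : HeightOneSpectrum (𝓞 K)) : HeightOneSpectrum (𝓞 B) where
  asIdeal := w.asIdeal.under (𝓞 B)
  isPrime := inferInstance
  ne_bot := Ideal.IsIntegral.comap_ne_bot _ w.ne_bot

lemma mem_below {w : HeightOneSpectrum (𝓞 K)} {a : 𝓞 B} :
    a ∈ (below B w).asIdeal ↔ algebraMap (𝓞 B) (𝓞 K) a ∈ w.asIdeal := Iff.rfl

instance below_liesOver (w : HeightOneSpectrum (𝓞 K)) : w.asIdeal.LiesOver (below B w).asIdeal := ⟨rfl⟩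

lemma finite_above (v : HeightOneSpectrum (𝓞 B)) :
    {w : HeightOneSpectrum (𝓞 K) | below B w = v}.Finite := by
  refine (finite_mem (a := algebraMap (𝓞 B) (𝓞 K) (unif v)) ?_).subset ?_
  · exact fun h => unif_ne_zero v (FaithfulSMul.algebraMap_injective (𝓞 B) (𝓞 K) (by simpa using h))
  · rintro w rfl
    exact unif_mem (below B w)

/-- The places above a given one. -/
noncomputable def above (K : Type*) [Field K] [NumberField K] [Algebra B K]
    (v : HeightOneSpectrum (𝓞 B)) : Finset (HeightOneSpectrum (𝓞 K)) := (finite_above v).toFinset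

lemma mem_above {v : HeightOneSpectrum (𝓞 B)} {w : HeightOneSpectrum (𝓞 K)} :
    w ∈ above K v ↔ below B w = v := by simp [above]

/-- The residue degree. -/
noncomputable def fdeg (B : Type*) [Field B] [NumberField B] [Algebra B K]
    (w : HeightOneSpectrum (𝓞 K)) : ℕ :=
  Module.finrank (𝓞 B ⧸ (below B w).asIdeal) (𝓞 K ⧸ w.asIdeal)

lemma relNorm_place (w : HeightOneSpectrum (𝓞 K)) :
    Ideal.relNorm (𝓞 B) w.asIdeal = (below B w).asIdeal ^ fdeg B w := by
  have := w.isMaximal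
  have := (below B w).isMaximal
  rw [Ideal.relNorm_eq_pow_of_isMaximal w.asIdeal (below B w).asIdeal,
    Ideal.inertiaDeg_eq_of_isMaximal (below B w).asIdeal]
  rfl

lemma ord_eq_count (v : HeightOneSpectrum (𝓞 B)) {a : 𝓞 B} (ha : a ≠ 0) :
    ord v (a : B) = ((normalizedFactors (Ideal.span {a})).count v.asIdeal : ℕ) := by
  have h0 := ord_nonneg (v := v) ha
  obtain ⟨n, hn⟩ := Int.eq_ofNat_of_zero_le h0
  rw [hn]
  norm_cast
  symm
  refine count_normalizedFactors_eq v.irreducible (normalize_eq _) ?_ ?_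
  · rw [Ideal.dvd_span_singleton, mem_pow_iff ha, hn]
  · rw [Ideal.dvd_span_singleton, mem_pow_iff ha, hn]; push_cast; omega

lemma count_relNorm (v : HeightOneSpectrum (𝓞 B)) {I : Ideal (𝓞 K)} (hI : I ≠ 0) :
    (normalizedFactors (Ideal.relNorm (𝓞 B) I)).count v.asIdeal =
      ∑ w ∈ above K v, fdeg B w * (normalizedFactors I).count w.asIdeal := by
  have hne : ∀ {I : Ideal (𝓞 K)}, I ≠ 0 → Ideal.relNorm (𝓞 B) I ≠ 0 := fun h h' =>
    h (Ideal.relNorm_eq_bot_iff.mp h')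
  induction I using induction_on_prime with
  | h₁ => exact absurd rfl hI
  | h₂ I h =>
    rw [Ideal.isUnit_iff.mp h, Ideal.relNorm_top, ← Ideal.one_eq_top, ← Ideal.one_eq_top,
      normalizedFactors_one, normalizedFactors_one]
    simp
  | h₃ I P hI0 hP ih =>
    let w : HeightOneSpectrum (𝓞 K) := ⟨P, Ideal.isPrime_of_prime hP, hP.ne_zero⟩
    have hw : P = w.asIdeal := rfl
    rw [map_mul, normalizedFactors_mul (hne hP.ne_zero) (hne hI0), normalizedFactors_mul hP.ne_zero hI0,
      Multiset.count_add, ih hI0]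
    simp only [Multiset.count_add, mul_add, Finset.sum_add_distrib]
    congr 1
    rw [hw, relNorm_place, normalizedFactors_pow, normalizedFactors_irreducible w.irreducible,
      normalizedFactors_irreducible (below B w).irreducible, normalize_eq, normalize_eq,
      Multiset.count_nsmul]
    simp only [Multiset.count_singleton]
    by_cases h : below B w = v
    · rw [if_pos (by rw [h]), Finset.sum_eq_single w]
      · simp
      · intro w' _ hw'
        rw [if_neg (fun h => hw' (HeightOneSpectrum.ext h)), mul_zero]
      · exact fun h' => absurd (mem_above.mpr h) h'
    · rw [if_neg (fun h' => h (HeightOneSpectrum.ext h'.symm)), mul_zero, Finset.sum_eq_zero]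
      intro w' hw'
      rw [if_neg, mul_zero]
      exact fun h' => h ((HeightOneSpectrum.ext h' : w' = w) ▸ mem_above.mp hw')

lemma coe_intNorm (z : 𝓞 K) : ((Algebra.intNorm (𝓞 B) (𝓞 K) z : 𝓞 B) : B) = Algebra.norm B (z : K) :=
  Algebra.algebraMap_intNorm (A := 𝓞 B) (B := 𝓞 K) (K := B) (L := K) z

lemma norm_ne_zero' {z : K} (hz : z ≠ 0) : Algebra.norm B z ≠ 0 := Algebra.norm_ne_zero_iff.mpr hz

lemma ord_norm (v : HeightOneSpectrum (𝓞 B)) {z : K} (hz : z ≠ 0) :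
    ord v (Algebra.norm B z) = ∑ w ∈ above K v, (fdeg B w : ℤ) * ord w z := by
  have key : ∀ z : 𝓞 K, z ≠ 0 →
      ord v (Algebra.norm B (z : K)) = ∑ w ∈ above K v, (fdeg B w : ℤ) * ord w (z : K) := by
    intro z hz
    have hzK : (z : K) ≠ 0 := by exact_mod_cast hz
    have hN : Algebra.intNorm (𝓞 B) (𝓞 K) z ≠ 0 := by
      intro h
      have := coe_intNorm (B := B) z
      rw [h] at this
      exact norm_ne_zero' (B := B) hzK (by simpa using this.symm)
    rw [← coe_intNorm, ord_eq_count v hN, ← Ideal.relNorm_singleton, count_relNorm v (by simpa using hz)]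
    push_cast
    exact Finset.sum_congr rfl fun w _ => by rw [ord_eq_count w hz]
  obtain ⟨r, s, hs, rfl⟩ := IsFractionRing.div_surjective (𝓞 K) z
  have hs0 : s ≠ 0 := nonZeroDivisors.ne_zero hs
  have hr0 : r ≠ 0 := by rintro rfl; simp at hz
  have hsK : (s : K) ≠ 0 := by exact_mod_cast hs0
  have hrK : (r : K) ≠ 0 := by exact_mod_cast hr0
  change ord v (Algebra.norm B ((r : K) / s)) = ∑ w ∈ above K v, (fdeg B w : ℤ) * ord w ((r : K) / s)
  rw [div_eq_mul_inv, map_mul, Algebra.norm_inv, ord_mul v (norm_ne_zero' hrK) (inv_ne_zero (norm_ne_zero' hsK)),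
    ord_inv (norm_ne_zero' hsK), key r hr0, key s hs0, ← sub_eq_add_neg, ← Finset.sum_sub_distrib]
  exact Finset.sum_congr rfl fun w _ => by
    rw [ord_mul w hrK (inv_ne_zero hsK), ord_inv hsK]; ring
lemma coe_algebraMap (x : 𝓞 B) : ((algebraMap (𝓞 B) (𝓞 K) x : 𝓞 K) : K) = algebraMap B K x := rfl

lemma sum_ord_unif (v : HeightOneSpectrum (𝓞 B)) :
    ∑ w ∈ above K v, (fdeg B w : ℤ) * ord w (algebraMap B K (unif v : B)) = Module.finrank B K := by
  have hv : (unif v : B) ≠ 0 := by exact_mod_cast unif_ne_zero v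
  rw [← ord_norm v (by simpa using hv), Algebra.norm_algebraMap, ord_pow hv, ord_unif, mul_one]

lemma exists_mem_of_intNorm_mem (v : HeightOneSpectrum (𝓞 B)) {z : 𝓞 K}
    (h : Algebra.intNorm (𝓞 B) (𝓞 K) z ∈ v.asIdeal) : ∃ w ∈ above K v, z ∈ w.asIdeal := by
  by_contra! hc
  rcases eq_or_ne z 0 with rfl | hz
  · have := sum_ord_unif (K := K) v
    rw [Finset.sum_eq_zero (fun w hw => absurd (zero_mem _) (hc w hw))] at this
    exact Module.finrank_pos.ne' (by exact_mod_cast this.symm : Module.finrank B K = 0)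
  · have hzK : (z : K) ≠ 0 := by exact_mod_cast hz
    have hN : Algebra.intNorm (𝓞 B) (𝓞 K) z ≠ 0 := by
      intro h
      have := coe_intNorm (B := B) z
      rw [h] at this
      exact norm_ne_zero' (B := B) hzK (by simpa using this.symm)
    rw [mem_iff hN, coe_intNorm, ord_norm v hzK] at h
    exact h (Finset.sum_eq_zero fun w hw => by rw [ord_of_notMem (hc w hw), mul_zero])

/-- The characteristic polynomial of an algebraic integer over the base. -/
noncomputable def qpol (B : Type*) [Field B] [NumberField B] [Algebra B K] (s : 𝓞 K) : (𝓞 B)[X] :=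
  minpoly (𝓞 B) s ^ Module.finrank (IntermediateField.adjoin B {(s : K)}) K

lemma qpol_monic (s : 𝓞 K) : (qpol B s).Monic := (minpoly.monic (Algebra.IsIntegral.isIntegral s)).pow _

lemma qpol_map (s : 𝓞 K) : (qpol B s).map (algebraMap (𝓞 B) B) =
    minpoly B (s : K) ^ Module.finrank (IntermediateField.adjoin B {(s : K)}) K := by
  rw [qpol, Polynomial.map_pow]
  congr 1
  exact (minpoly.isIntegrallyClosed_eq_field_fractions B K (Algebra.IsIntegral.isIntegral s)).symm

lemma natDegree_qpol (s : 𝓞 K) : (qpol B s).natDegree = Module.finrank B K := by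
  have hs : IsIntegral B (s : K) := Algebra.IsIntegral.isIntegral _
  rw [← (qpol_monic s).natDegree_map (algebraMap (𝓞 B) B), qpol_map, natDegree_pow,
    ← IntermediateField.adjoin.finrank hs, mul_comm, Module.finrank_mul_finrank]

lemma aeval_qpol (s : 𝓞 K) : aeval s (qpol B s) = 0 := by
  rw [qpol, map_pow, minpoly.aeval, zero_pow Module.finrank_pos.ne']

lemma coe_aeval (s : 𝓞 K) (f : (𝓞 B)[X]) :
    ((aeval s f : 𝓞 K) : K) = aeval (s : K) (f.map (algebraMap (𝓞 B) B)) := by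
  rw [aeval_map_algebraMap]
  exact (aeval_algebraMap_apply K s f).symm

lemma intNorm_aeval (s : 𝓞 K) (f : (𝓞 B)[X]) :
    Algebra.intNorm (𝓞 B) (𝓞 K) (aeval s f) = res (qpol B s) f := by
  apply FaithfulSMul.algebraMap_injective (𝓞 B) B
  rw [res_map (qpol_monic s), qpol_map, ← norm_aeval, ← coe_aeval]
  exact coe_intNorm _

lemma good_above {ζ : 𝓞 B} {v : HeightOneSpectrum (𝓞 B)} (hg : Good ζ v)
    {w : HeightOneSpectrum (𝓞 K)} (hw : w ∈ above K v) : Good (algebraMap (𝓞 B) (𝓞 K) ζ) w := by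
  rw [mem_above] at hw
  subst hw
  refine ⟨hg.prim.map_of_injective (FaithfulSMul.algebraMap_injective (𝓞 B) (𝓞 K)), fun h => hg.three ?_⟩
  rwa [mem_below, map_ofNat]

lemma notMem_above {v : HeightOneSpectrum (𝓞 B)} {w : HeightOneSpectrum (𝓞 K)} (hw : w ∈ above K v)
    {a : 𝓞 B} : algebraMap (𝓞 B) (𝓞 K) a ∈ w.asIdeal ↔ a ∈ v.asIdeal := by
  rw [mem_above] at hw
  subst hw
  rfl

lemma rcub_algebraMap {ζ : 𝓞 B} {v : HeightOneSpectrum (𝓞 B)} (hg : Good ζ v)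
    {w : HeightOneSpectrum (𝓞 K)} (hw : w ∈ above K v) {a : 𝓞 B} (ha : a ∉ v.asIdeal) :
    rcub (algebraMap (𝓞 B) (𝓞 K) ζ) w (algebraMap (𝓞 B) (𝓞 K) a) = fdeg B w * rcub ζ v a := by
  rw [mem_above] at hw
  subst hw
  exact fcub_algebraMap hg.mk_prim (mk_ne_zero ha)

lemma ord_lg_algebraMap {ζ : 𝓞 B} {v : HeightOneSpectrum (𝓞 B)} (hg : Good ζ v)
    {w : HeightOneSpectrum (𝓞 K)} (hw : w ∈ above K v) {x : B} (hx : x ≠ 0) :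
    ord w (algebraMap B K x) = ord v x * ord w (algebraMap B K (unif v : B)) ∧
    lg (algebraMap (𝓞 B) (𝓞 K) ζ) w (algebraMap B K x) =
      ord v x * lg (algebraMap (𝓞 B) (𝓞 K) ζ) w (algebraMap B K (unif v : B)) + fdeg B w * lg ζ v x := by
  have hg' := good_above hg hw
  obtain ⟨n, b, d, h⟩ := exists_dec v hx
  have hb : algebraMap (𝓞 B) (𝓞 K) b ∉ w.asIdeal := fun h' => h.hb ((notMem_above hw).mp h')
  have hd : algebraMap (𝓞 B) (𝓞 K) d ∉ w.asIdeal := fun h' => h.hd ((notMem_above hw).mp h')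
  have hbK := coe_ne_zero_of_notMem hb
  have hdK := coe_ne_zero_of_notMem hd
  have hπ : (algebraMap B K (unif v : B)) ≠ 0 := by
    simpa using unif_ne_zero v
  have e := congrArg (algebraMap B K) h.eq
  rw [map_mul, map_mul, map_zpow₀, ← coe_algebraMap, ← coe_algebraMap (K := K) b] at e
  have hxK : algebraMap B K x ≠ 0 := by simpa using hx
  have e1 := congrArg (ord w) e
  have e2 := congrArg (lg (algebraMap (𝓞 B) (𝓞 K) ζ) w) e
  rw [ord_mul w hxK hdK, ord_mul w (zpow_ne_zero _ hπ) hbK, ord_zpow hπ, ord_of_notMem hb,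
    ord_of_notMem hd] at e1
  rw [lg_mul hg' hxK hdK, lg_mul hg' (zpow_ne_zero _ hπ) hbK, lg_zpow hg' hπ, lg_of_notMem hg' hb,
    lg_of_notMem hg' hd, rcub_algebraMap hg hw h.hb, rcub_algebraMap hg hw h.hd] at e2
  rw [ord_eq h, lg_eq hg h]
  constructor
  · linarith
  · linear_combination e2

lemma exists_eq_pow_mul_pow {k : Type*} [Field k] {P₁ P₂ : k[X]} (Q : k[X]) (hQ : Q.Monic)
    (h : ∀ R : k[X], R.Monic → Irreducible R → R ∣ Q → R = P₁ ∨ R = P₂) :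
    ∃ a b : ℕ, Q = P₁ ^ a * P₂ ^ b := by
  induction hn : Q.natDegree using Nat.strong_induction_on generalizing Q with
  | _ n ih =>
  subst hn
  by_cases h1 : IsUnit Q
  · exact ⟨0, 0, by simp [hQ.eq_one_of_isUnit h1]⟩
  obtain ⟨R, hR, hRi, S, rfl⟩ := Polynomial.exists_monic_irreducible_factor Q h1
  have hS := hR.of_mul_monic_left hQ
  obtain ⟨a, b, hab⟩ := ih S.natDegree (by
    rw [hR.natDegree_mul hS]; have := hRi.natDegree_pos; omega) S hS
    (fun T hT hTi hTd => h T hT hTi (hTd.mul_left _)) rfl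
  rcases h R hR hRi (Dvd.intro _ rfl) with rfl | rfl
  · exact ⟨a + 1, b, by rw [hab]; ring⟩
  · exact ⟨a, b + 1, by rw [hab]; ring⟩

/-- The logarithmic form of the compatibility of tame symbols with norms, at `z`. -/
def NormCompat (ζ : 𝓞 B) (v : HeightOneSpectrum (𝓞 B)) (z : K) : Prop :=
  lg ζ v (Algebra.norm B z) = ∑ w ∈ above K v,
    ((ord w (algebraMap B K (unif v : B)) : ZMod 3) * lg (algebraMap (𝓞 B) (𝓞 K) ζ) w z -
      lg (algebraMap (𝓞 B) (𝓞 K) ζ) w (algebraMap B K (unif v : B)) * ord w z)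

variable {ζ : 𝓞 B} {v : HeightOneSpectrum (𝓞 B)}

lemma NormCompat.mul (hg : Good ζ v) {y z : K} (hy : y ≠ 0) (hz : z ≠ 0) (h : NormCompat ζ v y)
    (h' : NormCompat ζ v z) : NormCompat ζ v (y * z) := by
  rw [NormCompat] at *
  rw [map_mul, lg_mul hg (norm_ne_zero' hy) (norm_ne_zero' hz), h, h', ← Finset.sum_add_distrib]
  refine Finset.sum_congr rfl fun w hw => ?_
  rw [lg_mul (good_above hg hw) hy hz, ord_mul w hy hz]
  push_cast; ring

lemma NormCompat.one (hg : Good ζ v) : NormCompat ζ v (1 : K) := by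
  rw [NormCompat, map_one, lg_one hg]
  exact (Finset.sum_eq_zero fun w hw => by rw [lg_one (good_above hg hw), ord_one]; simp).symm

lemma NormCompat.inv (hg : Good ζ v) {z : K} (hz : z ≠ 0) (h : NormCompat ζ v z) :
    NormCompat ζ v z⁻¹ := by
  rw [NormCompat] at *
  rw [Algebra.norm_inv, lg_inv hg (norm_ne_zero' hz), h, ← Finset.sum_neg_distrib]
  refine Finset.sum_congr rfl fun w hw => ?_
  rw [lg_inv (good_above hg hw) hz, ord_inv hz]
  push_cast; ring

lemma NormCompat.zpow (hg : Good ζ v) {z : K} (hz : z ≠ 0) (h : NormCompat ζ v z) (n : ℤ) :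
    NormCompat ζ v (z ^ n) := by
  have key : ∀ n : ℕ, NormCompat ζ v (z ^ n) := by
    intro n
    induction n with
    | zero => rw [pow_zero]; exact .one hg
    | succ n ih => rw [pow_succ]; exact ih.mul hg (pow_ne_zero _ hz) hz h
  obtain ⟨n, rfl | rfl⟩ := n.eq_nat_or_neg
  · rw [zpow_natCast]; exact key n
  · rw [zpow_neg, zpow_natCast]; exact (key n).inv hg (pow_ne_zero _ hz)

lemma NormCompat.prod (hg : Good ζ v) {ι : Type*} (s : Finset ι) (f : ι → K) (hf : ∀ i ∈ s, f i ≠ 0)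
    (h : ∀ i ∈ s, NormCompat ζ v (f i)) : NormCompat ζ v (∏ i ∈ s, f i) := by
  classical
  induction s using Finset.induction_on with
  | empty => rw [Finset.prod_empty]; exact .one hg
  | insert i s hi ih =>
    rw [Finset.prod_insert hi]
    simp only [Finset.mem_insert, forall_eq_or_imp] at hf h
    exact h.1.mul hg hf.1 (Finset.prod_ne_zero_iff.mpr hf.2) (ih hf.2 h.2)

lemma exists_lift_monic (v : HeightOneSpectrum (𝓞 B)) {R : (𝓞 B ⧸ v.asIdeal)[X]} (hR : R.Monic) :
    ∃ Ψ : (𝓞 B)[X], Ψ.map (Ideal.Quotient.mk v.asIdeal) = R ∧ Ψ.Monic := by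
  obtain ⟨Ψ, hΨ, -, hΨm⟩ := lifts_and_natDegree_eq_and_monic
    (f := Ideal.Quotient.mk v.asIdeal) (p := R) (by
      rw [lifts_iff_coeff_lifts]; exact fun n => Ideal.Quotient.mk_surjective _) hR
  exact ⟨Ψ, hΨ, hΨm⟩

lemma exists_aeval_mem (s : 𝓞 K) {R : (𝓞 B ⧸ v.asIdeal)[X]} (hRi : Irreducible R)
    (hd : R ∣ (qpol B s).map (Ideal.Quotient.mk v.asIdeal)) {Ψ : (𝓞 B)[X]}
    (hΨ : Ψ.map (Ideal.Quotient.mk v.asIdeal) = R) : ∃ w ∈ above K v, aeval s Ψ ∈ w.asIdeal := by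
  apply exists_mem_of_intNorm_mem v
  rw [← Ideal.Quotient.eq_zero_iff_mem, intNorm_aeval, res_map (qpol_monic s), hΨ, res,
    resultant_eq_zero_iff]
  exact ⟨Or.inr hRi.ne_zero, fun hc => hRi.not_isUnit (IsCoprime.isUnit_of_dvd' hc hd dvd_rfl)⟩

lemma algebraMap_eval_zero (Ψ : (𝓞 B)[X]) :
    algebraMap (𝓞 B) (𝓞 K) (Ψ.eval 0) = aeval 0 Ψ := by
  rw [← map_zero (algebraMap (𝓞 B) (𝓞 K)), aeval_algebraMap_apply]; simp

lemma aeval_sub_mem (s s' : 𝓞 K) (Ψ : (𝓞 B)[X]) {I : Ideal (𝓞 K)} (h : s - s' ∈ I) :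
    aeval s Ψ - aeval s' Ψ ∈ I := by
  rw [← eval_map_algebraMap, ← eval_map_algebraMap]
  exact Ideal.mem_of_dvd _ (sub_dvd_eval_sub _ _ _) h

lemma eq_X_of_aeval_mem {s : 𝓞 K} {w : HeightOneSpectrum (𝓞 K)} (hw : w ∈ above K v)
    (hs : s ∈ w.asIdeal) {R : (𝓞 B ⧸ v.asIdeal)[X]} (hR : R.Monic) (hRi : Irreducible R)
    {Ψ : (𝓞 B)[X]} (hΨ : Ψ.map (Ideal.Quotient.mk v.asIdeal) = R) (h : aeval s Ψ ∈ w.asIdeal) :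
    R = X := by
  have h1 : Ψ.eval 0 ∈ v.asIdeal := by
    rw [← notMem_above hw, algebraMap_eval_zero]
    simpa using sub_mem h (aeval_sub_mem s 0 Ψ (by simpa using hs))
  have h3 : X ∣ R := by
    rw [X_dvd_iff, ← hΨ, coeff_map, Ideal.Quotient.eq_zero_iff_mem, coeff_zero_eq_eval_zero]
    exact h1
  exact (eq_of_monic_of_associated monic_X hR (irreducible_X.associated_of_dvd hRi h3)).symm

lemma NormCompat.of_sub_one_mem (hg : Good ζ v) {z : 𝓞 K} (h : ∀ w ∈ above K v, z - 1 ∈ w.asIdeal) :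
    NormCompat ζ v (z : K) := by
  have hz : ∀ w ∈ above K v, z ∉ w.asIdeal := fun w hw hz =>
    one_notMem w (by simpa using sub_mem hz (h w hw))
  have hN : Algebra.intNorm (𝓞 B) (𝓞 K) z - 1 ∈ v.asIdeal := by
    let q := qpol B (z - 1)
    have e : z = aeval (z - 1) (1 + X : (𝓞 B)[X]) := by simp
    let φ := Ideal.Quotient.mk v.asIdeal
    have hq : q.map φ = X ^ (Module.finrank B K) := by
      obtain ⟨a, b, hab⟩ := exists_eq_pow_mul_pow (P₁ := X) (P₂ := X) (q.map φ) ((qpol_monic _).map φ) (by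
        intro R hR hRi hRd
        refine or_self_iff.mpr ?_
        obtain ⟨Ψ, hΨ, -⟩ := exists_lift_monic v hR
        obtain ⟨w, hw, hm⟩ := exists_aeval_mem _ hRi hRd hΨ
        exact eq_X_of_aeval_mem hw (h w hw) hR hRi hΨ hm)
      rw [← pow_add] at hab
      rw [hab]
      have := congrArg natDegree hab
      rw [(qpol_monic _).natDegree_map, natDegree_qpol, natDegree_X_pow] at this
      rw [this]
    rw [← Ideal.Quotient.eq_zero_iff_mem, map_sub, map_one]
    conv_lhs => rw [e]
    rw [intNorm_aeval, res_map (qpol_monic _), hq, res_pow_left monic_X, res_X]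
    simp
  rw [NormCompat, ← coe_intNorm, lg_of_notMem hg (fun h' => one_notMem v (by simpa using sub_mem h' hN)),
    rcub_congr hN, rcub_one hg]
  refine (Finset.sum_eq_zero fun w hw => ?_).symm
  rw [lg_of_notMem (good_above hg hw) (hz w hw), rcub_congr (h w hw), rcub_one (good_above hg hw),
    ord_of_notMem (hz w hw)]
  simp
lemma exists_crt (S : Finset (HeightOneSpectrum (𝓞 K))) (e : HeightOneSpectrum (𝓞 K) → ℕ)
    (x : HeightOneSpectrum (𝓞 K) → 𝓞 K) : ∃ y, ∀ w ∈ S, y - x w ∈ w.asIdeal ^ e w := by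
  obtain ⟨y, hy⟩ := IsDedekindDomain.exists_forall_sub_mem_ideal (s := S) (fun w => w.asIdeal) e
    (fun w _ => w.prime) (fun i _ j _ hij h => hij (HeightOneSpectrum.ext h)) (fun w => x w)
  exact ⟨y, fun w hw => hy w hw⟩

lemma mk_aeval (w : HeightOneSpectrum (𝓞 K)) (s : 𝓞 K) (Ψ : (𝓞 B)[X]) :
    Ideal.Quotient.mk w.asIdeal (aeval s Ψ) = aeval (Ideal.Quotient.mk w.asIdeal s)
      (Ψ.map (Ideal.Quotient.mk (below B w).asIdeal)) :=
  map_aeval_eq_aeval_map (φ := Ideal.Quotient.mk (below B w).asIdeal)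
    (ψ := Ideal.Quotient.mk w.asIdeal) (by ext; rfl) _ _

lemma exists_primitive_ne_zero (k L : Type*) [Field k] [Field L] [Finite L] [Algebra k L] :
    ∃ α : L, α ≠ 0 ∧ IntermediateField.adjoin k {α} = ⊤ := by
  obtain ⟨α, hα⟩ := Field.exists_primitive_element_of_finite_top k L
  rcases eq_or_ne α 0 with rfl | h
  · exact ⟨1, one_ne_zero, by rw [← hα]; simp⟩
  · exact ⟨α, h, hα⟩

lemma norm_aeval_top {k L : Type*} [Field k] [Field L] [Algebra k L] [FiniteDimensional k L] {s : L}
    (hs : IntermediateField.adjoin k {s} = ⊤) (f : k[X]) :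
    Algebra.norm k (aeval s f) = res (minpoly k s) f := by
  rw [norm_aeval, hs, IntermediateField.finrank_top, pow_one]

/-- Data separating the place `w` from the other places above `v`. -/
structure Sep (w : HeightOneSpectrum (𝓞 K)) (φ : (𝓞 B)[X]) (s : 𝓞 K) : Prop where
  monic : φ.Monic
  map_eq : φ.map (Ideal.Quotient.mk (below B w).asIdeal) =
    minpoly (𝓞 B ⧸ (below B w).asIdeal) (Ideal.Quotient.mk w.asIdeal s)
  top : IntermediateField.adjoin (𝓞 B ⧸ (below B w).asIdeal) {Ideal.Quotient.mk w.asIdeal s} = ⊤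
  notMem : s ∉ w.asIdeal
  notMem_sq : aeval s φ ∉ w.asIdeal ^ 2
  mem : ∀ w' ∈ above K (below B w), w' ≠ w → s ∈ w'.asIdeal

lemma exists_sep (w : HeightOneSpectrum (𝓞 K)) : ∃ (φ : (𝓞 B)[X]) (s : 𝓞 K), Sep w φ s := by
  classical
  have hfin : Module.Finite (𝓞 B ⧸ (below B w).asIdeal) (𝓞 K ⧸ w.asIdeal) := Module.Finite.of_finite
  obtain ⟨α, hα0, hα⟩ := exists_primitive_ne_zero (𝓞 B ⧸ (below B w).asIdeal) (𝓞 K ⧸ w.asIdeal)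
  obtain ⟨α, rfl⟩ := Ideal.Quotient.mk_surjective α
  have hint : IsIntegral (𝓞 B ⧸ (below B w).asIdeal) (Ideal.Quotient.mk w.asIdeal α) :=
    Algebra.IsIntegral.isIntegral _
  obtain ⟨φ, hφ, hm⟩ := exists_lift_monic (below B w) (minpoly.monic hint)
  have hself : w ∈ above K (below B w) := mem_above.mpr rfl
  have main : ∃ s : 𝓞 K, s - α ∈ w.asIdeal ∧ (∀ w' ∈ above K (below B w), w' ≠ w → s ∈ w'.asIdeal) ∧
      aeval s φ ∉ w.asIdeal ^ 2 := by
    obtain ⟨s, hs⟩ := exists_crt (above K (below B w)) (fun _ => 1) (fun w' => if w' = w then α else 0)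
    have hsw : s - α ∈ w.asIdeal := by simpa using hs w hself
    have hs' : ∀ w' ∈ above K (below B w), w' ≠ w → s ∈ w'.asIdeal := fun w' hw' hne => by
      simpa [hne] using hs w' hw'
    by_cases h : aeval s φ ∈ w.asIdeal ^ 2
    swap
    · exact ⟨s, hsw, hs', h⟩
    obtain ⟨p, hp⟩ := exists_crt (above K (below B w)) (fun _ => 2)
      (fun w' => if w' = w then unif w else 0)
    have hpw : p - unif w ∈ w.asIdeal ^ 2 := by simpa using hp w hself
    have hpw1 : p ∈ w.asIdeal := by
      simpa using add_mem (Ideal.pow_le_self two_ne_zero hpw) (unif_mem w)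
    refine ⟨s + p, by simpa [add_sub_right_comm] using add_mem hsw hpw1, fun w' hw' hne => ?_, ?_⟩
    · refine add_mem (hs' w' hw' hne) ?_
      have := hp w' hw'
      simp only [if_neg hne, sub_zero] at this
      exact Ideal.pow_le_self two_ne_zero this
    · intro hc
      obtain ⟨k, hk⟩ := (φ.map (algebraMap (𝓞 B) (𝓞 K))).binomExpansion s p
      rw [derivative_map, eval_map_algebraMap, eval_map_algebraMap, eval_map_algebraMap] at hk
      have h2 : aeval s (derivative φ) * p ∈ w.asIdeal ^ 2 := by
        have e : aeval s (derivative φ) * p = aeval (s + p) φ - aeval s φ - k * p ^ 2 := by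
          rw [hk]; ring
        rw [e]
        exact sub_mem (sub_mem hc h) (Ideal.mul_mem_left _ _ (Ideal.pow_mem_pow hpw1 2))
      rcases w.isPrime.mul_mem_pow w.asIdeal h2 with h3 | h3
      · rw [← Ideal.Quotient.eq_zero_iff_mem, mk_aeval, Ideal.Quotient.eq.mpr hsw,
          ← derivative_map, hφ] at h3
        exact (Algebra.IsSeparable.isSeparable (𝓞 B ⧸ (below B w).asIdeal)
          (Ideal.Quotient.mk w.asIdeal α)).aeval_derivative_ne_zero (minpoly.aeval _ _) h3
      · exact unif_notMem w (by simpa using sub_mem h3 hpw)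
  obtain ⟨s, hs, hs', hs2⟩ := main
  have e : Ideal.Quotient.mk w.asIdeal s = Ideal.Quotient.mk w.asIdeal α := Ideal.Quotient.eq.mpr hs
  refine ⟨φ, s, hm, by rw [e, hφ], by rw [e, hα], ?_, hs2, hs'⟩
  rwa [← Ideal.Quotient.eq_zero_iff_mem, e]

namespace Sep
variable {w : HeightOneSpectrum (𝓞 K)} {φ : (𝓞 B)[X]} {s : 𝓞 K}

lemma natDegree_eq (h : Sep w φ s) : φ.natDegree = fdeg B w := by
  have hfin : Module.Finite (𝓞 B ⧸ (below B w).asIdeal) (𝓞 K ⧸ w.asIdeal) := Module.Finite.of_finite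
  rw [← h.monic.natDegree_map (Ideal.Quotient.mk (below B w).asIdeal), h.map_eq,
    ← IntermediateField.adjoin.finrank (Algebra.IsIntegral.isIntegral _), h.top,
    IntermediateField.finrank_top', fdeg]

lemma aeval_mem (h : Sep w φ s) : aeval s φ ∈ w.asIdeal := by
  rw [← Ideal.Quotient.eq_zero_iff_mem, mk_aeval, h.map_eq, minpoly.aeval]

lemma eval_zero_notMem (h : Sep w φ s) : φ.eval 0 ∉ (below B w).asIdeal := by
  have hfin : Module.Finite (𝓞 B ⧸ (below B w).asIdeal) (𝓞 K ⧸ w.asIdeal) := Module.Finite.of_finite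
  rw [← Ideal.Quotient.eq_zero_iff_mem, ← coeff_zero_eq_eval_zero, ← coeff_map, h.map_eq]
  exact minpoly.coeff_zero_ne_zero (Algebra.IsIntegral.isIntegral _) (mk_ne_zero h.notMem)

lemma exists_pow (h : Sep w φ s) : ∃ a b : ℕ, 0 < a ∧ a * fdeg B w + b = Module.finrank B K ∧
    (qpol B s).map (Ideal.Quotient.mk (below B w).asIdeal) =
      φ.map (Ideal.Quotient.mk (below B w).asIdeal) ^ a * X ^ b := by
  have hfin : Module.Finite (𝓞 B ⧸ (below B w).asIdeal) (𝓞 K ⧸ w.asIdeal) := Module.Finite.of_finite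
  obtain ⟨a, b, hab⟩ := exists_eq_pow_mul_pow
    (P₁ := φ.map (Ideal.Quotient.mk (below B w).asIdeal)) (P₂ := X)
    ((qpol B s).map (Ideal.Quotient.mk (below B w).asIdeal)) ((qpol_monic s).map _) (by
      intro R hR hRi hRd
      obtain ⟨Ψ, hΨ, -⟩ := exists_lift_monic (below B w) hR
      obtain ⟨w', hw', hm⟩ := exists_aeval_mem _ hRi hRd hΨ
      rcases eq_or_ne w' w with rfl | hne
      · left
        rw [← Ideal.Quotient.eq_zero_iff_mem, mk_aeval, hΨ] at hm
        have := minpoly.dvd _ _ hm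
        rw [h.map_eq]
        refine (eq_of_monic_of_associated (minpoly.monic (Algebra.IsIntegral.isIntegral _)) hR
          ((minpoly.irreducible (Algebra.IsIntegral.isIntegral _)).associated_of_dvd hRi this)).symm
      · exact Or.inr (eq_X_of_aeval_mem hw' (h.mem w' hw' hne) hR hRi hΨ hm))
  refine ⟨a, b, Nat.pos_of_ne_zero ?_, ?_, hab⟩
  · rintro rfl
    have := congrArg (aeval (Ideal.Quotient.mk w.asIdeal s)) hab
    rw [← mk_aeval, aeval_qpol, map_zero] at this
    simp only [pow_zero, one_mul, map_pow, aeval_X] at this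
    exact pow_ne_zero b (mk_ne_zero h.notMem) this.symm
  · have := congrArg natDegree hab
    rw [(qpol_monic _).natDegree_map, natDegree_qpol,
      ((h.monic.map _).pow a).natDegree_mul (monic_X_pow b), natDegree_X_pow, natDegree_pow,
      h.monic.natDegree_map, h.natDegree_eq] at this
    exact this.symm

end Sep
namespace Sep
variable {w : HeightOneSpectrum (𝓞 K)} {φ : (𝓞 B)[X]} {s : 𝓞 K}

lemma res_map_eq (h : Sep w φ s) (f : (𝓞 B)[X]) :
    Ideal.Quotient.mk (below B w).asIdeal (res φ f) =
      Algebra.norm (𝓞 B ⧸ (below B w).asIdeal) (Ideal.Quotient.mk w.asIdeal (aeval s f)) := by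
  have hfin : Module.Finite (𝓞 B ⧸ (below B w).asIdeal) (𝓞 K ⧸ w.asIdeal) := Module.Finite.of_finite
  rw [res_map h.monic, h.map_eq, mk_aeval, norm_aeval_top h.top]

lemma res_notMem (h : Sep w φ s) {f : (𝓞 B)[X]} :
    res φ f ∈ (below B w).asIdeal ↔ aeval s f ∈ w.asIdeal := by
  have hfin : Module.Finite (𝓞 B ⧸ (below B w).asIdeal) (𝓞 K ⧸ w.asIdeal) := Module.Finite.of_finite
  rw [← Ideal.Quotient.eq_zero_iff_mem, h.res_map_eq, Algebra.norm_eq_zero_iff,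
    Ideal.Quotient.eq_zero_iff_mem]

lemma rcub_res (h : Sep w φ s) (hg : Good ζ (below B w)) {f : (𝓞 B)[X]} (hf : aeval s f ∉ w.asIdeal) :
    rcub ζ (below B w) (res φ f) = rcub (algebraMap (𝓞 B) (𝓞 K) ζ) w (aeval s f) := by
  rw [rcub, h.res_map_eq, fcub_norm hg.mk_prim (mk_ne_zero hf)]
  rfl

lemma lg_mul_coe {M : Type*} [Field M] [NumberField M] {ξ : 𝓞 M} {u : HeightOneSpectrum (𝓞 M)}
    (hg : Good ξ u) {x y : 𝓞 M} (hx : x ≠ 0) (hy : y ≠ 0) :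
    lg ξ u ((x * y : 𝓞 M) : M) = lg ξ u (x : M) + lg ξ u (y : M) := by
  push_cast
  exact lg_mul hg (by exact_mod_cast hx) (by exact_mod_cast hy)

lemma ord_mul_coe {M : Type*} [Field M] [NumberField M] (u : HeightOneSpectrum (𝓞 M))
    {x y : 𝓞 M} (hx : x ≠ 0) (hy : y ≠ 0) :
    ord u ((x * y : 𝓞 M) : M) = ord u (x : M) + ord u (y : M) := by
  push_cast
  exact ord_mul u (by exact_mod_cast hx) (by exact_mod_cast hy)

lemma aeval_notMem (h : Sep w φ s) {w' : HeightOneSpectrum (𝓞 K)} (hw' : w' ∈ above K (below B w))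
    (hne : w' ≠ w) : aeval s φ - algebraMap (𝓞 B) (𝓞 K) (φ.eval 0) ∈ w'.asIdeal ∧
      aeval s φ ∉ w'.asIdeal := by
  have h1 : aeval s φ - algebraMap (𝓞 B) (𝓞 K) (φ.eval 0) ∈ w'.asIdeal := by
    rw [algebraMap_eval_zero]
    exact aeval_sub_mem _ _ _ (by simpa using h.mem w' hw' hne)
  refine ⟨h1, fun h2 => h.eval_zero_notMem ?_⟩
  rw [← notMem_above hw']
  simpa using sub_mem h2 h1

open Classical in
lemma sum_other (w : HeightOneSpectrum (𝓞 K)) : ∑ w' ∈ (above K (below B w)).erase w,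
    (fdeg B w' : ℤ) * ord w' (algebraMap B K (unif (below B w) : B)) =
      Module.finrank B K - fdeg B w * ord w (algebraMap B K (unif (below B w) : B)) := by
  rw [← sum_ord_unif (below B w), ← Finset.add_sum_erase _ _ (mem_above.mpr rfl : w ∈ above K (below B w))]
  ring

open Classical in
/-- The key computation at `w`. -/
lemma normCompat_aeval (h : Sep w φ s) (hg : Good ζ (below B w)) :
    (∃ b : ℕ, (qpol B s).map (Ideal.Quotient.mk (below B w).asIdeal) =
      φ.map (Ideal.Quotient.mk (below B w).asIdeal) ^
        (ord w (algebraMap B K (unif (below B w) : B))).toNat * X ^ b) ∧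
    0 ≤ ord w (algebraMap B K (unif (below B w) : B)) ∧ aeval s φ ≠ 0 ∧
    NormCompat ζ (below B w) ((aeval s φ : 𝓞 K) : K) ∧ ord w ((aeval s φ : 𝓞 K) : K) = 1 := by
  have hself : w ∈ above K (below B w) := mem_above.mpr rfl
  have hg' := good_above hg hself
  obtain ⟨a, b, ha, hdeg, hq⟩ := h.exists_pow
  set V := below B w with hV
  set t := aeval s φ with ht
  have ht0 : t ≠ 0 := fun h0 => h.notMem_sq (by rw [← ht, h0]; exact zero_mem _)
  have htK : (t : K) ≠ 0 := by exact_mod_cast ht0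
  have htw : ord w (t : K) = 1 := ord_unif' h.aeval_mem h.notMem_sq
  obtain ⟨d, hd, hdv⟩ := exists_mul_mem_span (unif_mem V) (unif_notMem V)
  obtain ⟨r, hr⟩ : ∃ r : (𝓞 B)[X], C d * qpol B s = φ * (C d * (φ ^ (a - 1) * X ^ b)) + C (unif V) * r := by
    have : C (unif V) ∣ C d * (qpol B s - φ ^ a * X ^ b) := by
      rw [C_dvd_iff_dvd_coeff]
      intro i
      rw [coeff_C_mul, mul_comm]
      apply hdv
      rw [← Ideal.Quotient.eq_zero_iff_mem, ← coeff_map, Polynomial.map_sub, hq]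
      simp
    obtain ⟨r, hr⟩ := this
    refine ⟨r, ?_⟩
    rw [← hr]
    obtain ⟨a, rfl⟩ := Nat.exists_eq_succ_of_ne_zero ha.ne'
    simp only [Nat.succ_eq_add_one, Nat.add_sub_cancel]
    ring
  have hN0 : Algebra.intNorm (𝓞 B) (𝓞 K) t ≠ 0 := by
    intro h0
    have := coe_intNorm (B := B) t
    rw [h0] at this
    exact norm_ne_zero' (B := B) htK (by simpa using this.symm)
  have hπ0 := unif_ne_zero V
  have hd0 := ne_zero_of_notMem hd
  -- the norm of `t`
  obtain ⟨k, hk⟩ := res_comm (qpol B s) φ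
  have e1 : d ^ fdeg B w * Algebra.intNorm (𝓞 B) (𝓞 K) t = (-1) ^ k * (unif V ^ fdeg B w * res φ r) := by
    rw [intNorm_aeval, hk, mul_left_comm, ← h.natDegree_eq, ← res_C_mul h.monic, hr, add_comm,
      res_add_mul h.monic, res_C_mul h.monic]
  have hordN : ord V ((Algebra.intNorm (𝓞 B) (𝓞 K) t : 𝓞 B) : B) = fdeg B w := by
    rw [coe_intNorm, ord_norm V htK, Finset.sum_eq_single w, htw, mul_one]
    · intro w' hw' hne
      rw [ord_of_notMem (h.aeval_notMem hw' hne).2, mul_zero]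
    · exact fun h' => absurd hself h'
  have hρ0 : res φ r ≠ 0 := by
    intro h0
    rw [h0] at e1
    simp [hd0, hN0] at e1
  have e2 := congrArg (fun x : 𝓞 B => ord V (x : B)) e1
  have e3 := congrArg (fun x : 𝓞 B => lg ζ V (x : B)) e1
  have hneg : ∀ (x : 𝓞 B), ord V (((-1) ^ k * x : 𝓞 B) : B) = ord V (x : B) ∧
      lg ζ V (((-1) ^ k * x : 𝓞 B) : B) = lg ζ V (x : B) := by
    intro x
    rcases neg_one_pow_eq_or (𝓞 B) k with hk | hk <;> rw [hk]
    · simp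
    · simp only [neg_mul, one_mul, map_neg]
      exact ⟨ord_neg _, lg_neg hg _⟩
  beta_reduce at e2 e3
  rw [(hneg _).1, ord_mul_coe V (pow_ne_zero _ hd0) hN0, ord_mul_coe V (pow_ne_zero _ hπ0) hρ0, hordN] at e2
  rw [(hneg _).2, lg_mul_coe hg (pow_ne_zero _ hd0) hN0, lg_mul_coe hg (pow_ne_zero _ hπ0) hρ0] at e3
  push_cast at e2 e3
  have hdB : (d : B) ≠ 0 := by exact_mod_cast hd0
  have hπB : (unif V : B) ≠ 0 := by exact_mod_cast hπ0
  rw [ord_pow hdB, ord_of_notMem hd, ord_pow hπB, ord_unif] at e2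
  rw [lg_pow hg hdB, lg_of_notMem hg hd, lg_pow hg hπB, lg_unif hg] at e3
  have hρ : res φ r ∉ V.asIdeal := by
    rw [mem_iff hρ0]; push Not; linarith
  have hrs : aeval s r ∉ w.asIdeal := fun h' => hρ (h.res_notMem.mpr h')
  rw [lg_of_notMem hg hρ, h.rcub_res hg hrs] at e3
  -- the equation at `w`
  have e4 := congrArg (aeval s) hr
  have hdw : algebraMap (𝓞 B) (𝓞 K) d ∉ w.asIdeal := fun h' => hd ((notMem_above hself).mp h')
  have hs0 := ne_zero_of_notMem h.notMem
  rw [map_mul, aeval_qpol, mul_zero, map_add, map_mul, map_mul, map_mul, map_mul, map_pow, map_pow, aeval_X,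
    aeval_C, aeval_C, ← ht] at e4
  have e5 : -(algebraMap (𝓞 B) (𝓞 K) d * (t ^ a * s ^ b)) =
      algebraMap (𝓞 B) (𝓞 K) (unif V) * aeval s r := by
    obtain ⟨a, rfl⟩ := Nat.exists_eq_succ_of_ne_zero ha.ne'
    simp only [Nat.succ_eq_add_one, Nat.add_sub_cancel] at e4
    rw [pow_succ]
    linear_combination e4
  have hπK0 : algebraMap (𝓞 B) (𝓞 K) (unif V) ≠ 0 := by simpa using hπ0
  have e6 := congrArg (fun x : 𝓞 K => ord w (x : K)) e5
  have e7 := congrArg (fun x : 𝓞 K => lg (algebraMap (𝓞 B) (𝓞 K) ζ) w (x : K)) e5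
  beta_reduce at e6 e7
  have hsK : (s : K) ≠ 0 := by exact_mod_cast hs0
  have hta := pow_ne_zero a ht0
  have hsb := pow_ne_zero b hs0
  have c1 : ∀ x : 𝓞 K, ((-x : 𝓞 K) : K) = -(x : K) := fun x => map_neg _ x
  rw [c1, ord_neg, ord_mul_coe w (ne_zero_of_notMem hdw) (mul_ne_zero hta hsb),
    ord_mul_coe w hta hsb, ord_mul_coe w hπK0 (ne_zero_of_notMem hrs), ord_of_notMem hdw,
    ord_of_notMem hrs, coe_algebraMap (unif V)] at e6
  rw [c1, lg_neg hg', lg_mul_coe hg' (ne_zero_of_notMem hdw) (mul_ne_zero hta hsb),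
    lg_mul_coe hg' hta hsb, lg_mul_coe hg' hπK0 (ne_zero_of_notMem hrs), lg_of_notMem hg' hdw,
    lg_of_notMem hg' hrs, rcub_algebraMap hg hself hd, coe_algebraMap (unif V)] at e7
  push_cast at e6 e7
  rw [ord_pow htK, ord_pow hsK, ord_of_notMem h.notMem, htw] at e6
  rw [lg_pow hg' htK, lg_pow hg' hsK, lg_of_notMem hg' h.notMem] at e7
  have hao : ord w (algebraMap B K (unif V : B)) = a := by linarith
  have hs_log : rcub (algebraMap (𝓞 B) (𝓞 K) ζ) w s = rcub ζ V (φ.eval 0) := by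
    have := h.rcub_res hg (f := X) (by simpa using h.notMem)
    rw [aeval_X] at this
    rw [← this]
    obtain ⟨k, hk⟩ := res_comm φ X
    rw [hk, res_X]
    rcases neg_one_pow_eq_or (𝓞 B) k with hk | hk <;> rw [hk]
    · rw [one_mul]
    · rw [neg_one_mul, rcub_neg hg]
  refine ⟨⟨b, by rw [hao]; simpa using hq⟩, by rw [hao]; positivity, ht0, ?_, htw⟩
  rw [NormCompat, ← coe_intNorm, ← Finset.add_sum_erase _ _ hself, htw, hao]
  have e8 : ∑ w' ∈ (above K V).erase w, ((ord w' (algebraMap B K (unif V : B)) : ZMod 3) *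
        lg (algebraMap (𝓞 B) (𝓞 K) ζ) w' (t : K) -
      lg (algebraMap (𝓞 B) (𝓞 K) ζ) w' (algebraMap B K (unif V : B)) * ord w' (t : K)) =
      b * rcub ζ V (φ.eval 0) := by
    have : ∀ w' ∈ (above K V).erase w, ((ord w' (algebraMap B K (unif V : B)) : ZMod 3) *
        lg (algebraMap (𝓞 B) (𝓞 K) ζ) w' (t : K) -
      lg (algebraMap (𝓞 B) (𝓞 K) ζ) w' (algebraMap B K (unif V : B)) * ord w' (t : K)) =
        (((fdeg B w' : ℤ) * ord w' (algebraMap B K (unif V : B)) : ℤ) : ZMod 3) * rcub ζ V (φ.eval 0) := by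
      intro w' hw'
      obtain ⟨hne, hw'⟩ := Finset.mem_erase.mp hw'
      obtain ⟨h1, h2⟩ := h.aeval_notMem hw' hne
      rw [lg_of_notMem (good_above hg hw') h2, rcub_congr h1,
        rcub_algebraMap hg hw' h.eval_zero_notMem, ord_of_notMem h2]
      push_cast; ring
    rw [Finset.sum_congr rfl this, ← Finset.sum_mul, ← Int.cast_sum, sum_other w, hao, ← hdeg]
    push_cast; ring
  rw [e8]
  rw [hs_log] at e7
  push_cast
  linear_combination e3 - e7

lemma exists_unit (h : Sep w φ s) (hg : Good ζ (below B w)) {c : 𝓞 K} (hc : c ∉ w.asIdeal) :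
    ∃ u : 𝓞 K, u - c ∈ w.asIdeal ∧ (∀ w' ∈ above K (below B w), w' ≠ w → u - 1 ∈ w'.asIdeal) ∧
      NormCompat ζ (below B w) (u : K) := by
  have hfin : Module.Finite (𝓞 B ⧸ (below B w).asIdeal) (𝓞 K ⧸ w.asIdeal) := Module.Finite.of_finite
  have hself : w ∈ above K (below B w) := mem_above.mpr rfl
  obtain ⟨⟨b, hq⟩, he, -⟩ := h.normCompat_aeval hg
  -- a polynomial with prescribed values
  obtain ⟨Ψ, hΨc, hΨ0⟩ : ∃ Ψ : (𝓞 B)[X], aeval s Ψ - c ∈ w.asIdeal ∧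
      Ψ.eval 0 - 1 ∈ (below B w).asIdeal := by
    have hcm : Ideal.Quotient.mk w.asIdeal c ∈ IntermediateField.adjoin (𝓞 B ⧸ (below B w).asIdeal)
        {Ideal.Quotient.mk w.asIdeal s} := by rw [h.top]; trivial
    rw [← IntermediateField.mem_toSubalgebra,
      IntermediateField.adjoin_simple_toSubalgebra_of_isAlgebraic
        (Algebra.IsIntegral.isIntegral _).isAlgebraic,
      Algebra.adjoin_singleton_eq_range_aeval] at hcm
    obtain ⟨g, hg1⟩ := hcm
    obtain ⟨G, rfl⟩ := Polynomial.map_surjective (Ideal.Quotient.mk (below B w).asIdeal)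
      Ideal.Quotient.mk_surjective g
    obtain ⟨y, hy⟩ : ∃ y : 𝓞 B, φ.eval 0 * y - 1 ∈ (below B w).asIdeal := by
      obtain ⟨y, hy⟩ := Ideal.Quotient.mk_surjective
        (Ideal.Quotient.mk (below B w).asIdeal (φ.eval 0))⁻¹
      refine ⟨y, Ideal.Quotient.eq.mp ?_⟩
      rw [RingHom.map_mul, hy, mul_inv_cancel₀ (mk_ne_zero h.eval_zero_notMem), RingHom.map_one]
    refine ⟨G + φ * C (y * (1 - G.eval 0)), ?_, ?_⟩
    · have h1 : aeval s G - c ∈ w.asIdeal := by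
        rw [← Ideal.Quotient.eq, mk_aeval]; exact hg1
      rw [map_add, map_mul, add_sub_right_comm]
      exact add_mem h1 (Ideal.mul_mem_right _ _ h.aeval_mem)
    · have : (G + φ * C (y * (1 - G.eval 0))).eval 0 - 1 =
          (φ.eval 0 * y - 1) * (1 - G.eval 0) := by simp; ring
      rw [this]
      exact Ideal.mul_mem_right _ _ hy
  have hu : aeval s Ψ ∉ w.asIdeal := fun hh => hc (by simpa using sub_mem hh hΨc)
  have hother : ∀ w' ∈ above K (below B w), w' ≠ w → aeval s Ψ - 1 ∈ w'.asIdeal := by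
    intro w' hw' hne
    have h1 : aeval s Ψ - algebraMap (𝓞 B) (𝓞 K) (Ψ.eval 0) ∈ w'.asIdeal := by
      rw [algebraMap_eval_zero]
      exact aeval_sub_mem _ _ _ (by simpa using h.mem w' hw' hne)
    have h2 : algebraMap (𝓞 B) (𝓞 K) (Ψ.eval 0 - 1) ∈ w'.asIdeal := (notMem_above hw').mpr hΨ0
    rw [map_sub, map_one] at h2
    simpa using add_mem h1 h2
  refine ⟨aeval s Ψ, hΨc, hother, ?_⟩
  set e := ord w (algebraMap B K (unif (below B w) : B)) with he'
  have hN : Ideal.Quotient.mk (below B w).asIdeal (Algebra.intNorm (𝓞 B) (𝓞 K) (aeval s Ψ)) =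
      Ideal.Quotient.mk (below B w).asIdeal (res φ Ψ ^ e.toNat) := by
    rw [intNorm_aeval, res_map (qpol_monic s), hq, res_mul_left ((h.monic.map _).pow _) (monic_X_pow b),
      res_pow_left (h.monic.map _), res_pow_left monic_X, res_X, map_pow, res_map h.monic,
      eval_map, eval₂_at_zero, coeff_zero_eq_eval_zero, Ideal.Quotient.eq.mpr hΨ0, RingHom.map_one, one_pow,
      mul_one]
  have hρ : res φ Ψ ∉ (below B w).asIdeal := fun hh => hu (h.res_notMem.mp hh)
  have hρe : res φ Ψ ^ e.toNat ∉ (below B w).asIdeal := fun hh =>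
    hρ ((below B w).isPrime.mem_of_pow_mem _ hh)
  have hNm : Algebra.intNorm (𝓞 B) (𝓞 K) (aeval s Ψ) ∉ (below B w).asIdeal := by
    rw [← Ideal.Quotient.eq_zero_iff_mem, hN]
    exact mk_ne_zero hρe
  have hg' := good_above hg hself
  rw [NormCompat, ← coe_intNorm, lg_of_notMem hg hNm, rcub_congr (Ideal.Quotient.eq.mp hN),
    Finset.sum_eq_single w, ← he', lg_of_notMem hg' hu, ord_of_notMem hu, ← h.rcub_res hg hu, rcub,
    map_pow, fcub_pow hg.mk_prim (mk_ne_zero hρ)]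
  · have : ((e.toNat : ℕ) : ZMod 3) = ((e : ℤ) : ZMod 3) := by
      conv_rhs => rw [← Int.toNat_of_nonneg he]
      rw [Int.cast_natCast]
    rw [this]; simp [rcub]
  · intro w' hw' hne
    have h1 := hother w' hw' hne
    have hu' : aeval s Ψ ∉ w'.asIdeal := fun hh => one_notMem w' (by simpa using sub_mem hh h1)
    have hg'' := good_above hg hw'
    rw [lg_of_notMem hg'' hu', ord_of_notMem hu', rcub_congr h1, rcub_one hg'']
    simp
  · exact fun h' => absurd hself h'
end Sep
lemma coe_mul (a b : 𝓞 K) : ((a * b : 𝓞 K) : K) = a * b := map_mul (algebraMap (𝓞 K) K) a b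

lemma coe_add (a b : 𝓞 K) : ((a + b : 𝓞 K) : K) = a + b := map_add (algebraMap (𝓞 K) K) a b

lemma coe_prod {ι : Type*} (S : Finset ι) (f : ι → 𝓞 K) : ((∏ i ∈ S, f i : 𝓞 K) : K) = ∏ i ∈ S, (f i : K) :=
  map_prod (algebraMap (𝓞 K) K) f S

lemma NormCompat.of_notMem (hg : Good ζ v) {z : 𝓞 K} (hz : ∀ w ∈ above K v, z ∉ w.asIdeal) :
    NormCompat ζ v (z : K) := by
  classical
  have key : ∀ w : HeightOneSpectrum (𝓞 K), ∃ u : 𝓞 K, w ∈ above K v →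
      z * u - 1 ∈ w.asIdeal ∧ (∀ w' ∈ above K v, w' ≠ w → u - 1 ∈ w'.asIdeal) ∧
      NormCompat ζ v (u : K) := by
    intro w
    by_cases hw : w ∈ above K v
    swap
    · exact ⟨0, fun h => absurd h hw⟩
    obtain ⟨c, hc⟩ := Ideal.Quotient.mk_surjective (Ideal.Quotient.mk w.asIdeal z)⁻¹
    have hzc : Ideal.Quotient.mk w.asIdeal z * Ideal.Quotient.mk w.asIdeal c = 1 := by
      rw [hc, mul_inv_cancel₀ (mk_ne_zero (hz w hw))]
    have hcw : c ∉ w.asIdeal := by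
      intro h
      rw [Ideal.Quotient.eq_zero_iff_mem.mpr h, mul_zero] at hzc
      exact zero_ne_one hzc
    have hv := mem_above.mp hw
    subst hv
    obtain ⟨φ, s, h⟩ := exists_sep (B := B) w
    obtain ⟨u, h1, h2, h3⟩ := h.exists_unit hg hcw
    refine ⟨u, fun _ => ⟨?_, h2, h3⟩⟩
    rw [← Ideal.Quotient.eq, map_mul, Ideal.Quotient.eq.mpr h1, hzc, RingHom.map_one]
  choose u hu using key
  have hunit : ∀ w ∈ above K v, ∀ w' ∈ above K v, u w ∉ w'.asIdeal := by
    intro w hw w' hw' h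
    rcases eq_or_ne w' w with rfl | hne
    · exact one_notMem w' (by simpa using sub_mem (Ideal.mul_mem_left _ z h) (hu w' hw').1)
    · exact one_notMem w' (by simpa using sub_mem h ((hu w hw).2.1 w' hw' hne))
  have hP : NormCompat ζ v ((∏ w ∈ above K v, u w : 𝓞 K) : K) := by
    rw [coe_prod]
    exact .prod hg _ _ (fun w hw => coe_ne_zero_of_notMem (hunit w hw w hw)) (fun w hw => (hu w hw).2.2)
  have hPne : ((∏ w ∈ above K v, u w : 𝓞 K) : K) ≠ 0 := by
    rw [coe_prod]
    exact Finset.prod_ne_zero_iff.mpr (fun w hw => coe_ne_zero_of_notMem (hunit w hw w hw))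
  have hZ : NormCompat ζ v ((z * ∏ w ∈ above K v, u w : 𝓞 K) : K) := by
    refine .of_sub_one_mem hg fun w hw => ?_
    rw [← Ideal.Quotient.eq, map_mul, map_prod, Finset.prod_eq_single w, ← map_mul]
    · exact Ideal.Quotient.eq.mpr (hu w hw).1
    · intro w' hw' hne
      rw [← RingHom.map_one (Ideal.Quotient.mk w.asIdeal)]
      exact Ideal.Quotient.eq.mpr ((hu w' hw').2.1 w hw hne.symm)
    · exact fun h => absurd hw h
  have e : (z : K) = ((z * ∏ w ∈ above K v, u w : 𝓞 K) : K) * ((∏ w ∈ above K v, u w : 𝓞 K) : K)⁻¹ := by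
    rw [coe_mul, mul_inv_cancel_right₀ hPne]
  by_cases hz0 : z = 0
  · subst hz0
    have hempty : above K v = ∅ := by
      by_contra hne
      obtain ⟨w, hw⟩ := Finset.nonempty_iff_ne_empty.mpr hne
      exact hz w hw (zero_mem _)
    have := sum_ord_unif (K := K) v
    rw [hempty, Finset.sum_empty] at this
    exact absurd (by exact_mod_cast this.symm) (Module.finrank_pos (R := B) (M := K)).ne'
  have hz0' : (z : K) ≠ 0 := by exact_mod_cast hz0
  rw [e]
  exact hZ.mul hg (by rw [coe_mul]; exact mul_ne_zero hz0' hPne) (inv_ne_zero hPne) (hP.inv hg hPne)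

lemma exists_div (S : Finset (HeightOneSpectrum (𝓞 K))) {x : K} (hx : x ≠ 0) (h : ∀ w ∈ S, ord w x = 0) :
    ∃ b d : 𝓞 K, (∀ w ∈ S, b ∉ w.asIdeal) ∧ (∀ w ∈ S, d ∉ w.asIdeal) ∧ d ≠ 0 ∧ x * d = b := by
  by_cases hS : S = ∅
  · subst hS
    obtain ⟨r, s, hs, rfl⟩ := IsFractionRing.div_surjective (𝓞 K) x
    have hs0 : s ≠ 0 := nonZeroDivisors.ne_zero hs
    refine ⟨r, s, by simp, by simp, hs0, ?_⟩
    exact div_mul_cancel₀ _ (by exact_mod_cast hs0 : (s : K) ≠ 0)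
  let I : Ideal (𝓞 K) :=
    { carrier := {d | ∃ b : 𝓞 K, x * d = b}
      add_mem' := by
        rintro a a' ⟨b, hb⟩ ⟨b', hb'⟩
        exact ⟨b + b', by rw [coe_add, coe_add, mul_add, hb, hb']⟩
      zero_mem' := ⟨0, by simp⟩
      smul_mem' := by
        rintro c a ⟨b, hb⟩
        exact ⟨c * b, by rw [smul_eq_mul, coe_mul, coe_mul, ← hb]; ring⟩ }
  have hI : ¬ ((I : Set (𝓞 K)) ⊆ ⋃ w ∈ (S : Set (HeightOneSpectrum (𝓞 K))), (w.asIdeal : Set (𝓞 K))) := by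
    obtain ⟨w₀, -⟩ := Finset.nonempty_iff_ne_empty.mpr hS
    rw [Ideal.subset_union_prime w₀ w₀ (fun w _ _ _ => w.isPrime)]
    rintro ⟨w, hw, hle⟩
    obtain ⟨n, b, d, hd⟩ := exists_dec w hx
    have hn := h w hw
    rw [ord_eq hd] at hn
    subst hn
    exact hd.hd (hle ⟨b, by simpa using hd.eq⟩)
  obtain ⟨d, ⟨b, hb⟩, hd⟩ := Set.not_subset.mp hI
  simp only [Set.mem_iUnion, not_exists] at hd
  have hd' : ∀ w ∈ S, d ∉ w.asIdeal := fun w hw hm => hd w hw hm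
  obtain ⟨w₀, hw₀⟩ := Finset.nonempty_iff_ne_empty.mpr hS
  have hd0 := ne_zero_of_notMem (hd' w₀ hw₀)
  have hdK : (d : K) ≠ 0 := by exact_mod_cast hd0
  have hb0 : b ≠ 0 := by
    rintro rfl
    exact mul_ne_zero hx hdK (by simpa using hb)
  refine ⟨b, d, fun w hw => ?_, hd', hd0, hb⟩
  rw [mem_iff hb0, ← hb, ord_mul w hx hdK, h w hw, ord_of_notMem (hd' w hw)]
  simp

lemma normCompat (hg : Good ζ v) {z : K} (hz : z ≠ 0) : NormCompat ζ v z := by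
  classical
  have key : ∀ w : HeightOneSpectrum (𝓞 K), ∃ t : 𝓞 K, w ∈ above K v →
      t ≠ 0 ∧ NormCompat ζ v (t : K) ∧ ord w (t : K) = 1 ∧
        ∀ w' ∈ above K v, w' ≠ w → ord w' (t : K) = 0 := by
    intro w
    by_cases hw : w ∈ above K v
    swap
    · exact ⟨0, fun h => absurd h hw⟩
    have hv := mem_above.mp hw
    subst hv
    obtain ⟨φ, s, h⟩ := exists_sep (B := B) w
    obtain ⟨-, -, h1, h2, h3⟩ := h.normCompat_aeval hg
    exact ⟨_, fun _ => ⟨h1, h2, h3, fun w' hw' hne => ord_of_notMem (h.aeval_notMem hw' hne).2⟩⟩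
  choose t ht using key
  have htK : ∀ w ∈ above K v, (t w : K) ≠ 0 := fun w hw => by exact_mod_cast (ht w hw).1
  set y : K := ∏ w ∈ above K v, (t w : K) ^ ord w z with hy
  have hy0 : y ≠ 0 := Finset.prod_ne_zero_iff.mpr fun w hw => zpow_ne_zero _ (htK w hw)
  have hyc : NormCompat ζ v y := .prod hg _ _ (fun w hw => zpow_ne_zero _ (htK w hw))
    (fun w hw => (ht w hw).2.1.zpow hg (htK w hw) _)
  have hordprod : ∀ (w : HeightOneSpectrum (𝓞 K)) (T : Finset (HeightOneSpectrum (𝓞 K))), T ⊆ above K v →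
      ord w (∏ w ∈ T, (t w : K) ^ ord w z) = ∑ w' ∈ T, ord w' z * ord w (t w' : K) := by
    intro w T
    induction T using Finset.induction_on with
    | empty => intro _; simp [ord_one]
    | insert w' T hw' ih =>
      intro hT
      rw [Finset.insert_subset_iff] at hT
      rw [Finset.prod_insert hw', Finset.sum_insert hw', ord_mul, ih hT.2, ord_zpow (htK w' hT.1)]
      · exact zpow_ne_zero _ (htK w' hT.1)
      · exact Finset.prod_ne_zero_iff.mpr fun w hw => zpow_ne_zero _ (htK w (hT.2 hw))
  have hord : ∀ w ∈ above K v, ord w (z * y⁻¹) = 0 := by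
    intro w hw
    rw [ord_mul w hz (inv_ne_zero hy0), ord_inv hy0, hy, hordprod w _ subset_rfl, Finset.sum_eq_single w,
      (ht w hw).2.2.1, mul_one, add_neg_cancel]
    · intro w' hw' hne
      rw [(ht w' hw').2.2.2 w hw hne.symm, mul_zero]
    · exact fun h => absurd hw h
  have hx0 := mul_ne_zero hz (inv_ne_zero hy0)
  obtain ⟨b, d, hb, hd, hd0, e⟩ := exists_div (above K v) hx0 hord
  have hdK : (d : K) ≠ 0 := by exact_mod_cast hd0
  have hbK : (b : K) ≠ 0 := e ▸ mul_ne_zero hx0 hdK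
  have e2 : z = y * ((b : K) * (d : K)⁻¹) := by
    rw [← e]; field_simp
  rw [e2]
  exact hyc.mul hg hy0 (mul_ne_zero hbK (inv_ne_zero hdK))
    ((NormCompat.of_notMem hg hb).mul hg hbK (inv_ne_zero hdK) ((NormCompat.of_notMem hg hd).inv hg hdK))

lemma sum_tame (hζ : IsPrimitiveRoot ζ 3) (v : HeightOneSpectrum (𝓞 B)) {x : B} {z : K} (hx : x ≠ 0)
    (hz : z ≠ 0) : ∑ w ∈ above K v, tame (algebraMap (𝓞 B) (𝓞 K) ζ) w (algebraMap B K x) z =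
      tame ζ v x (Algebra.norm B z) := by
  rcases good_or hζ v with h3 | hg
  · rw [tame_of_mem h3]
    refine Finset.sum_eq_zero fun w hw => tame_of_mem ?_ _ _
    have := (notMem_above hw (a := 3)).mpr h3
    rwa [map_ofNat] at this
  · have h1 : ∀ w ∈ above K v, tame (algebraMap (𝓞 B) (𝓞 K) ζ) w (algebraMap B K x) z =
        lg ζ v x * (((fdeg B w : ℤ) * ord w z : ℤ) : ZMod 3) - ord v x *
          ((ord w (algebraMap B K (unif v : B)) : ZMod 3) * lg (algebraMap (𝓞 B) (𝓞 K) ζ) w z -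
            lg (algebraMap (𝓞 B) (𝓞 K) ζ) w (algebraMap B K (unif v : B)) * ord w z) := by
      intro w hw
      rw [tame_of_good (good_above hg hw), (ord_lg_algebraMap hg hw hx).1, (ord_lg_algebraMap hg hw hx).2]
      push_cast; ring
    rw [Finset.sum_congr rfl h1, Finset.sum_sub_distrib, ← Finset.mul_sum, ← Finset.mul_sum,
      ← Int.cast_sum, ← ord_norm v hz, tame_of_good hg, normCompat hg hz]

/-- The projection formula for the sum of all tame symbols. -/
lemma FS_norm (hζ : IsPrimitiveRoot ζ 3) {x : B} {z : K} (hx : x ≠ 0) (hz : z ≠ 0) :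
    FS (algebraMap (𝓞 B) (𝓞 K) ζ) (algebraMap B K x) z = FS ζ x (Algebra.norm B z) := by
  classical
  have hζ' : IsPrimitiveRoot (algebraMap (𝓞 B) (𝓞 K) ζ) 3 :=
    hζ.map_of_injective (FaithfulSMul.algebraMap_injective (𝓞 B) (𝓞 K))
  have hxK : algebraMap B K x ≠ 0 := by simpa using hx
  have hf := finite_tame (ζ := algebraMap (𝓞 B) (𝓞 K) ζ) hxK hz
  rw [FS, FS, ← finsum_congr (fun v => sum_tame hζ v hx hz)]
  set g := fun w => tame (algebraMap (𝓞 B) (𝓞 K) ζ) w (algebraMap B K x) z with hgdef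
  let S := hf.toFinset
  have hS : ∀ w, g w ≠ 0 → w ∈ S := fun w h => by simpa [S] using h
  rw [finsum_eq_sum_of_support_subset (s := S) g (fun w hw => hS w hw),
    finsum_eq_sum_of_support_subset (s := S.image (below B)) _ ?_]
  · rw [← Finset.sum_fiberwise_of_maps_to (fun w hw => Finset.mem_image_of_mem (below B) hw)]
    refine Finset.sum_congr rfl fun v _ => ?_
    refine Finset.sum_subset (fun w hw => mem_above.mpr (Finset.mem_filter.mp hw).2) fun w hw hw' => ?_
    by_contra h
    exact hw' (Finset.mem_filter.mpr ⟨hS w h, mem_above.mp hw⟩)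
  · intro v hv
    obtain ⟨w, hw, hne⟩ := Finset.exists_ne_zero_of_sum_ne_zero hv
    exact Finset.mem_coe.mpr (Finset.mem_image.mpr ⟨w, hS w hne, mem_above.mp hw⟩)
end CubicRec

namespace CubicRec
set_option linter.unusedSectionVars false
open IsDedekindDomain Polynomial UniqueFactorizationMonoid

lemma det_blockDiagonal' {R ι : Type*} [CommRing R] [Fintype ι] [DecidableEq ι] {β : ι → Type*}
    [∀ i, Fintype (β i)] [∀ i, DecidableEq (β i)] (M : ∀ i, Matrix (β i) (β i) R) :
    (Matrix.blockDiagonal' M).det = ∏ i, (M i).det := by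
  let _ : LinearOrder ι := LinearOrder.lift' (Fintype.equivFin ι) (Fintype.equivFin ι).injective
  rw [(Matrix.blockTriangular_blockDiagonal' M).det_fintype]
  refine Finset.prod_congr rfl fun i _ => ?_
  rw [← Matrix.det_reindex_self (Equiv.sigmaSubtype i).symm (M i)]
  congr 1
  ext ⟨⟨j, x⟩, hj⟩ ⟨⟨j', y⟩, hj'⟩
  obtain rfl : j = i := hj
  obtain rfl : j' = j := hj'
  simp only [Matrix.toSquareBlock_def, Matrix.of_apply, Matrix.blockDiagonal'_apply_eq]
  rfl

lemma norm_pi {R ι : Type*} [CommRing R] [Fintype ι] {A : ι → Type*} [∀ i, CommRing (A i)]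
    [∀ i, Algebra R (A i)] [∀ i, Module.Free R (A i)] [∀ i, Module.Finite R (A i)] (z : ∀ i, A i) :
    Algebra.norm R z = ∏ i, Algebra.norm R (z i) := by
  classical
  let b := fun i => Module.Free.chooseBasis R (A i)
  rw [Algebra.norm_eq_matrix_det (Pi.basis b)]
  have : Algebra.leftMulMatrix (Pi.basis b) z =
      Matrix.blockDiagonal' fun i => Algebra.leftMulMatrix (b i) (z i) := by
    ext ⟨i, x⟩ ⟨j, y⟩
    rw [Algebra.leftMulMatrix_eq_repr_mul, Pi.basis_repr, Pi.basis_apply]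
    by_cases h : i = j
    · subst h
      rw [Matrix.blockDiagonal'_apply_eq, Algebra.leftMulMatrix_eq_repr_mul]
      simp
    · rw [Matrix.blockDiagonal'_apply_ne _ _ _ h]
      simp [Pi.single_eq_of_ne h]
  rw [this, det_blockDiagonal']
  exact Finset.prod_congr rfl fun i _ => (Algebra.norm_eq_matrix_det (b i) _).symm

lemma norm_eq_prod {B C : Type*} [Field B] [CommRing C] [Algebra B C] [FiniteDimensional B C] [IsReduced C]
    [IsArtinianRing C] [Fintype (MaximalSpectrum C)] (z : C) :
    Algebra.norm B z = ∏ m : MaximalSpectrum C, Algebra.norm B (Ideal.Quotient.mk m.asIdeal z) := by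
  rw [Algebra.norm_eq_of_algEquiv ((IsArtinianRing.equivPi C).restrictScalars B) z |>.symm, norm_pi]
  rfl

lemma numberField_of_finite (k L : Type*) [Field k] [NumberField k] [Field L] [Algebra k L]
    [FiniteDimensional k L] : NumberField L where
  to_charZero := charZero_of_injective_algebraMap (algebraMap k L).injective
  to_finiteDimensional := by
    have := charZero_of_injective_algebraMap (algebraMap k L).injective
    exact FiniteDimensional.trans ℚ k L

end CubicRec

namespace CubicRec
set_option linter.unusedSectionVars false
open IsDedekindDomain Polynomial UniqueFactorizationMonoid
open scoped TensorProduct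

noncomputable local instance maxQuotField {C : Type*} [CommRing C] (m : MaximalSpectrum C) : Field (C ⧸ m.asIdeal) :=
  Ideal.Quotient.field _

lemma FS_norm_eq_sum {B C : Type*} [Field B] [NumberField B] [CommRing C] [Algebra B C] [FiniteDimensional B C]
    [IsReduced C] [IsArtinianRing C] [Fintype (MaximalSpectrum C)]
    [∀ m : MaximalSpectrum C, NumberField (C ⧸ m.asIdeal)] {ζ : 𝓞 B} (hζ : IsPrimitiveRoot ζ 3) {x : B}
    (hx : x ≠ 0) {z : C} (hz : Algebra.norm B z ≠ 0) :
    FS ζ x (Algebra.norm B z) = ∑ m : MaximalSpectrum C,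
      FS (algebraMap (𝓞 B) (𝓞 (C ⧸ m.asIdeal)) ζ) (algebraMap B (C ⧸ m.asIdeal) x) (Ideal.Quotient.mk m.asIdeal z) := by
  rw [norm_eq_prod] at hz ⊢
  have hz' : ∀ m : MaximalSpectrum C, Algebra.norm B (Ideal.Quotient.mk m.asIdeal z) ≠ 0 := fun m =>
    Finset.prod_ne_zero_iff.mp hz m (Finset.mem_univ m)
  have key : ∀ S : Finset (MaximalSpectrum C),
      FS ζ x (∏ m ∈ S, Algebra.norm B (Ideal.Quotient.mk m.asIdeal z)) =
        ∑ m ∈ S, FS ζ x (Algebra.norm B (Ideal.Quotient.mk m.asIdeal z)) := by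
    classical
    intro S
    induction S using Finset.induction_on with
    | empty => simp [FS_one_right hζ hx]
    | insert m S hm ih =>
      rw [Finset.prod_insert hm, Finset.sum_insert hm, FS_mul_right hζ (hz' m) ?_ hx, ih]
      exact Finset.prod_ne_zero_iff.mpr fun m _ => hz' m
  rw [key]
  refine Finset.sum_congr rfl fun m _ => (FS_norm hζ hx ?_).symm
  intro h
  exact hz' m (by rw [h, Algebra.norm_zero])

lemma algebraMap_tower {k B L : Type*} [Field k] [Field B] [Field L] [NumberField k] [NumberField B] [NumberField L]
    [Algebra k B] [Algebra k L] [Algebra B L] [IsScalarTower k B L] (ζ : 𝓞 k) :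
    algebraMap (𝓞 B) (𝓞 L) (algebraMap (𝓞 k) (𝓞 B) ζ) = algebraMap (𝓞 k) (𝓞 L) ζ := by
  apply RingOfIntegers.ext
  exact (IsScalarTower.algebraMap_apply k B L ζ).symm

variable {k K₁ K₂ : Type*} [Field k] [NumberField k] [Field K₁] [NumberField K₁] [Field K₂] [NumberField K₂]
  [Algebra k K₁] [Algebra k K₂] {ζ : 𝓞 k}

lemma prim_map (hζ : IsPrimitiveRoot ζ 3) : IsPrimitiveRoot (algebraMap (𝓞 k) (𝓞 K₁) ζ) 3 :=
  hζ.map_of_injective (FaithfulSMul.algebraMap_injective (𝓞 k) (𝓞 K₁))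

lemma norm_sub_core {C : Type*} [CommRing C] [Algebra k C] [Algebra K₁ C] [Algebra K₂ C] [IsScalarTower k K₁ C]
    [IsScalarTower k K₂ C] [FiniteDimensional K₁ C] [FiniteDimensional K₂ C]
    [IsReduced C] (hζ : IsPrimitiveRoot ζ 3) {x : K₁} {y : K₂}
    (hx : x ≠ 0) (hy : y ≠ 0)
    (h1 : Algebra.norm K₁ (algebraMap K₁ C x - algebraMap K₂ C y) ≠ 0)
    (h2 : Algebra.norm K₂ (algebraMap K₂ C y - algebraMap K₁ C x) ≠ 0)
    (h3 : Algebra.norm K₁ (algebraMap K₂ C y) ≠ 0) :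
    FS (algebraMap (𝓞 k) (𝓞 K₁) ζ) x (Algebra.norm K₁ (algebraMap K₁ C x - algebraMap K₂ C y)) =
      FS (algebraMap (𝓞 k) (𝓞 K₂) ζ) y (Algebra.norm K₂ (algebraMap K₂ C y - algebraMap K₁ C x)) +
      FS (algebraMap (𝓞 k) (𝓞 K₁) ζ) x (Algebra.norm K₁ (algebraMap K₂ C y)) := by
  have : IsArtinianRing C := IsArtinianRing.of_finite K₁ C
  have := Fintype.ofFinite (MaximalSpectrum C)
  have (m : MaximalSpectrum C) : NumberField (C ⧸ m.asIdeal) := numberField_of_finite K₁ _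
  rw [FS_norm_eq_sum (prim_map hζ) hx h1, FS_norm_eq_sum (prim_map hζ) hx h3, FS_norm_eq_sum (prim_map hζ) hy h2,
    ← Finset.sum_add_distrib]
  refine Finset.sum_congr rfl fun m _ => ?_
  rw [algebraMap_tower, algebraMap_tower, map_sub, map_sub]
  have e1 : Ideal.Quotient.mk m.asIdeal (algebraMap K₁ C x) = algebraMap K₁ (C ⧸ m.asIdeal) x := rfl
  have e2 : Ideal.Quotient.mk m.asIdeal (algebraMap K₂ C y) = algebraMap K₂ (C ⧸ m.asIdeal) y := rfl
  rw [e1, e2, ← neg_sub (algebraMap K₁ (C ⧸ m.asIdeal) x), FS_neg_right (prim_map hζ)]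
  refine FS_sub (prim_map hζ) (by simpa) (by simpa) fun h => ?_
  rw [norm_eq_prod] at h1
  refine Finset.prod_ne_zero_iff.mp h1 m (Finset.mem_univ m) ?_
  rw [map_sub, e1, e2, h, Algebra.norm_zero]

lemma norm_tmul_sub (pb : PowerBasis k K₂) (x : K₁) :
    Algebra.norm K₁ (x ⊗ₜ[k] (1 : K₂) - (1 : K₁) ⊗ₜ[k] pb.gen) = aeval x (minpoly k pb.gen) := by
  have e : minpoly k pb.gen = (Algebra.lmul k K₂ pb.gen).charpoly := by
    rw [← charpoly_leftMulMatrix, Algebra.leftMulMatrix_apply, LinearMap.charpoly_toMatrix]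
  rw [e, aeval_def, ← eval_map, ← LinearMap.charpoly_baseChange, LinearMap.eval_charpoly, Algebra.norm_apply]
  congr 1
  ext
  simp [Algebra.TensorProduct.tmul_mul_tmul, TensorProduct.smul_tmul']

lemma norm_one_tmul (y : K₂) : Algebra.norm K₁ ((1 : K₁) ⊗ₜ[k] y) = algebraMap k K₁ (Algebra.norm k y) := by
  rw [Algebra.norm_apply, Algebra.norm_apply, ← LinearMap.det_baseChange]
  congr 1
  ext
  simp

lemma neg_one_pow_mul_eq_or {F : Type*} [Field F] (u : F) (n : ℕ) : (-1) ^ n * u = u ∨ (-1) ^ n * u = - u := by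
  rcases neg_one_pow_eq_or F n with h | h <;> simp [h]

lemma FS_gen_algebraMap (hζ : IsPrimitiveRoot ζ 3) (p₁ : PowerBasis k K₁) (h₁ : p₁.gen ≠ 0) {c : k} (hc : c ≠ 0) :
    FS (algebraMap (𝓞 k) (𝓞 K₁) ζ) p₁.gen (algebraMap k K₁ c) = FS ζ ((minpoly k p₁.gen).coeff 0) c := by
  have : FiniteDimensional k K₁ := p₁.finite
  rw [FS_swap, FS_norm hζ hc h₁, ← FS_swap, Algebra.PowerBasis.norm_gen_eq_coeff_zero_minpoly]
  rcases neg_one_pow_mul_eq_or ((minpoly k p₁.gen).coeff 0) p₁.dim with h | h <;> rw [h]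
  rw [FS_neg_left hζ]

/-- Reciprocity between two points of the multiplicative group over `k`. -/
lemma FS_minpoly (hζ : IsPrimitiveRoot ζ 3) (p₁ : PowerBasis k K₁) (p₂ : PowerBasis k K₂) (h₁ : p₁.gen ≠ 0)
    (h₂ : p₂.gen ≠ 0) (hne : minpoly k p₁.gen ≠ minpoly k p₂.gen) :
    FS (algebraMap (𝓞 k) (𝓞 K₁) ζ) p₁.gen (aeval p₁.gen (minpoly k p₂.gen)) =
      FS (algebraMap (𝓞 k) (𝓞 K₂) ζ) p₂.gen (aeval p₂.gen (minpoly k p₁.gen)) +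
      FS ζ ((minpoly k p₁.gen).coeff 0) ((minpoly k p₂.gen).coeff 0) := by
  have i1 : IsIntegral k p₁.gen := p₁.isIntegral_gen
  have i2 : IsIntegral k p₂.gen := p₂.isIntegral_gen
  have ne1 : aeval p₁.gen (minpoly k p₂.gen) ≠ 0 := fun h => hne
    (minpoly.eq_of_irreducible_of_monic (minpoly.irreducible i2) h (minpoly.monic i2)).symm
  have ne2 : aeval p₂.gen (minpoly k p₁.gen) ≠ 0 := fun h => hne
    (minpoly.eq_of_irreducible_of_monic (minpoly.irreducible i1) h (minpoly.monic i1))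
  have : FiniteDimensional k K₁ := p₁.finite
  have : FiniteDimensional k K₂ := p₂.finite
  let _ : Algebra K₂ (K₁ ⊗[k] K₂) := Algebra.TensorProduct.rightAlgebra
  have : FiniteDimensional K₂ (K₁ ⊗[k] K₂) :=
    Module.Finite.equiv (Algebra.TensorProduct.commRight k K₂ K₁).toLinearEquiv
  have : Algebra.FormallyUnramified k K₂ := Algebra.FormallyUnramified.of_isSeparable k K₂
  have : IsReduced (K₁ ⊗[k] K₂) := Algebra.FormallyUnramified.isReduced_of_field K₁ _
  have a1 : algebraMap K₁ (K₁ ⊗[k] K₂) p₁.gen = p₁.gen ⊗ₜ 1 := rfl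
  have a2 : algebraMap K₂ (K₁ ⊗[k] K₂) p₂.gen = 1 ⊗ₜ p₂.gen := rfl
  have n1 := norm_tmul_sub p₂ p₁.gen
  have n2 : Algebra.norm K₂ ((1 : K₁) ⊗ₜ[k] p₂.gen - p₁.gen ⊗ₜ[k] (1 : K₂)) = aeval p₂.gen (minpoly k p₁.gen) := by
    have e : Algebra.TensorProduct.commRight k K₂ K₁ (p₂.gen ⊗ₜ[k] (1 : K₁) - (1 : K₂) ⊗ₜ[k] p₁.gen) =
        (1 : K₁) ⊗ₜ[k] p₂.gen - p₁.gen ⊗ₜ[k] (1 : K₂) := by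
      rw [map_sub]; rfl
    rw [← norm_tmul_sub p₁ p₂.gen, ← Algebra.norm_eq_of_algEquiv (Algebra.TensorProduct.commRight k K₂ K₁), e]
  have n3 := norm_one_tmul (k := k) (K₁ := K₁) p₂.gen
  have c1 : (minpoly k p₁.gen).coeff 0 ≠ 0 := minpoly.coeff_zero_ne_zero i1 h₁
  have c2 : (minpoly k p₂.gen).coeff 0 ≠ 0 := minpoly.coeff_zero_ne_zero i2 h₂
  have := norm_sub_core (C := K₁ ⊗[k] K₂) hζ h₁ h₂ (by rw [a1, a2, n1]; exact ne1) (by rw [a1, a2, n2]; exact ne2)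
    (by rw [a2, n3, map_ne_zero_iff _ (algebraMap k K₁).injective, Algebra.norm_ne_zero_iff]; exact h₂)
  rw [a1, a2, n1, n2, n3] at this
  rw [this]
  congr 1
  rw [FS_gen_algebraMap hζ p₁ h₁ (Algebra.norm_ne_zero_iff.mpr h₂), Algebra.PowerBasis.norm_gen_eq_coeff_zero_minpoly]
  rcases neg_one_pow_mul_eq_or ((minpoly k p₂.gen).coeff 0) p₂.dim with h | h <;> rw [h]
  rw [FS_neg_right hζ]

lemma FS_algEquiv (hζ : IsPrimitiveRoot ζ 3) (e : K₁ ≃ₐ[k] K₂) {x y : K₁} (hx : x ≠ 0) (hy : y ≠ 0) :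
    FS (algebraMap (𝓞 k) (𝓞 K₂) ζ) (e x) (e y) = FS (algebraMap (𝓞 k) (𝓞 K₁) ζ) x y := by
  have := FS_map e.toRingEquiv (prim_map (K₁ := K₁) hζ) hx hy
  have e1 : RingOfIntegers.mapRingEquiv e.toRingEquiv (algebraMap (𝓞 k) (𝓞 K₁) ζ) = algebraMap (𝓞 k) (𝓞 K₂) ζ :=
    RingOfIntegers.ext (e.commutes ζ)
  rw [e1] at this
  exact this
end CubicRec

namespace CubicRec
set_option linter.unusedSectionVars false
open IsDedekindDomain Polynomial UniqueFactorizationMonoid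

variable {k : Type*} [Field k] [NumberField k] {ζ : 𝓞 k}

lemma numberField_adjoinRoot (P : k[X]) [Fact (Irreducible P)] : NumberField (AdjoinRoot P) := by
  have := (AdjoinRoot.powerBasis (Fact.out : Irreducible P).ne_zero).finite
  exact numberField_of_finite k _

open Classical in
noncomputable def Rirr (ζ : 𝓞 k) (f P : k[X]) : ZMod 3 :=
  if h : Irreducible P then
    haveI := Fact.mk h
    haveI := numberField_adjoinRoot P
    FS (algebraMap (𝓞 k) (𝓞 (AdjoinRoot P)) ζ) (AdjoinRoot.root P) (aeval (AdjoinRoot.root P) f)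
  else 0

noncomputable def RS (ζ : 𝓞 k) (f q : k[X]) : ZMod 3 := by
  classical exact ((normalizedFactors q).map (Rirr ζ f)).sum

lemma RS_one (f : k[X]) : RS ζ f 1 = 0 := by
  classical simp [RS]

lemma RS_mul {q q' : k[X]} (f : k[X]) (hq : q ≠ 0) (hq' : q' ≠ 0) : RS ζ f (q * q') = RS ζ f q + RS ζ f q' := by
  classical simp [RS, normalizedFactors_mul hq hq']

lemma RS_irr {P : k[X]} (f : k[X]) (hP : P.Monic) (h : Irreducible P) : RS ζ f P = Rirr ζ f P := by
  classical rw [RS, normalizedFactors_irreducible h, hP.normalize_eq_self]; simp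

lemma Rirr_eq {L : Type*} [Field L] [NumberField L] [Algebra k L] (hζ : IsPrimitiveRoot ζ 3) (pb : PowerBasis k L)
    {f : k[X]} (h0 : pb.gen ≠ 0) (hf : aeval pb.gen f ≠ 0) :
    Rirr ζ f (minpoly k pb.gen) = FS (algebraMap (𝓞 k) (𝓞 L) ζ) pb.gen (aeval pb.gen f) := by
  have hi := minpoly.irreducible pb.isIntegral_gen
  have := Fact.mk hi
  have := numberField_adjoinRoot (minpoly k pb.gen)
  rw [Rirr, dif_pos hi]
  let p' := AdjoinRoot.powerBasis hi.ne_zero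
  have hm : minpoly k p'.gen = minpoly k pb.gen :=
    AdjoinRoot.minpoly_powerBasis_gen_of_monic (minpoly.monic pb.isIntegral_gen)
  let e := pb.equivOfMinpoly p' hm.symm
  have e1 : e pb.gen = AdjoinRoot.root _ := (PowerBasis.equivOfMinpoly_gen _ _ _)
  rw [← FS_algEquiv hζ e h0 hf, ← Polynomial.aeval_algHom_apply, e1]

lemma exists_powerBasis {P : k[X]} (hP : P.Monic) (h : Irreducible P) [Fact (Irreducible P)] :
    ∃ pb : PowerBasis k (AdjoinRoot P), minpoly k pb.gen = P :=
  ⟨AdjoinRoot.powerBasis h.ne_zero, AdjoinRoot.minpoly_powerBasis_gen_of_monic hP⟩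

lemma monic_induction {motive : ∀ q : k[X], q.Monic → Prop} (h1 : motive 1 monic_one)
    (hmul : ∀ (P q : k[X]) (hP : P.Monic) (_ : Irreducible P) (hq : q.Monic), motive P hP → motive q hq →
      motive (P * q) (hP.mul hq))
    (hirr : ∀ (P : k[X]) (hP : P.Monic), Irreducible P → motive P hP) {q : k[X]} (hq : q.Monic) : motive q hq := by
  induction hn : q.natDegree using Nat.strong_induction_on generalizing q with
  | _ n ih =>
    subst hn
    by_cases hu : IsUnit q
    · obtain rfl := hq.isUnit_iff.mp hu
      exact h1
    obtain ⟨P, hP, hPi, r, rfl⟩ := exists_monic_irreducible_factor q hu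
    have hr : r.Monic := hP.of_mul_monic_left hq
    refine hmul P r hP hPi hr (hirr P hP hPi) (ih _ ?_ hr rfl)
    rw [hP.natDegree_mul hr]
    have := hPi.natDegree_pos
    omega

lemma coeff_zero_mul_ne {p q : k[X]} : (p * q).coeff 0 ≠ 0 ↔ p.coeff 0 ≠ 0 ∧ q.coeff 0 ≠ 0 := by
  rw [mul_coeff_zero, mul_ne_zero_iff]

section
variable {L : Type*} [Field L] [NumberField L] [Algebra k L]

lemma aeval_gen_ne_zero (pb : PowerBasis k L) {f : k[X]} (h : IsCoprime f (minpoly k pb.gen)) : aeval pb.gen f ≠ 0 := by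
  obtain ⟨a, b, hab⟩ := h
  intro hf
  have := congrArg (aeval pb.gen) hab
  simp [hf] at this

lemma gen_ne_zero (pb : PowerBasis k L) (h : (minpoly k pb.gen).coeff 0 ≠ 0) : pb.gen ≠ 0 := by
  intro h0
  apply h
  rw [h0, minpoly.zero]; simp
end

lemma RS_mul_left (hζ : IsPrimitiveRoot ζ 3) {f g q : k[X]} (hq : q.Monic) (h0 : q.coeff 0 ≠ 0) (hf : IsCoprime f q)
    (hg : IsCoprime g q) : RS ζ (f * g) q = RS ζ f q + RS ζ g q := by
  induction hq using monic_induction with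
  | h1 => simp [RS_one]
  | hmul P q hP hi hq ih1 ih2 =>
    rw [coeff_zero_mul_ne] at h0
    rw [IsCoprime.mul_right_iff] at hf hg
    rw [RS_mul _ hP.ne_zero hq.ne_zero, RS_mul _ hP.ne_zero hq.ne_zero, RS_mul _ hP.ne_zero hq.ne_zero,
      ih1 h0.1 hf.1 hg.1, ih2 h0.2 hf.2 hg.2]
    ring
  | hirr P hP hi =>
    have := Fact.mk hi
    have := numberField_adjoinRoot P
    rw [RS_irr _ hP hi, RS_irr _ hP hi, RS_irr _ hP hi]
    obtain ⟨pb, e⟩ := exists_powerBasis hP hi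
    rw [← e] at h0 hf hg
    have hg0 := gen_ne_zero pb h0
    have hf' := aeval_gen_ne_zero pb hf
    have hg' := aeval_gen_ne_zero pb hg
    have h1 := Rirr_eq hζ pb (f := f * g) hg0 (by rw [map_mul]; exact mul_ne_zero hf' hg')
    rw [map_mul, FS_mul_right (prim_map hζ) hf' hg' hg0, ← Rirr_eq hζ pb hg0 hf', ← Rirr_eq hζ pb hg0 hg', e] at h1
    exact h1

lemma RS_add_mul {f q : k[X]} (hq : q.Monic) (s : k[X]) : RS ζ (f + q * s) q = RS ζ f q := by
  induction hq using monic_induction generalizing s with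
  | h1 => simp [RS_one]
  | hmul P q hP hi hq ih1 ih2 =>
    rw [RS_mul _ hP.ne_zero hq.ne_zero, RS_mul _ hP.ne_zero hq.ne_zero, mul_assoc, ih1, mul_left_comm, ih2]
  | hirr P hP hi =>
    rw [RS_irr _ hP hi, RS_irr _ hP hi, Rirr, Rirr, dif_pos hi, dif_pos hi]
    simp

lemma RS_modByMonic {f q : k[X]} (hq : q.Monic) : RS ζ (f %ₘ q) q = RS ζ f q := by
  conv_rhs => rw [← modByMonic_add_div f q]
  rw [RS_add_mul hq]

lemma RS_C (hζ : IsPrimitiveRoot ζ 3) {c : k} {q : k[X]} (hq : q.Monic) (h0 : q.coeff 0 ≠ 0) (hc : c ≠ 0) :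
    RS ζ (C c) q = FS ζ (q.coeff 0) c := by
  induction hq using monic_induction with
  | h1 => simp [RS_one, FS_one_left hζ hc]
  | hmul P q hP hi hq ih1 ih2 =>
    rw [coeff_zero_mul_ne] at h0
    rw [RS_mul _ hP.ne_zero hq.ne_zero, ih1 h0.1, ih2 h0.2, mul_coeff_zero, FS_mul_left hζ h0.1 h0.2 hc]
  | hirr P hP hi =>
    have := Fact.mk hi
    have := numberField_adjoinRoot P
    rw [RS_irr _ hP hi]
    obtain ⟨pb, e⟩ := exists_powerBasis hP hi
    rw [← e] at h0
    have hg0 := gen_ne_zero pb h0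
    have h1 := Rirr_eq hζ pb (f := C c) hg0 (by simpa)
    rw [aeval_C, FS_gen_algebraMap hζ pb hg0 hc, e] at h1
    exact h1

lemma RS_X (hζ : IsPrimitiveRoot ζ 3) {q : k[X]} (hq : q.Monic) (h0 : q.coeff 0 ≠ 0) : RS ζ X q = 0 := by
  induction hq using monic_induction with
  | h1 => simp [RS_one]
  | hmul P q hP hi hq ih1 ih2 =>
    rw [coeff_zero_mul_ne] at h0
    rw [RS_mul _ hP.ne_zero hq.ne_zero, ih1 h0.1, ih2 h0.2, add_zero]
  | hirr P hP hi =>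
    have := Fact.mk hi
    have := numberField_adjoinRoot P
    rw [RS_irr _ hP hi]
    obtain ⟨pb, e⟩ := exists_powerBasis hP hi
    rw [← e] at h0
    have hg0 := gen_ne_zero pb h0
    have h1 := Rirr_eq hζ pb (f := X) hg0 (by simpa)
    rw [aeval_X, FS_self, e] at h1
    exact h1

/-- Reciprocity for the symbol of two coprime monic polynomials. -/
lemma RS_swap (hζ : IsPrimitiveRoot ζ 3) {f q : k[X]} (hf : f.Monic) (hq : q.Monic) (f0 : f.coeff 0 ≠ 0)
    (q0 : q.coeff 0 ≠ 0) (h : IsCoprime f q) : RS ζ f q = RS ζ q f + FS ζ (q.coeff 0) (f.coeff 0) := by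
  induction hq using monic_induction generalizing f with
  | h1 =>
    rw [RS_one, coeff_one_zero, FS_one_left hζ f0, ← C_1, RS_C hζ hf f0 one_ne_zero, FS_one_right hζ f0, add_zero]
  | hmul P q hP hi hq ih1 ih2 =>
    rw [coeff_zero_mul_ne] at q0
    rw [IsCoprime.mul_right_iff] at h
    rw [RS_mul _ hP.ne_zero hq.ne_zero, ih1 hf f0 q0.1 h.1, ih2 hf f0 q0.2 h.2, mul_coeff_zero,
      FS_mul_left hζ q0.1 q0.2 f0, RS_mul_left hζ hf f0 h.1.symm h.2.symm]
    ring
  | hirr P hP hi =>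
    induction hf using monic_induction with
    | h1 =>
      rw [RS_one, coeff_one_zero, FS_one_right hζ q0, ← C_1, RS_C hζ hP q0 one_ne_zero, FS_one_right hζ q0, add_zero]
    | hmul G f hG hj hf ih1 ih2 =>
      rw [coeff_zero_mul_ne] at f0
      rw [IsCoprime.mul_left_iff] at h
      rw [RS_mul _ hG.ne_zero hf.ne_zero, RS_mul_left hζ hP q0 h.1 h.2, mul_coeff_zero,
        FS_mul_right hζ f0.1 f0.2 q0, ih1 f0.1 h.1, ih2 f0.2 h.2]
      ring
    | hirr G hG hj =>
      have := Fact.mk hi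
      have := numberField_adjoinRoot P
      have := Fact.mk hj
      have := numberField_adjoinRoot G
      rw [RS_irr _ hP hi, RS_irr _ hG hj]
      obtain ⟨p₁, e₁⟩ := exists_powerBasis hP hi
      obtain ⟨p₂, e₂⟩ := exists_powerBasis hG hj
      rw [← e₁] at q0
      rw [← e₂] at f0
      rw [← e₁, ← e₂] at h
      have hne : minpoly k p₁.gen ≠ minpoly k p₂.gen := by
        intro e
        rw [e, isCoprime_self] at h
        exact (minpoly.irreducible p₂.isIntegral_gen).not_isUnit h
      have h1 := Rirr_eq hζ p₁ (gen_ne_zero p₁ q0) (aeval_gen_ne_zero p₁ h)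
      have h2 := Rirr_eq hζ p₂ (gen_ne_zero p₂ f0) (aeval_gen_ne_zero p₂ h.symm)
      have h3 := FS_minpoly hζ p₁ p₂ (gen_ne_zero p₁ q0) (gen_ne_zero p₂ f0) hne
      rw [← h1, ← h2, e₁, e₂] at h3
      exact h3
end CubicRec

namespace CubicRec
set_option linter.unusedSectionVars false
open IsDedekindDomain Polynomial UniqueFactorizationMonoid
open Filter Topology

section Conv
variable {k Ω ι : Type*} [Field k] [NormedField Ω] (σ : k →+* Ω) (l : Filter ι)

/-- Coefficientwise convergence of polynomials of bounded degree. -/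
structure Conv (f : ι → k[X]) (f₀ : k[X]) : Prop where
  deg : ∃ D, ∀ n, (f n).natDegree ≤ D
  tendsto : ∀ i, Tendsto (fun n => σ ((f n).coeff i)) l (𝓝 (σ (f₀.coeff i)))

variable {σ l}

lemma Conv.const (f : k[X]) : Conv σ l (fun _ => f) f := ⟨⟨_, fun _ => le_rfl⟩, fun _ => tendsto_const_nhds⟩

lemma Conv.add {f g : ι → k[X]} {f₀ g₀ : k[X]} (hf : Conv σ l f f₀) (hg : Conv σ l g g₀) :
    Conv σ l (fun n => f n + g n) (f₀ + g₀) := by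
  obtain ⟨D, hD⟩ := hf.deg
  obtain ⟨E, hE⟩ := hg.deg
  refine ⟨⟨max D E, fun n => (natDegree_add_le _ _).trans (max_le_max (hD n) (hE n))⟩, fun i => ?_⟩
  simpa using (hf.tendsto i).add (hg.tendsto i)

lemma Conv.mul {f g : ι → k[X]} {f₀ g₀ : k[X]} (hf : Conv σ l f f₀) (hg : Conv σ l g g₀) :
    Conv σ l (fun n => f n * g n) (f₀ * g₀) := by
  obtain ⟨D, hD⟩ := hf.deg
  obtain ⟨E, hE⟩ := hg.deg
  refine ⟨⟨D + E, fun n => natDegree_mul_le.trans (add_le_add (hD n) (hE n))⟩, fun i => ?_⟩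
  simp only [coeff_mul, map_sum, map_mul]
  exact tendsto_finsetSum _ fun p _ => (hf.tendsto p.1).mul (hg.tendsto p.2)

lemma Conv.sub {f g : ι → k[X]} {f₀ g₀ : k[X]} (hf : Conv σ l f f₀) (hg : Conv σ l g g₀) :
    Conv σ l (fun n => f n - g n) (f₀ - g₀) := by
  have := hf.add ((Conv.const (-1)).mul hg)
  simpa only [neg_one_mul, ← sub_eq_add_neg] using this

lemma Conv.C {c : ι → k} {c₀ : k} (h : Tendsto (fun n => σ (c n)) l (𝓝 (σ c₀))) :
    Conv σ l (fun n => Polynomial.C (c n)) (Polynomial.C c₀) := by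
  refine ⟨⟨0, by simp⟩, fun i => ?_⟩
  rcases i with _ | i
  · simpa using h
  · simpa using tendsto_const_nhds

lemma Conv.modByMonic {f q : ι → k[X]} {f₀ p : k[X]} (hf : Conv σ l f f₀) (hq : Conv σ l q p) (hqm : ∀ n, (q n).Monic)
    (hp : p.Monic) (hr : ∀ n, (q n).natDegree = p.natDegree) : Conv σ l (fun n => f n %ₘ q n) (f₀ %ₘ p) := by
  obtain ⟨D, hD⟩ := hf.deg
  have hD' : ∀ n, (f n).natDegree ≤ max D f₀.natDegree := fun n => (hD n).trans (le_max_left _ _)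
  have hD0 := le_max_right D f₀.natDegree
  generalize max D f₀.natDegree = E at hD' hD0
  clear hD
  induction E using Nat.strong_induction_on generalizing f f₀ with
  | _ E ih =>
    by_cases hE : E < p.natDegree
    · convert hf using 1
      · ext1 n
        exact (modByMonic_eq_self_iff (hqm n)).mpr (degree_lt_degree ((hD' n).trans_lt (hE.trans_eq (hr n).symm)))
      · exact (modByMonic_eq_self_iff hp).mpr (degree_lt_degree (hD0.trans_lt hE))
    push Not at hE
    have step : ∀ (g q : k[X]), q.Monic → g.natDegree ≤ E → q.natDegree = p.natDegree →
        (g - Polynomial.C (g.coeff E) * X ^ (E - p.natDegree) * q) %ₘ q = g %ₘ q ∧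
        (g - Polynomial.C (g.coeff E) * X ^ (E - p.natDegree) * q).natDegree ≤ E ∧
        (g - Polynomial.C (g.coeff E) * X ^ (E - p.natDegree) * q).coeff E = 0 := by
      intro g q hq hg hqp
      refine ⟨?_, ?_, ?_⟩
      · rw [sub_modByMonic, mul_comm _ q, self_mul_modByMonic hq, sub_zero]
      · refine (natDegree_sub_le _ _).trans (max_le hg ?_)
        refine natDegree_mul_le.trans ?_
        have := natDegree_C_mul_X_pow_le (g.coeff E) (E - p.natDegree)
        omega
      · have hc : (X ^ (E - p.natDegree) * q).coeff E = 1 := by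
          have : E = p.natDegree + (E - p.natDegree) := by omega
          conv_lhs => rw [this, Nat.add_sub_cancel_left, coeff_X_pow_mul, ← hqp]
          exact hq.coeff_natDegree
        rw [coeff_sub, mul_assoc, coeff_C_mul, hc, mul_one, sub_self]
    have hconv : Conv σ l (fun n => f n - Polynomial.C ((f n).coeff E) * X ^ (E - p.natDegree) * q n)
        (f₀ - Polynomial.C (f₀.coeff E) * X ^ (E - p.natDegree) * p) :=
      hf.sub (((Conv.C (hf.tendsto E)).mul (.const _)).mul hq)
    have e1 : (fun n => f n %ₘ q n) = fun n => (f n - Polynomial.C ((f n).coeff E) * X ^ (E - p.natDegree) * q n) %ₘ q n :=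
      funext fun n => (step (f n) (q n) (hqm n) (hD' n) (hr n)).1.symm
    rw [e1, ← (step f₀ p hp hD0 rfl).1]
    rcases Nat.eq_zero_or_pos E with rfl | hpos
    · have hp0 : p.natDegree = 0 := by omega
      have hp1 : p = 1 := hp.natDegree_eq_zero.mp hp0
      have hq1 : ∀ n, q n = 1 := fun n => (hqm n).natDegree_eq_zero.mp ((hr n).trans hp0)
      simp only [hp1, hq1, modByMonic_one]
      exact .const 0
    have lt : ∀ g : k[X], g.natDegree ≤ E → g.coeff E = 0 → g.natDegree ≤ E - 1 := by
      intro g h1 h2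
      by_contra h3
      have h4 : g.natDegree = E := by omega
      rw [← h4, coeff_natDegree, leadingCoeff_eq_zero] at h2
      rw [h2, natDegree_zero] at h4
      omega
    exact ih (E - 1) (by omega) hconv
      (fun n => lt _ (step (f n) (q n) (hqm n) (hD' n) (hr n)).2.1 (step (f n) (q n) (hqm n) (hD' n) (hr n)).2.2)
      (lt _ (step f₀ p hp hD0 rfl).2.1 (step f₀ p hp hD0 rfl).2.2)

lemma eventually_ne {a : ι → k} {a₀ : k} (ha : Tendsto (fun n => σ (a n)) l (𝓝 (σ a₀))) (h : a₀ ≠ 0) :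
    ∀ᶠ n in l, a n ≠ 0 := by
  filter_upwards [ha.eventually_ne ((map_ne_zero σ).mpr h)] with n hn
  exact (map_ne_zero σ).mp hn

lemma Conv.eventually_isCoprime {f q : ι → k[X]} {f₀ p : k[X]} (hf : Conv σ l f f₀) (hq : Conv σ l q p)
    (hqm : ∀ n, (q n).Monic) (hp : p.Monic) (hr : ∀ n, (q n).natDegree = p.natDegree) (h : IsCoprime f₀ p) :
    ∀ᶠ n in l, IsCoprime (f n) (q n) := by
  obtain ⟨D, hD⟩ := hf.deg
  have hD' : ∀ n, (f n).natDegree ≤ max D f₀.natDegree := fun n => (hD n).trans (le_max_left _ _)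
  have hD0 := le_max_right D f₀.natDegree
  generalize max D f₀.natDegree = E at hD' hD0
  have key : Tendsto (fun n => σ (res (q n) (f n))) l (𝓝 (σ (res p f₀))) := by
    have e : ∀ n, σ (res (q n) (f n)) = (((q n).sylvester (f n) p.natDegree E).map σ).det := by
      intro n
      rw [← res_eq (hqm n) (f n) (hD' n), hr, resultant, RingHom.map_det]; rfl
    have e0 : σ (res p f₀) = ((p.sylvester f₀ p.natDegree E).map σ).det := by
      rw [← res_eq hp f₀ hD0, resultant, RingHom.map_det]; rfl
    rw [e0]
    simp only [e]
    refine (Continuous.tendsto (f := fun M : Matrix (Fin (p.natDegree + E)) (Fin (p.natDegree + E)) Ω => M.det)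
      (by fun_prop) _).comp ?_
    refine tendsto_pi_nhds.mpr fun i => tendsto_pi_nhds.mpr fun j => ?_
    induction j using Fin.addCases with
    | left j =>
      simp only [Matrix.map_apply, sylvester, Matrix.of_apply, Fin.addCases_left]
      split_ifs
      · exact hf.tendsto _
      · exact tendsto_const_nhds
    | right j =>
      simp only [Matrix.map_apply, sylvester, Matrix.of_apply, Fin.addCases_right]
      split_ifs
      · exact hq.tendsto _
      · exact tendsto_const_nhds
  filter_upwards [eventually_ne key (resultant_ne_zero _ _ h.symm)] with n hn
  by_contra hc
  exact hn (resultant_eq_zero_iff.mpr ⟨.inl (hqm n).ne_zero, fun h => hc h.symm⟩)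
end Conv

section LocConst
variable {k Ω ι : Type*} [Field k] [NumberField k] {ζ : 𝓞 k} [NormedField Ω] {σ : k →+* Ω} {l : Filter ι}

/-- The global symbol is continuous at `1` in the topology induced by `σ`. -/
def SmallTrivial (ζ : 𝓞 k) (σ : k →+* Ω) : Prop :=
  ∃ ε > 0, ∀ a b : k, a ≠ 0 → b ≠ 0 → ‖σ b - 1‖ < ε → FS ζ a b = 0

lemma SmallTrivial.eventually_right (hs : SmallTrivial ζ σ) (hζ : IsPrimitiveRoot ζ 3) {b : ι → k} {b₀ : k}
    (hb : Tendsto (fun n => σ (b n)) l (𝓝 (σ b₀))) (h : b₀ ≠ 0) :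
    ∀ᶠ n in l, ∀ a : k, a ≠ 0 → FS ζ a (b n) = FS ζ a b₀ := by
  obtain ⟨ε, hε, H⟩ := hs
  have h1 : Tendsto (fun n => σ (b n) / σ b₀) l (𝓝 1) := by
    simpa [div_self ((map_ne_zero σ).mpr h)] using hb.div_const (σ b₀)
  filter_upwards [eventually_ne hb h, Metric.tendsto_nhds.mp h1 ε hε] with n hn hd a ha
  rw [dist_eq_norm, ← map_div₀] at hd
  have := H a (b n / b₀) ha (div_ne_zero hn h) hd
  rw [FS_div_right hζ hn h ha] at this
  exact sub_eq_zero.mp this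

lemma SmallTrivial.eventually (hs : SmallTrivial ζ σ) (hζ : IsPrimitiveRoot ζ 3) {a b : ι → k} {a₀ b₀ : k}
    (ha : Tendsto (fun n => σ (a n)) l (𝓝 (σ a₀))) (ha0 : a₀ ≠ 0)
    (hb : Tendsto (fun n => σ (b n)) l (𝓝 (σ b₀))) (hb0 : b₀ ≠ 0) :
    ∀ᶠ n in l, FS ζ (a n) (b n) = FS ζ a₀ b₀ := by
  filter_upwards [hs.eventually_right hζ hb hb0, hs.eventually_right hζ ha ha0, eventually_ne ha ha0] with n h1 h2 h3
  rw [h1 _ h3, FS_swap, h2 _ hb0, ← FS_swap]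

lemma isCoprime_C {c : k} (hc : c ≠ 0) (q : k[X]) : IsCoprime (C c) q :=
  ⟨C c⁻¹, 0, by rw [← C_mul, inv_mul_cancel₀ hc]; simp⟩

lemma RS_C_mul (hζ : IsPrimitiveRoot ζ 3) {b : k} {g q : k[X]} (hb : b ≠ 0) (hg : g.Monic) (hq : q.Monic)
    (g0 : g.coeff 0 ≠ 0) (q0 : q.coeff 0 ≠ 0) (h : IsCoprime g q) :
    RS ζ (C b * g) q = FS ζ (q.coeff 0) b + (RS ζ q g + FS ζ (q.coeff 0) (g.coeff 0)) := by
  rw [RS_mul_left hζ hq q0 (isCoprime_C hb q) h, RS_C hζ hq q0 hb, RS_swap hζ hg hq g0 q0 h]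

/-- A monic replacement for `g` of degree at most `m`: the rescaling of `g` if its coefficient in degree `m` is
nonzero. -/
noncomputable def scaled (m : ℕ) (g : k[X]) : k[X] := X ^ m + C (g.coeff m)⁻¹ * (g - C (g.coeff m) * X ^ m)

lemma scaled_aux {m : ℕ} {g : k[X]} (hg : g.natDegree ≤ m) : (C (g.coeff m)⁻¹ * (g - C (g.coeff m) * X ^ m)).degree < (m : WithBot ℕ) := by
  rw [degree_lt_iff_coeff_zero]
  intro i hi
  rw [coeff_C_mul, coeff_sub, coeff_C_mul, coeff_X_pow]
  rcases hi.eq_or_lt with rfl | hi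
  · simp
  · rw [coeff_eq_zero_of_natDegree_lt (hg.trans_lt hi), if_neg hi.ne']; simp

lemma scaled_monic {m : ℕ} {g : k[X]} (hg : g.natDegree ≤ m) : (scaled m g).Monic := monic_X_pow_add (scaled_aux hg)

lemma natDegree_scaled {m : ℕ} {g : k[X]} (hg : g.natDegree ≤ m) : (scaled m g).natDegree = m := by
  rw [scaled, natDegree_add_eq_left_of_degree_lt, natDegree_X_pow]
  rw [degree_X_pow]; exact scaled_aux hg

lemma scaled_spec {m : ℕ} {g : k[X]} (h : g.coeff m ≠ 0) : g = C (g.coeff m) * scaled m g := by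
  rw [scaled, mul_add, ← mul_assoc, ← C_mul, mul_inv_cancel₀ h]
  simp

lemma Conv.normalized {m : ℕ} {g : ι → k[X]} {g₀ : k[X]} (hg : Conv σ l g g₀) (h : g₀.coeff m ≠ 0) :
    Conv σ l (fun n => scaled m (g n)) (scaled m g₀) := by
  refine (Conv.const _).add ((Conv.C ?_).mul (hg.sub ((Conv.C (hg.tendsto m)).mul (.const _))))
  simp only [map_inv₀]
  exact (hg.tendsto m).inv₀ ((map_ne_zero σ).mpr h)

variable (ζ σ l) in
/-- Local constancy of `RS f q` in both arguments, for `q` of degree `r`. -/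
def LocConst (r : ℕ) : Prop := ∀ (f q : ι → k[X]) (f₀ p : k[X]), Conv σ l f f₀ → Conv σ l q p → (∀ n, (q n).Monic) →
  p.Monic → (∀ n, (q n).natDegree = r) → p.natDegree = r → p.coeff 0 ≠ 0 → IsCoprime f₀ p →
  ∀ᶠ n in l, RS ζ (f n) (q n) = RS ζ f₀ p

lemma LocConst.swap (hs : SmallTrivial ζ σ) (hζ : IsPrimitiveRoot ζ 3) {m : ℕ} (hm : LocConst ζ σ l m)
    {g q : ι → k[X]} {g₀ p : k[X]} (hg : Conv σ l g g₀) (hq : Conv σ l q p) (hqm : ∀ n, (q n).Monic) (hp : p.Monic)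
    (hr : ∀ n, (q n).natDegree = p.natDegree) (p0 : p.coeff 0 ≠ 0) (h : IsCoprime g₀ p)
    (hgm : ∀ n, (g n).natDegree ≤ m) (hg0 : g₀.natDegree = m) (g0 : g₀.coeff 0 ≠ 0) :
    ∀ᶠ n in l, RS ζ (g n) (q n) = RS ζ g₀ p := by
  have b0 : g₀.coeff m ≠ 0 := by
    rw [← hg0, coeff_natDegree, leadingCoeff_ne_zero]; rintro rfl; simp at g0
  have e := scaled_spec b0
  have hcop : IsCoprime (scaled m g₀) p := by
    rw [e] at h; exact h.of_mul_left_right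
  have c0 : (scaled m g₀).coeff 0 ≠ 0 := by
    rw [e, coeff_C_mul] at g0; exact right_ne_zero_of_mul g0
  have hc := hg.normalized b0
  filter_upwards [eventually_ne (hg.tendsto m) b0, eventually_ne (hc.tendsto 0) c0, eventually_ne (hq.tendsto 0) p0,
    hc.eventually_isCoprime hq hqm hp hr hcop, hs.eventually hζ (hq.tendsto 0) p0 (hg.tendsto m) b0,
    hs.eventually hζ (hq.tendsto 0) p0 (hc.tendsto 0) c0,
    hm q _ p _ hq hc (fun n => scaled_monic (hgm n)) (scaled_monic hg0.le) (fun n => natDegree_scaled (hgm n)) (natDegree_scaled hg0.le)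
      c0 hcop.symm] with n h1 h2 h3 h4 h5 h6 h7
  rw [scaled_spec h1, e, RS_C_mul hζ h1 (scaled_monic (hgm n)) (hqm n) h2 h3 h4, h5, h6, h7,
    ← RS_C_mul hζ b0 (scaled_monic hg0.le) hp c0 p0 hcop]

section Step
variable {r : ℕ} {q : ι → k[X]} {p : k[X]}

lemma LocConst.near_one (hs : SmallTrivial ζ σ) (hζ : IsPrimitiveRoot ζ 3) (hm : LocConst ζ σ l r)
    {h : ι → k[X]} (hh : Conv σ l h 1) (hq : Conv σ l q p) (hqm : ∀ n, (q n).Monic) (hp : p.Monic)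
    (hr : ∀ n, (q n).natDegree = r + 1) (hpr : p.natDegree = r + 1) (p0 : p.coeff 0 ≠ 0) :
    ∀ᶠ n in l, RS ζ (h n) (q n) = 0 := by
  classical
  obtain ⟨c, hc⟩ := Infinite.exists_notMem_finset (insert 0 p.roots.toFinset)
  rw [Finset.mem_insert, not_or, Multiset.mem_toFinset, mem_roots hp.ne_zero] at hc
  obtain ⟨hc0, hc⟩ := hc
  have hr' : ∀ n, (q n).natDegree = p.natDegree := fun n => (hr n).trans hpr.symm
  have gd : ((X - C c : k[X]) ^ r).natDegree = r := by simp
  have g0 : ((X - C c : k[X]) ^ r).coeff 0 ≠ 0 := by simp [coeff_zero_eq_eval_zero, hc0]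
  have gc : IsCoprime ((X - C c : k[X]) ^ r) p := by
    refine IsCoprime.pow_left ?_
    rw [(irreducible_X_sub_C c).coprime_iff_not_dvd, dvd_iff_isRoot]
    exact hc
  have hmod : ((1 : k[X]) * (X - C c : k[X]) ^ r) %ₘ p = (X - C c) ^ r := by
    rw [one_mul, modByMonic_eq_self_iff hp]
    exact degree_lt_degree (by omega)
  have hconv := (hh.mul (Conv.const ((X - C c : k[X]) ^ r))).modByMonic hq hqm hp hr'
  rw [hmod] at hconv
  have hne : ∀ n, q n ≠ 1 := fun n e => by have := hr n; rw [e] at this; simp at this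
  filter_upwards [eventually_ne (hq.tendsto 0) p0,
    hh.eventually_isCoprime hq hqm hp hr' isCoprime_one_left,
    (Conv.const _).eventually_isCoprime hq hqm hp hr' gc,
    hm.swap hs hζ hconv hq hqm hp hr' p0 gc (fun n => by
      have := natDegree_modByMonic_lt (h n * (X - C c) ^ r) (hqm n) (hne n)
      rw [hr] at this; omega) gd g0,
    hm.swap hs hζ (Conv.const ((X - C c : k[X]) ^ r)) hq hqm hp hr' p0 gc (fun _ => gd.le) gd g0] with n h1 h2 h3 h4 h5
  rw [RS_modByMonic (hqm n), RS_mul_left hζ (hqm n) h1 h2 h3, h5] at h4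
  simpa using h4

lemma LocConst.left (hs : SmallTrivial ζ σ) (hζ : IsPrimitiveRoot ζ 3) (hm : LocConst ζ σ l r)
    {f : ι → k[X]} {f₀ : k[X]} (hf : Conv σ l f f₀) (hq : Conv σ l q p) (hqm : ∀ n, (q n).Monic) (hp : p.Monic)
    (hr : ∀ n, (q n).natDegree = r + 1) (hpr : p.natDegree = r + 1) (p0 : p.coeff 0 ≠ 0) (hc : IsCoprime f₀ p) :
    ∀ᶠ n in l, RS ζ (f n) (q n) = RS ζ f₀ (q n) := by
  have hr' : ∀ n, (q n).natDegree = p.natDegree := fun n => (hr n).trans hpr.symm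
  have hcop := hc
  obtain ⟨u, s, hus⟩ := hc
  have hu : IsCoprime u p := ⟨f₀, s, by rw [← hus]; ring⟩
  have key : ∀ {g : ι → k[X]}, Conv σ l g f₀ → ∀ᶠ n in l, RS ζ (g n) (q n) + RS ζ u (q n) = 0 := by
    intro g hg
    have hconv := (hg.mul (Conv.const u)).add (hq.mul (Conv.const s))
    rw [show f₀ * u + p * s = 1 by rw [← hus]; ring] at hconv
    filter_upwards [hm.near_one hs hζ hconv hq hqm hp hr hpr p0, eventually_ne (hq.tendsto 0) p0,
      hg.eventually_isCoprime hq hqm hp hr' hcop, (Conv.const u).eventually_isCoprime hq hqm hp hr' hu] with n h1 h2 h3 h4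
    rwa [RS_add_mul (hqm n), RS_mul_left hζ (hqm n) h2 h3 h4] at h1
  filter_upwards [key hf, key (Conv.const f₀)] with n h1 h2
  exact add_right_cancel (h1.trans h2.symm)
end Step

lemma RS_X_pow_mul (hζ : IsPrimitiveRoot ζ 3) {f q : k[X]} (hq : q.Monic) (q0 : q.coeff 0 ≠ 0) (h : IsCoprime f q) (j : ℕ) :
    RS ζ (X ^ j * f) q = RS ζ f q := by
  have hX : IsCoprime X q := by rwa [irreducible_X.coprime_iff_not_dvd, X_dvd_iff]
  induction j with
  | zero => simp
  | succ j ih => rw [pow_succ', mul_assoc, RS_mul_left hζ hq q0 hX ((hX.pow_left).mul_left h), RS_X hζ hq q0, ih, zero_add]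

theorem locConst (hs : SmallTrivial ζ σ) (hζ : IsPrimitiveRoot ζ 3) (r : ℕ) : LocConst ζ σ l r := by
  induction r using Nat.strong_induction_on with
  | _ r ih =>
  intro f q f₀ p hf hq hqm hp hr hpr p0 hc
  rcases r with _ | r
  · refine Eventually.of_forall fun n => ?_
    rw [hp.natDegree_eq_zero.mp hpr, (hqm n).natDegree_eq_zero.mp (hr n), RS_one, RS_one]
  have hr' : ∀ n, (q n).natDegree = p.natDegree := fun n => (hr n).trans hpr.symm
  have hm := ih r (by omega)
  have hcm : IsCoprime (f₀ %ₘ p) p := by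
    rw [← modByMonic_add_div f₀ p] at hc
    exact IsCoprime.of_add_mul_left_left hc
  have hne : f₀ %ₘ p ≠ 0 := by
    intro h
    rw [h, isCoprime_zero_left] at hcm
    have := natDegree_eq_zero_of_isUnit hcm
    omega
  have hlt : (f₀ %ₘ p).natDegree < p.natDegree := natDegree_modByMonic_lt _ hp (by rintro rfl; simp at hpr)
  obtain ⟨f₂, e, hnd⟩ := exists_eq_pow_rootMultiplicity_mul_and_not_dvd _ hne 0
  rw [C_0, sub_zero] at e hnd
  rw [X_dvd_iff] at hnd
  generalize rootMultiplicity 0 (f₀ %ₘ p) = j at e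
  have hcm2 : IsCoprime f₂ p := by rw [e] at hcm; exact hcm.of_mul_left_right
  have hd2 : f₂.natDegree < r + 1 := by
    have : f₂ ≠ 0 := by rintro rfl; simp at hnd
    rw [e, natDegree_mul (by simp) this] at hlt; omega
  have hconv := (Conv.const (σ := σ) (l := l) f₀).sub (hq.mul (Conv.const (f₀ /ₘ p)))
  rw [show f₀ - p * (f₀ /ₘ p) = f₀ %ₘ p from (eq_sub_of_add_eq (modByMonic_add_div f₀ p)).symm] at hconv
  filter_upwards [hm.left hs hζ hf hq hqm hp hr hpr p0 hc, hm.left hs hζ hconv hq hqm hp hr hpr p0 hcm,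
    (ih _ hd2).swap hs hζ (Conv.const f₂) hq hqm hp hr' p0 hcm2 (fun _ => le_rfl) rfl hnd,
    eventually_ne (hq.tendsto 0) p0, (Conv.const f₂).eventually_isCoprime hq hqm hp hr' hcm2] with n h1 h2 h3 h4 h5
  rw [sub_eq_add_neg, ← mul_neg, RS_add_mul (hqm n), e, RS_X_pow_mul hζ (hqm n) h4 h5, h3] at h2
  rw [h1, h2, ← RS_X_pow_mul hζ hp p0 hcm2 j, ← e, RS_modByMonic hp]
end LocConst

section NearOne
variable {k Ω L : Type*} [Field k] [NumberField k] {ζ : 𝓞 k} [NormedField Ω] {σ : k →+* Ω}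
  [Field L] [NumberField L] [Algebra k L]

lemma exists_common_denom (pb : PowerBasis k L) :
    ∃ d : 𝓞 k, d ≠ 0 ∧ ∀ (x : 𝓞 L) i, ∃ c : 𝓞 k, (c : k) = d * pb.basis.repr (x : L) i := by
  have : FiniteDimensional k L := pb.finite
  have : Module.Finite (𝓞 k) (𝓞 L) := Module.Finite.of_restrictScalars_finite ℤ _ _
  obtain ⟨s, hs⟩ := Module.Finite.fg_top (R := 𝓞 k) (M := 𝓞 L)
  classical
  obtain ⟨d, hd⟩ := IsLocalization.exist_integer_multiples (nonZeroDivisors (𝓞 k)) (s ×ˢ Finset.univ)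
    (fun p : 𝓞 L × Fin pb.dim => pb.basis.repr (p.1 : L) p.2)
  refine ⟨d, nonZeroDivisors.ne_zero d.2, fun x => ?_⟩
  have hx : x ∈ Submodule.span (𝓞 k) (s : Set (𝓞 L)) := hs ▸ Submodule.mem_top
  induction hx using Submodule.span_induction with
  | mem x hx =>
    intro i
    obtain ⟨c, hc⟩ := hd (x, i) (by simpa using hx)
    exact ⟨c, hc.trans (Algebra.smul_def _ _)⟩
  | zero => exact fun i => ⟨0, by simp⟩
  | add x y _ _ hx hy =>
    intro i
    obtain ⟨a, ha⟩ := hx i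
    obtain ⟨b, hb⟩ := hy i
    refine ⟨a + b, ?_⟩
    simp only [map_add, Finsupp.add_apply, mul_add, ha, hb]
  | smul a x _ hx =>
    intro i
    obtain ⟨c, hc⟩ := hx i
    refine ⟨a * c, ?_⟩
    have e : ((a • x : 𝓞 L) : L) = (a : k) • (x : L) := by
      rw [Algebra.smul_def, Algebra.smul_def]; exact coe_mul _ _
    simp only [map_mul, e, map_smul, Finsupp.smul_apply, smul_eq_mul, hc]
    ring

lemma FS_near_one_of_powerBasis (hs : SmallTrivial ζ σ) (hζ : IsPrimitiveRoot ζ 3) (h3 : ‖σ 3‖ < 1)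
    (hb : ∀ c : 𝓞 k, ‖σ c‖ ≤ 1) (pb : PowerBasis k L) (h0 : pb.gen ≠ 0) :
    ∃ N, ∀ α : 𝓞 L, 3 ^ N ∣ α - 1 → FS (algebraMap (𝓞 k) (𝓞 L) ζ) pb.gen α = 0 := by
  by_contra! H
  choose α hα hne using H
  choose x hx using hα
  obtain ⟨d, hd0, hd⟩ := exists_common_denom pb
  have hσd : σ (d : k) ≠ 0 := (map_ne_zero σ).mpr (by exact_mod_cast hd0)
  obtain ⟨h, hh⟩ : ∃ h : ℕ → k[X], h = fun n => 1 + C (3 ^ n) * ∑ i, C (pb.basis.repr (x n : L) i) * X ^ (i : ℕ) :=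
    ⟨_, rfl⟩
  have hev : ∀ n, aeval pb.gen (h n) = (α n : L) := by
    intro n
    have e : (α n : L) = 1 + 3 ^ n * x n := by
      have := congrArg (algebraMap (𝓞 L) L) (eq_add_of_sub_eq' (hx n))
      rwa [map_add, map_mul, map_pow, map_one, map_ofNat] at this
    have e2 : ∑ i, pb.basis.repr (x n : L) i • pb.gen ^ (i : ℕ) = x n := by
      conv_rhs => rw [← pb.basis.sum_repr (x n : L)]
      simp only [pb.basis_eq_pow]
    rw [hh]
    simp only [map_add, map_one, map_mul, aeval_C, map_pow, map_ofNat, map_sum, aeval_X, e, ← Algebra.smul_def, e2]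
  have hconv : Conv σ atTop h 1 := by
    refine ⟨⟨pb.dim, fun n => ?_⟩, fun j => ?_⟩
    · rw [hh]
      refine (natDegree_add_le _ _).trans (max_le (by simp) ?_)
      refine (natDegree_C_mul_le _ _).trans (natDegree_sum_le_of_forall_le _ _ fun i _ => ?_)
      exact (natDegree_C_mul_X_pow_le _ _).trans i.2.le
    · have ht : Tendsto (fun n => σ ((h n).coeff j) - σ ((1 : k[X]).coeff j)) atTop (𝓝 0) := by
        have hl : Tendsto (fun n : ℕ => ‖σ 3‖ ^ n * (pb.dim * ‖σ (d : k)‖⁻¹)) atTop (𝓝 0) := by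
          simpa using (tendsto_pow_atTop_nhds_zero_of_lt_one (norm_nonneg _) h3).mul_const (pb.dim * ‖σ (d : k)‖⁻¹)
        refine squeeze_zero_norm (fun n => ?_) hl
        rw [← map_sub, ← coeff_sub, hh]
        rw [add_sub_cancel_left, coeff_C_mul, finsetSum_coeff, map_mul, map_sum, map_pow, norm_mul, norm_pow]
        simp only [coeff_C_mul, coeff_X_pow, map_mul]
        gcongr
        refine (norm_sum_le _ _).trans ?_
        refine (Finset.sum_le_card_nsmul _ _ ‖σ (d : k)‖⁻¹ fun i _ => ?_).trans (by simp)
        obtain ⟨c, hc⟩ := hd (x n) i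
        have hr : pb.basis.repr (x n : L) i = (d : k)⁻¹ * c := by
          rw [hc, inv_mul_cancel_left₀ (by exact_mod_cast hd0)]
        split_ifs
        · rw [hr, map_mul, map_inv₀, map_one, mul_one, norm_mul, norm_inv]
          exact mul_le_of_le_one_right (by positivity) (hb c)
        · simp
      simpa using ht.add_const (σ ((1 : k[X]).coeff j))
  have hm := minpoly.monic pb.isIntegral_gen
  have hirr := minpoly.irreducible pb.isIntegral_gen
  have hp0 : (minpoly k pb.gen).coeff 0 ≠ 0 := minpoly.coeff_zero_ne_zero pb.isIntegral_gen h0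
  obtain ⟨n, h1, h2⟩ := ((locConst hs hζ _ _ _ _ _ hconv (Conv.const (minpoly k pb.gen)) (fun _ => hm) hm (fun _ => rfl)
    rfl hp0 isCoprime_one_left).and (hconv.eventually_isCoprime (Conv.const _) (fun _ => hm) hm (fun _ => rfl)
      isCoprime_one_left)).exists
  have h4 := aeval_gen_ne_zero pb h2
  rw [RS_irr _ hm hirr, Rirr_eq hζ pb h0 h4, ← C_1, RS_C hζ hm hp0 one_ne_zero, FS_one_right hζ hp0, hev] at h1
  exact hne n h1

lemma exists_powerBasis_of_adjoin {γ : L} (h : IntermediateField.adjoin k {γ} = ⊤) : ∃ pb : PowerBasis k L, pb.gen = γ := by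
  have : FiniteDimensional k L := Module.Finite.of_restrictScalars_finite ℚ k L
  have hi : IsIntegral k γ := Algebra.IsIntegral.isIntegral γ
  refine ⟨PowerBasis.ofAdjoinEqTop' hi ?_, PowerBasis.ofAdjoinEqTop'_gen hi _⟩
  rw [← IntermediateField.adjoin_simple_toSubalgebra_of_isAlgebraic hi.isAlgebraic, h]; rfl

theorem FS_near_one (hs : SmallTrivial ζ σ) (hζ : IsPrimitiveRoot ζ 3) (h3 : ‖σ 3‖ < 1)
    (hb : ∀ c : 𝓞 k, ‖σ c‖ ≤ 1) {γ : L} (h0 : γ ≠ 0) :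
    ∃ N, ∀ α : 𝓞 L, α ≠ 0 → 3 ^ N ∣ α - 1 → FS (algebraMap (𝓞 k) (𝓞 L) ζ) γ α = 0 := by
  have : FiniteDimensional k L := Module.Finite.of_restrictScalars_finite ℚ k L
  obtain ⟨θ, hθ⟩ := Field.exists_primitive_element k L
  have : Finite (IntermediateField k L) := Field.finite_intermediateField_of_exists_primitive_element k L ⟨θ, hθ⟩
  obtain ⟨m, n, hmn, e⟩ := Finite.exists_ne_map_eq_of_infinite
    (fun n : ℕ => IntermediateField.adjoin k {γ * (θ + n)})
  have hm1 : γ * (θ + m) ∈ IntermediateField.adjoin k {γ * (θ + m)} := IntermediateField.mem_adjoin_simple_self _ _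
  have hn1 : γ * (θ + n) ∈ IntermediateField.adjoin k {γ * (θ + m)} := e ▸ IntermediateField.mem_adjoin_simple_self _ _
  have hmn' : (m : L) - n ≠ 0 := sub_ne_zero.mpr (by exact_mod_cast hmn)
  have hγ : γ ∈ IntermediateField.adjoin k {γ * (θ + m)} := by
    have := div_mem (sub_mem hm1 hn1) (sub_mem (natCast_mem _ m) (natCast_mem _ n))
    rwa [show γ * (θ + m) - γ * (θ + n) = γ * (m - n) by ring, mul_div_cancel_right₀ _ hmn'] at this
  have hθ' : θ ∈ IntermediateField.adjoin k {γ * (θ + m)} := by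
    have := sub_mem (div_mem hm1 hγ) (natCast_mem _ m)
    rwa [mul_div_cancel_left₀ _ h0, add_sub_cancel_right] at this
  have htop : IntermediateField.adjoin k {γ * (θ + m)} = ⊤ := by
    rw [eq_top_iff, ← hθ, IntermediateField.adjoin_simple_le_iff]; exact hθ'
  obtain ⟨j, hj, hj0⟩ : ∃ j : ℕ, IntermediateField.adjoin k {γ * (θ + j)} = ⊤ ∧ θ + j ≠ 0 := by
    by_cases h : θ + m = 0
    · refine ⟨n, e ▸ htop, fun h' => hmn' ?_⟩
      rw [← sub_eq_zero.mpr (h.trans h'.symm)]; ring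
    · exact ⟨m, htop, h⟩
  have hj1 : IntermediateField.adjoin k {θ + (j : L)} = ⊤ := by
    rw [eq_top_iff, ← hθ, IntermediateField.adjoin_simple_le_iff]
    simpa using sub_mem (IntermediateField.mem_adjoin_simple_self k (θ + (j : L))) (natCast_mem _ j)
  obtain ⟨pb, e1⟩ := exists_powerBasis_of_adjoin hj
  obtain ⟨pb', e2⟩ := exists_powerBasis_of_adjoin hj1
  obtain ⟨N, hN⟩ := FS_near_one_of_powerBasis hs hζ h3 hb pb (e1 ▸ mul_ne_zero h0 hj0)
  obtain ⟨N', hN'⟩ := FS_near_one_of_powerBasis hs hζ h3 hb pb' (e2 ▸ hj0)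
  refine ⟨max N N', fun α hα0 hα => ?_⟩
  have h1 := hN α ((pow_dvd_pow _ (le_max_left _ _)).trans hα)
  have h2 := hN' α ((pow_dvd_pow _ (le_max_right _ _)).trans hα)
  rw [e1, FS_mul_left (prim_map hζ) h0 hj0 (by exact_mod_cast hα0), ← e2, h2, add_zero] at h1
  exact h1
end NearOne

end CubicRec

namespace CubicRec
set_option linter.unusedSectionVars false
open IsDedekindDomain Polynomial UniqueFactorizationMonoid

section CubicChar
variable {F : Type*} [Field F] [Fintype F] {z : F} {R S : Type*} [CommRing R] [CommRing S]

/-- The cubic character of a finite field, with values in the powers of `w`. -/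
noncomputable def cubicChar {z : F} (hz : IsPrimitiveRoot z 3) {w : R} (hw : w ^ 3 = 1) : MulChar F R where
  toFun a := open Classical in if a = 0 then 0 else w ^ (fcub z a).val
  map_one' := by simp [fcub_one hz]
  map_mul' a b := by
    by_cases ha : a = 0
    · simp [ha]
    by_cases hb : b = 0
    · simp [hb]
    simp only [mul_eq_zero, ha, hb, or_self, if_false, fcub_mul hz ha hb, pow_val_add hw]
  map_nonunit' a ha := by
    rw [isUnit_iff_ne_zero, not_not] at ha
    simp [ha]

variable (hz : IsPrimitiveRoot z 3) {w : R} (hw : w ^ 3 = 1)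

lemma cubicChar_apply {a : F} (ha : a ≠ 0) : cubicChar hz hw a = w ^ (fcub z a).val := by
  change (open Classical in if a = 0 then 0 else w ^ (fcub z a).val) = _
  rw [if_neg ha]

lemma cubicChar_pow_three : cubicChar hz hw ^ 3 = 1 := by
  ext a
  rw [MulChar.pow_apply_coe, cubicChar_apply hz hw a.ne_zero, ← pow_mul, mul_comm, pow_mul, hw, one_pow,
    MulChar.one_apply_coe]

lemma cubicChar_inv : (cubicChar hz hw)⁻¹ = cubicChar hz hw ^ 2 := by
  rw [inv_eq_iff_mul_eq_one, ← pow_succ', cubicChar_pow_three]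

lemma cubicChar_ringHomComp (f : R →+* S) :
    (cubicChar hz hw).ringHomComp f = cubicChar hz (w := f w) (by rw [← map_pow, hw, map_one]) := by
  ext a
  rw [MulChar.ringHomComp_apply, cubicChar_apply hz hw a.ne_zero, cubicChar_apply hz _ a.ne_zero, map_pow]

lemma cubicChar_sq (h : (w ^ 2) ^ 3 = 1) : cubicChar hz (w := w ^ 2) h = (cubicChar hz hw)⁻¹ := by
  rw [cubicChar_inv]
  ext a
  rw [MulChar.pow_apply_coe, cubicChar_apply hz hw a.ne_zero, cubicChar_apply hz _ a.ne_zero, ← pow_mul, ← pow_mul,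
    mul_comm]

lemma exists_fcub_ne_zero (hz : IsPrimitiveRoot z 3) : ∃ a : F, a ≠ 0 ∧ fcub z a ≠ 0 := by
  obtain ⟨g, hg⟩ := IsCyclic.exists_generator (α := Fˣ)
  refine ⟨g, g.ne_zero, fun h => ?_⟩
  have h1 := fcub_spec hz g.ne_zero
  rw [h, ZMod.val_zero, pow_zero, ← Units.val_pow_eq_pow_val, Units.val_eq_one] at h1
  have h2 := orderOf_dvd_of_pow_eq_one h1
  rw [orderOf_eq_card_of_forall_mem_zpowers hg, Nat.card_units] at h2
  have h3 : 1 < Nat.card F := Finite.one_lt_card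
  obtain ⟨m, hm⟩ := three_dvd_card_sub_one hz
  rw [hm, Nat.mul_div_cancel_left _ (by norm_num)] at h2
  have := Nat.le_of_dvd (by omega) h2
  omega

lemma cubicChar_ne_one (hw' : IsPrimitiveRoot w 3) : cubicChar hz hw ≠ 1 := by
  obtain ⟨a, ha, h⟩ := exists_fcub_ne_zero hz
  intro e
  have := cubicChar_apply hz hw ha
  rw [e, MulChar.one_apply ha.isUnit] at this
  have h3 := hw'.dvd_of_pow_eq_one _ this.symm
  have h4 := ZMod.val_lt (fcub z a)
  exact h ((ZMod.val_eq_zero _).mp (Nat.eq_zero_of_dvd_of_lt h3 h4))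

lemma orderOf_cubicChar (hw' : IsPrimitiveRoot w 3) : orderOf (cubicChar hz hw) = 3 :=
  have := Fact.mk Nat.prime_three
  orderOf_eq_prime (cubicChar_pow_three hz hw) (cubicChar_ne_one hz hw hw')

lemma cubicChar_neg_one : cubicChar hz hw (-1) = 1 := by
  rw [cubicChar_apply hz hw (neg_ne_zero.mpr one_ne_zero), fcub_neg_one hz]; simp

lemma gaussSum_cube [IsDomain R] (hw' : IsPrimitiveRoot w 3) {ψ : AddChar F R} (hψ : ψ.IsPrimitive) :
    gaussSum (cubicChar hz hw) ψ ^ 3 = Fintype.card F * jacobiSum (cubicChar hz hw) (cubicChar hz hw) := by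
  have := gaussSum_pow_eq_prod_jacobiSum (χ := cubicChar hz hw) (by rw [orderOf_cubicChar hz hw hw']; norm_num) hψ
  rw [orderOf_cubicChar hz hw hw', cubicChar_neg_one] at this
  simpa using this

lemma gaussSum_pow_char_pow (χ : MulChar F R) (ψ : AddChar F R) (p : ℕ) [Fact p.Prime] [CharP R p] (n : ℕ) :
    gaussSum χ ψ ^ p ^ n = gaussSum (χ ^ p ^ n) (ψ ^ p ^ n) := by
  induction n with
  | zero => simp
  | succ n ih => rw [pow_succ, pow_mul, ih, gaussSum_frob, pow_mul, pow_mul]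

/-- The Gauss sum identity behind cubic reciprocity. -/
theorem fcub_card_mul_jacobiSum {E : Type*} [Field E] [Finite E] (f : R →+* E)
    (hf : IsPrimitiveRoot (f w) 3) (hchar : (Nat.card E : F) ≠ 0) (hchar' : (Nat.card F : E) ≠ 0) :
    fcub (f w) (Nat.card F * f (jacobiSum (cubicChar hz hw) (cubicChar hz hw))) = - fcub z (Nat.card E : F) := by
  have := Fintype.ofFinite E
  have hne : ringChar E ≠ ringChar F := by
    intro h
    apply hchar
    obtain ⟨n, hp, hc⟩ := FiniteField.card E (ringChar E)
    rw [Nat.card_eq_fintype_card, hc, Nat.cast_pow, h, ringChar.Nat.cast_ringChar, zero_pow n.ne_zero]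
  let ψ := AddChar.FiniteField.primitiveChar F E hne
  let C := CyclotomicField ψ.n E
  let i : R →+* C := (algebraMap E C).comp f
  have hw2 : (i w) ^ 3 = 1 := by rw [← map_pow, hw, map_one]
  have hi : IsPrimitiveRoot (i w) 3 := hf.map_of_injective (algebraMap E C).injective
  obtain ⟨n, hp, hc⟩ := FiniteField.card E (ringChar E)
  have := Fact.mk hp
  have : CharP C (ringChar E) := charP_of_injective_algebraMap (algebraMap E C).injective _
  have hcE : Nat.card E = ringChar E ^ (n : ℕ) := by rw [Nat.card_eq_fintype_card, hc]
  obtain ⟨m, hm⟩ := three_dvd_card_sub_one hf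
  have hm' : Nat.card E = 3 * m + 1 := by have : 1 < Nat.card E := Finite.one_lt_card; omega
  have g1 := gaussSum_pow_char_pow (cubicChar hz hw2) ψ.char (ringChar E) n
  have g2 := gaussSum_mulShift (cubicChar hz hw2) ψ.char (Units.mk0 _ hchar)
  rw [← hcE] at g1
  have hχ : cubicChar hz hw2 ^ Nat.card E = cubicChar hz hw2 := by
    rw [hm', pow_succ, pow_mul, cubicChar_pow_three, one_pow, one_mul]
  rw [hχ, AddChar.pow_mulShift] at g1
  rw [Units.val_mk0, ← g1, hm', pow_succ, pow_mul, gaussSum_cube hz hw2 hi ψ.prim, ← mul_assoc] at g2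
  have hg0 : gaussSum (cubicChar hz hw2) ψ.char ≠ 0 := by
    refine gaussSum_ne_zero_of_nontrivial ?_ (cubicChar_ne_one hz hw2 hi) ψ.prim
    intro h
    apply hchar'
    apply (algebraMap E C).injective
    rw [Nat.card_eq_fintype_card, map_natCast, map_zero]; exact h
  have g3 := (mul_eq_right₀ hg0).mp g2
  rw [← hm', cubicChar_apply hz hw2 hchar] at g3
  have e1 : jacobiSum (cubicChar hz hw2) (cubicChar hz hw2) = i (jacobiSum (cubicChar hz hw) (cubicChar hz hw)) := by
    rw [← jacobiSum_ringHomComp, cubicChar_ringHomComp]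
  rw [e1] at g3
  have g4 : (f w) ^ (fcub z (Nat.card E : F)).val *
      (Nat.card F * f (jacobiSum (cubicChar hz hw) (cubicChar hz hw))) ^ m = 1 := by
    apply (algebraMap E C).injective
    rw [map_mul, map_pow, map_pow, map_mul, map_natCast, map_one, Nat.card_eq_fintype_card (α := F)]
    exact g3
  have hne0 : (Nat.card F : E) * f (jacobiSum (cubicChar hz hw) (cubicChar hz hw)) ≠ 0 := by
    intro h
    have hm0 : m ≠ 0 := by rintro rfl; have : 1 < Nat.card E := Finite.one_lt_card; omega
    rw [h, zero_pow hm0, mul_zero] at g4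
    exact zero_ne_one g4
  refine fcub_eq hf hne0 ?_
  rw [hm, Nat.mul_div_cancel_left _ (by norm_num)]
  have h5 : (f w) ^ (fcub z (Nat.card E : F)).val * (f w) ^ (-fcub z (Nat.card E : F)).val = 1 := by
    rw [← pow_val_add hf.pow_eq_one]; simp
  exact mul_left_cancel₀ (pow_ne_zero _ (hf.ne_zero (by norm_num))) (g4.trans h5.symm)

/-- The cubic Jacobi sum vanishes under reduction modulo the prime defining the character. -/
lemma map_jacobiSum_eq_zero (f : R →+* F) (hf : f w = z) :
    f (jacobiSum (cubicChar hz hw) (cubicChar hz hw)) = 0 := by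
  obtain ⟨m, hm⟩ := three_dvd_card_sub_one hz
  have hc : 1 < Nat.card F := Finite.one_lt_card
  have hm0 : m ≠ 0 := by omega
  have key : ∀ a : F, f (cubicChar hz hw a) = a ^ m := by
    intro a
    by_cases ha : a = 0
    · rw [ha, zero_pow hm0, MulChar.map_nonunit _ not_isUnit_zero, map_zero]
    rw [cubicChar_apply hz hw ha, map_pow, hf, ← fcub_spec hz ha, hm, Nat.mul_div_cancel_left _ (by norm_num)]
  rw [jacobiSum, map_sum]
  simp only [map_mul, key]
  have e : ∀ x : F, x ^ m * (1 - x) ^ m = ∑ i ∈ Finset.range (m + 1), (-1) ^ i * (m.choose i : F) * x ^ (m + i) := by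
    intro x
    rw [sub_eq_neg_add, add_pow, Finset.mul_sum]
    refine Finset.sum_congr rfl fun i _ => ?_
    rw [neg_pow, pow_add]; ring
  simp only [e]
  rw [Finset.sum_comm]
  refine Finset.sum_eq_zero fun i hi => ?_
  rw [← Finset.mul_sum, FiniteField.sum_pow_lt_card_sub_one F, mul_zero]
  rw [← Nat.card_eq_fintype_card]
  have := Finset.mem_range.mp hi
  omega
end CubicChar
section Eisenstein
variable {k : Type*} [Field k] [NumberField k] [IsCyclotomicExtension {3} ℚ k] {ζ : 𝓞 k}

lemma coe_prim (hζ : IsPrimitiveRoot ζ 3) : IsPrimitiveRoot (ζ : k) 3 :=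
  hζ.map_of_injective RingOfIntegers.coe_injective

lemma toInteger_coe (hζ : IsPrimitiveRoot ζ 3) : (coe_prim hζ).toInteger = ζ := by
  apply RingOfIntegers.ext; rfl

lemma lam_prime (hζ : IsPrimitiveRoot ζ 3) : Prime (ζ - 1) := by
  have := Fact.mk Nat.prime_three
  have := (coe_prim hζ).zeta_sub_one_prime'
  rwa [toInteger_coe hζ] at this

lemma lam_sq (hζ : IsPrimitiveRoot ζ 3) : (ζ - 1) ^ 2 = -3 * ζ := by
  linear_combination sq_add_self_add_one hζ

lemma exists_repr (hζ : IsPrimitiveRoot ζ 3) (x : 𝓞 k) : ∃ a b : ℤ, x = a + b * ζ := by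
  have h := sq_add_self_add_one hζ
  have hx : x ∈ Algebra.adjoin ℤ {ζ} := by
    have := (coe_prim hζ).integralPowerBasis.adjoin_gen_eq_top
    rw [IsPrimitiveRoot.integralPowerBasis_gen, toInteger_coe hζ] at this
    rw [this]; trivial
  induction hx using Algebra.adjoin_induction with
  | mem x hx => rw [Set.mem_singleton_iff.mp hx]; exact ⟨0, 1, by simp⟩
  | algebraMap r => exact ⟨r, 0, by simp⟩
  | add x y _ _ hx hy =>
    obtain ⟨a, b, rfl⟩ := hx
    obtain ⟨c, d, rfl⟩ := hy
    exact ⟨a + c, b + d, by push_cast; ring⟩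
  | mul x y _ _ hx hy =>
    obtain ⟨a, b, rfl⟩ := hx
    obtain ⟨c, d, rfl⟩ := hy
    exact ⟨a * c - b * d, a * d + b * c - b * d, by push_cast; linear_combination (b * d : 𝓞 k) * h⟩

/-- An algebraic integer is primary if it is `±1` modulo `3`. -/
def Prim (x : 𝓞 k) : Prop := 3 ∣ x - 1 ∨ 3 ∣ x + 1

lemma Prim.mul {x y : 𝓞 k} (hx : Prim x) (hy : Prim y) : Prim (x * y) := by
  rcases hx with ⟨a, hx⟩ | ⟨a, hx⟩ <;> rcases hy with ⟨b, hy⟩ | ⟨b, hy⟩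
  · exact .inl ⟨a * y + b, by linear_combination y * hx + hy⟩
  · exact .inr ⟨a * y + b, by linear_combination y * hx + hy⟩
  · exact .inr ⟨a * y - b, by linear_combination y * hx - hy⟩
  · exact .inl ⟨a * y - b, by linear_combination y * hx - hy⟩

lemma three_dvd_iff (hζ : IsPrimitiveRoot ζ 3) (x : 𝓞 k) : 3 ∣ x ↔ (ζ - 1) ^ 2 ∣ x := by
  rw [lam_sq hζ]
  have hu : ζ * ζ ^ 2 = 1 := by rw [← pow_succ', hζ.pow_eq_one]
  constructor
  · rintro ⟨y, rfl⟩; exact ⟨- ζ ^ 2 * y, by linear_combination (-3 * y) * hu⟩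
  · rintro ⟨y, rfl⟩; exact ⟨- ζ * y, by ring⟩

lemma Prim.not_dvd (hζ : IsPrimitiveRoot ζ 3) {x : 𝓞 k} (hx : Prim x) : ¬ (ζ - 1 ∣ x) := by
  intro h
  apply (lam_prime hζ).not_isUnit
  rw [isUnit_iff_dvd_one]
  rcases hx with hx | hx
  · have := dvd_sub h ((dvd_pow_self _ two_ne_zero).trans ((three_dvd_iff hζ _).mp hx))
    simpa using this
  · have := dvd_sub ((dvd_pow_self _ two_ne_zero).trans ((three_dvd_iff hζ _).mp hx)) h
    simpa using this

/-- Modulo `3`, an integer prime to `ζ - 1` is `±1`, `±ζ` or `±ζ²`. -/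
lemma exists_prim_mul (hζ : IsPrimitiveRoot ζ 3) {x : 𝓞 k} (hx : ¬ (ζ - 1 ∣ x)) :
    Prim x ∨ Prim (ζ * x) ∨ Prim (ζ ^ 2 * x) := by
  have h := sq_add_self_add_one hζ
  have h3 := hζ.pow_eq_one
  have key : ∀ y : 𝓞 k, ζ - 1 ∣ y - 1 → 3 ∣ y - 1 ∨ 3 ∣ ζ * y - 1 ∨ 3 ∣ ζ ^ 2 * y - 1 := by
    rintro y ⟨t, ht⟩
    simp only [three_dvd_iff hζ]
    have h0 : ζ - 1 ∣ t ∨ ζ - 1 ∣ t - 1 ∨ ζ - 1 ∣ t + 1 := by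
      have := IsCyclotomicExtension.Rat.Three.lambda_dvd_or_dvd_sub_one_or_dvd_add_one (coe_prim hζ) t
      rwa [toInteger_coe hζ] at this
    obtain ⟨s, hs⟩ | ⟨s, hs⟩ | ⟨s, hs⟩ := h0
    · exact .inl ⟨s, by linear_combination ht + (ζ - 1) * hs⟩
    · exact .inr (.inr ⟨ζ ^ 2 * s, by linear_combination ζ ^ 2 * ht + (ζ - 1) * ζ ^ 2 * hs + h3⟩)
    · exact .inr (.inl ⟨ζ * s - 1, by linear_combination ζ * ht + (ζ - 1) * ζ * hs⟩)
  have h0 : ζ - 1 ∣ x ∨ ζ - 1 ∣ x - 1 ∨ ζ - 1 ∣ x + 1 := by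
    have := IsCyclotomicExtension.Rat.Three.lambda_dvd_or_dvd_sub_one_or_dvd_add_one (coe_prim hζ) x
    rwa [toInteger_coe hζ] at this
  obtain h1 | h1 | h1 := h0
  · exact absurd h1 hx
  · exact (key x h1).imp .inl (.imp .inl .inl)
  · have := key (-x) (by rw [← dvd_neg]; convert h1 using 1; ring)
    refine this.imp ?_ (.imp ?_ ?_) <;>
    · intro h; right; rw [← dvd_neg]; convert h using 1; ring

lemma prim_unit (hζ : IsPrimitiveRoot ζ 3) {u : 𝓞 k} (hu : IsUnit u) (h : Prim u) : u = 1 ∨ u = -1 := by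
  obtain ⟨u, rfl⟩ := hu
  have := IsCyclotomicExtension.Rat.Three.eq_one_or_neg_one_of_unit_of_congruent (coe_prim hζ) u (by
    rw [toInteger_coe hζ]
    simp only [← three_dvd_iff hζ]
    rcases h with h | h
    · exact ⟨1, by simpa using h⟩
    · exact ⟨-1, by simpa using h⟩)
  exact this.imp (by rintro rfl; rfl) (by rintro rfl; rfl)

lemma exists_conj (hζ : IsPrimitiveRoot ζ 3) : ∃ c : k ≃+* k, RingOfIntegers.mapRingEquiv c ζ = ζ ^ 2 := by
  have h0 := IsCyclotomicExtension.zeta_spec 3 ℚ k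
  have hp := h0.pow_of_coprime 2 (by norm_num)
  have hir : Irreducible (cyclotomic 3 ℚ) := cyclotomic.irreducible_rat (by norm_num)
  let c := IsCyclotomicExtension.fromZetaAut hp hir
  have hc : c (IsCyclotomicExtension.zeta 3 ℚ k) = IsCyclotomicExtension.zeta 3 ℚ k ^ 2 :=
    IsCyclotomicExtension.fromZetaAut_spec hp hir
  refine ⟨c.toRingEquiv, RingOfIntegers.ext ?_⟩
  change c (ζ : k) = (ζ : k) ^ 2
  obtain ⟨i, hi, h⟩ := h0.eq_pow_of_pow_eq_one (coe_prim hζ).pow_eq_one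
  rw [← h, map_pow, hc, ← pow_mul, ← pow_mul, mul_comm]

variable (c : k ≃+* k)

lemma coe_norm_int (hζ : IsPrimitiveRoot ζ 3) (hc : RingOfIntegers.mapRingEquiv c ζ = ζ ^ 2) (x : 𝓞 k) :
    ((Algebra.norm ℤ x : ℤ) : 𝓞 k) = x * RingOfIntegers.mapRingEquiv c x := by
  apply RingOfIntegers.ext
  have := IsCyclotomicExtension.isGalois {3} ℚ k
  let c' : Gal(k/ℚ) := AlgEquiv.ofRingEquiv (f := c) (fun r => by simp)
  have hne : c' ≠ 1 := by
    intro h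
    have h1 : c' (ζ : k) = (ζ : k) := by rw [h]; rfl
    have h2 : c' (ζ : k) = (ζ : k) ^ 2 := congrArg (fun y : 𝓞 k => (y : k)) hc
    have h3 : (ζ : k) ≠ 1 := (coe_prim hζ).ne_one (by norm_num)
    have h4 : (ζ : k) ≠ 0 := (coe_prim hζ).ne_zero (by norm_num)
    rw [h1, sq, left_eq_mul₀ h4] at h2
    exact h3 h2
  classical
  have hu : (Finset.univ : Finset Gal(k/ℚ)) = {1, c'} := by
    symm
    refine Finset.eq_of_subset_of_card_le (Finset.subset_univ _) ?_
    rw [Finset.card_univ, ← Nat.card_eq_fintype_card, IsGalois.card_aut_eq_finrank,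
      IsCyclotomicExtension.finrank (n := 3) k (cyclotomic.irreducible_rat (by norm_num)), Finset.card_pair hne.symm]
    decide
  have h1 : ((Algebra.norm ℤ x : ℤ) : k) = algebraMap ℚ k (Algebra.norm ℚ (x : k)) := by
    rw [← Algebra.coe_norm_int]; simp
  have h2 := Algebra.norm_eq_prod_automorphisms ℚ (x : k)
  rw [hu, Finset.prod_pair hne.symm] at h2
  rw [h2] at h1
  exact (map_intCast (algebraMap (𝓞 k) k) _).trans (h1.trans rfl)

lemma card_quotient (hζ : IsPrimitiveRoot ζ 3) (hc : RingOfIntegers.mapRingEquiv c ζ = ζ ^ 2) (x : 𝓞 k) :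
    (Nat.card (𝓞 k ⧸ Ideal.span {x}) : 𝓞 k) = x * RingOfIntegers.mapRingEquiv c x ∨
    (Nat.card (𝓞 k ⧸ Ideal.span {x}) : 𝓞 k) = - (x * RingOfIntegers.mapRingEquiv c x) := by
  have h : Nat.card (𝓞 k ⧸ Ideal.span {x}) = (Algebra.norm ℤ x).natAbs := by
    rw [← Ideal.absNorm_span_singleton]; rfl
  rw [h, ← coe_norm_int c hζ hc x]
  rcases Int.natAbs_eq (Algebra.norm ℤ x) with h | h
  · left; conv_rhs => rw [h]
    simp
  · right; conv_rhs => rw [h]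
    simp

lemma conj_conj (hζ : IsPrimitiveRoot ζ 3) (hc : RingOfIntegers.mapRingEquiv c ζ = ζ ^ 2) (x : 𝓞 k) :
    RingOfIntegers.mapRingEquiv c (RingOfIntegers.mapRingEquiv c x) = x := by
  obtain ⟨a, b, rfl⟩ := exists_repr hζ x
  simp only [map_add, map_mul, map_intCast, hc, map_pow]
  linear_combination (b * ζ : 𝓞 k) * hζ.pow_eq_one

lemma Prim.conj {x : 𝓞 k} (hx : Prim x) : Prim (RingOfIntegers.mapRingEquiv c x) := by
  rcases hx with ⟨a, hx⟩ | ⟨a, hx⟩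
  · exact .inl ⟨RingOfIntegers.mapRingEquiv c a, by
      simpa [map_ofNat (RingOfIntegers.mapRingEquiv c) 3] using congrArg (RingOfIntegers.mapRingEquiv c) hx⟩
  · exact .inr ⟨RingOfIntegers.mapRingEquiv c a, by
      simpa [map_ofNat (RingOfIntegers.mapRingEquiv c) 3] using congrArg (RingOfIntegers.mapRingEquiv c) hx⟩

end Eisenstein
section PrimePlace
variable {K : Type*} [Field K] [NumberField K] {ζ : 𝓞 K} {p q : 𝓞 K}

/-- The place of a prime element. -/
def place (hp : Prime p) : HeightOneSpectrum (𝓞 K) where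
  asIdeal := Ideal.span {p}
  isPrime := (Ideal.span_singleton_prime hp.ne_zero).mpr hp
  ne_bot := by rw [Ne, Ideal.span_singleton_eq_bot]; exact hp.ne_zero

lemma mem_place (hp : Prime p) {a : 𝓞 K} : a ∈ (place hp).asIdeal ↔ p ∣ a := Ideal.mem_span_singleton

lemma mem_asIdeal_iff (hp : Prime p) {v : HeightOneSpectrum (𝓞 K)} : p ∈ v.asIdeal ↔ v = place hp := by
  constructor
  · intro h
    have hm : (place hp).asIdeal.IsMaximal := inferInstance
    exact HeightOneSpectrum.ext (hm.eq_of_le v.isPrime.ne_top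
      ((Ideal.span_singleton_le_iff_mem _).mpr h)).symm
  · rintro rfl; exact (mem_place hp).mpr dvd_rfl

lemma SS_prime (hp : Prime p) (h3 : ¬ p ∣ 3) (a : 𝓞 K) : SS ζ a p = rcub ζ (place hp) a := by
  rw [SS, finsum_eq_single _ (place hp), if_neg (mt (mem_place hp).mp h3), ord_unif', Int.cast_one, mul_one]
  · exact (mem_place hp).mpr dvd_rfl
  · change p ∉ Ideal.span {p} ^ 2
    rw [Ideal.span_singleton_pow, Ideal.mem_span_singleton]
    rintro ⟨c, hc⟩
    refine hp.not_isUnit (.of_mul_eq_one c (mul_left_cancel₀ hp.ne_zero ?_))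
    linear_combination -hc
  · intro v hv
    rw [ord_of_notMem (mt (mem_asIdeal_iff hp).mp hv)]
    simp

lemma coprime_of_not_dvd (hp : Prime p) (h : ¬ p ∣ q) : IsCoprime p q := by
  refine coprime_of_forall hp.ne_zero fun v hv => ?_
  rw [mem_asIdeal_iff hp] at hv
  rw [hv, mem_place]; exact h

lemma prime_map {L : Type*} [Field L] [NumberField L] (e : K ≃+* L) (hp : Prime p) :
    Prime (RingOfIntegers.mapRingEquiv e p) := (MulEquiv.prime_iff (RingOfIntegers.mapRingEquiv e)).mpr hp

lemma rcub_conj (c : K ≃+* K) (hζ : IsPrimitiveRoot ζ 3) (hc : RingOfIntegers.mapRingEquiv c ζ = ζ ^ 2)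
    (hp : Prime p) (h3 : ¬ p ∣ 3) (a : 𝓞 K) :
    SS ζ (RingOfIntegers.mapRingEquiv c a) (RingOfIntegers.mapRingEquiv c p) = - SS ζ a p := by
  have hq := prime_map c hp
  have hq3 : ¬ RingOfIntegers.mapRingEquiv c p ∣ 3 := by
    rintro ⟨x, hx⟩
    apply h3
    refine ⟨(RingOfIntegers.mapRingEquiv c).symm x, (RingOfIntegers.mapRingEquiv c).injective ?_⟩
    rw [map_ofNat, map_mul, RingEquiv.apply_symm_apply, hx]
  have hpl : placeComap c (place hq) = place hp := by
    rw [← mem_asIdeal_iff hp, mem_placeComap, mem_place]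
  rw [SS_prime hp h3, SS_prime hq hq3]
  have hg : Good ζ (place hp) := ⟨hζ, mt (mem_place hp).mp h3⟩
  have hg' : Good ζ (place hq) := ⟨hζ, mt (mem_place hq).mp hq3⟩
  have := rcub_placeComap (e := c) (w := place hq) (ζ := ζ) (by rwa [hpl]) a
  rw [hpl, hc, rcub_sq hg'] at this
  rw [← this, neg_neg]
end PrimePlace

section Eisenstein
variable {k : Type*} [Field k] [NumberField k] [IsCyclotomicExtension {3} ℚ k] {ζ : 𝓞 k}

lemma Prim.not_dvd_three (hζ : IsPrimitiveRoot ζ 3) {p : 𝓞 k} (hp : Prime p) (h : Prim p) : ¬ p ∣ 3 := by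
  intro h3
  have h4 : p ∣ (ζ - 1) ^ 2 := by rw [lam_sq hζ, neg_mul, dvd_neg]; exact h3.mul_right _
  exact h.not_dvd hζ ((hp.dvd_prime_iff_associated (lam_prime hζ)).mp (hp.dvd_of_dvd_pow h4)).symm.dvd

lemma Prim.of_mul {x t : 𝓞 k} (h : Prim x) (h2 : Prim (x * t)) : Prim t := by
  rcases h with ⟨x, h⟩ | ⟨x, h⟩ <;> rcases h2 with ⟨y, h2⟩ | ⟨y, h2⟩
  · exact .inl ⟨y - x * t, by linear_combination h2 - t * h⟩
  · exact .inr ⟨y - x * t, by linear_combination h2 - t * h⟩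
  · exact .inr ⟨x * t - y, by linear_combination t * h - h2⟩
  · exact .inl ⟨x * t - y, by linear_combination t * h - h2⟩

variable (c : k ≃+* k)

lemma jacobiSum_eq (hζ : IsPrimitiveRoot ζ 3) (hc : RingOfIntegers.mapRingEquiv c ζ = ζ ^ 2)
    {p : 𝓞 k} (hp : Prime p) (h : Prim p) [Fintype (𝓞 k ⧸ (place hp).asIdeal)]
    (hz : IsPrimitiveRoot (Ideal.Quotient.mk (place hp).asIdeal ζ) 3) :
    jacobiSum (cubicChar hz hζ.pow_eq_one) (cubicChar hz hζ.pow_eq_one) = p ∨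
    jacobiSum (cubicChar hz hζ.pow_eq_one) (cubicChar hz hζ.pow_eq_one) = -p := by
  let J := jacobiSum (cubicChar hz hζ.pow_eq_one) (cubicChar hz hζ.pow_eq_one)
  have h1 : p ∣ J := by
    rw [← mem_place hp, ← Ideal.Quotient.eq_zero_iff_mem]
    exact map_jacobiSum_eq_zero hz hζ.pow_eq_one (Ideal.Quotient.mk _) rfl
  have h2 : Prim J := by
    obtain ⟨z, -, hz⟩ := exists_jacobiSum_eq_neg_one_add (by norm_num) (cubicChar_pow_three hz hζ.pow_eq_one)
      (cubicChar_pow_three hz hζ.pow_eq_one) (by rw [← Nat.card_eq_fintype_card]; exact three_dvd_card_sub_one hz) hζ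
    refine .inr ((three_dvd_iff hζ _).mpr ⟨z, ?_⟩)
    change jacobiSum _ _ + 1 = _
    rw [hz]; ring
  have h3 : J * RingOfIntegers.mapRingEquiv c J = Nat.card (𝓞 k ⧸ (place hp).asIdeal) := by
    apply RingOfIntegers.ext
    let i := algebraMap (𝓞 k) k
    have hiζ : IsPrimitiveRoot (i ζ) 3 := coe_prim hζ
    have e1 : i J = jacobiSum (cubicChar hz hiζ.pow_eq_one) (cubicChar hz hiζ.pow_eq_one) := by
      change i (jacobiSum _ _) = _
      rw [← jacobiSum_ringHomComp, cubicChar_ringHomComp]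
    have e2 : i (RingOfIntegers.mapRingEquiv c J) =
        jacobiSum (cubicChar hz hiζ.pow_eq_one)⁻¹ (cubicChar hz hiζ.pow_eq_one)⁻¹ := by
      change (i.comp (RingOfIntegers.mapRingEquiv c).toRingHom) (jacobiSum _ _) = _
      rw [← jacobiSum_ringHomComp, cubicChar_ringHomComp]
      have : (i.comp (RingOfIntegers.mapRingEquiv c).toRingHom) ζ = i ζ ^ 2 := by
        change i (RingOfIntegers.mapRingEquiv c ζ) = _
        rw [hc, map_pow]
      have e3 : ∀ w : k, w = i ζ ^ 2 → ∀ hw : w ^ 3 = 1, cubicChar hz hw = (cubicChar hz hiζ.pow_eq_one)⁻¹ := by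
        rintro _ rfl hw; exact cubicChar_sq hz hiζ.pow_eq_one hw
      rw [e3 _ this]
    have hne := cubicChar_ne_one hz hiζ.pow_eq_one hiζ
    have := jacobiSum_mul_jacobiSum_inv (F := 𝓞 k ⧸ (place hp).asIdeal) (F' := k) (by
      rw [ringChar.eq_zero]
      intro h
      have := CharP.ringChar_ne_zero_of_finite (𝓞 k ⧸ (place hp).asIdeal)
      exact this h.symm) hne hne (by
      rw [← sq, ← cubicChar_inv, Ne, inv_eq_one]; exact hne)
    rw [← e1, ← e2, ← Nat.card_eq_fintype_card] at this
    change i _ = i _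
    rw [map_mul, this, map_natCast]
  obtain ⟨t, ht⟩ := h1
  have h4 : IsUnit t := by
    have hc0 := (prime_map c hp).ne_zero
    rw [ht, map_mul] at h3
    change _ = ((Nat.card (𝓞 k ⧸ Ideal.span {p}) : ℕ) : 𝓞 k) at h3
    have h0 : p * RingOfIntegers.mapRingEquiv c p ≠ 0 := mul_ne_zero hp.ne_zero hc0
    rcases card_quotient c hζ hc p with h | h <;> rw [h] at h3
    · exact .of_mul_eq_one (RingOfIntegers.mapRingEquiv c t) (mul_left_cancel₀ h0 (by linear_combination h3))
    · exact .of_mul_eq_one (-RingOfIntegers.mapRingEquiv c t) (mul_left_cancel₀ h0 (by linear_combination -h3))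
  have h5 : Prim t := by
    change J = _ at ht
    rw [ht] at h2
    exact h.of_mul h2
  change J = _ ∨ J = _
  rcases prim_unit hζ h4 h5 with rfl | rfl
  · left; rw [ht, mul_one]
  · right; rw [ht, mul_neg_one]

lemma FS_conj_left (hζ : IsPrimitiveRoot ζ 3) (hc : RingOfIntegers.mapRingEquiv c ζ = ζ ^ 2)
    {p l : 𝓞 k} (hp : Prime p) (h : Prim p) (hl : Prime l) (h' : Prim l) (h1 : ¬ l ∣ p)
    (h2 : ¬ l ∣ RingOfIntegers.mapRingEquiv c p) :
    FS ζ (RingOfIntegers.mapRingEquiv c p : k) (l : k) = FS ζ (p : k) l := by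
  have h3 := h.not_dvd_three hζ hp
  have h3' := h'.not_dvd_three hζ hl
  have hcp := prime_map c hp
  have hcl := prime_map c hl
  have hgp : Good ζ (place hp) := ⟨hζ, mt (mem_place hp).mp h3⟩
  have hgl : Good ζ (place hl) := ⟨hζ, mt (mem_place hl).mp h3'⟩
  have i1 := (coprime_of_not_dvd hl h1).symm
  have i2 := (coprime_of_not_dvd hl h2).symm
  have h4 : ¬ p ∣ RingOfIntegers.mapRingEquiv c l := by
    rintro ⟨x, hx⟩
    have : l ∣ RingOfIntegers.mapRingEquiv c p := by
      have := ((MulEquiv.prime_iff (RingOfIntegers.mapRingEquiv c)).mpr hl)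
      refine (hcp.dvd_prime_iff_associated hl).mp ⟨RingOfIntegers.mapRingEquiv c x, ?_⟩ |>.symm.dvd
      rw [← map_mul, ← hx, conj_conj c hζ hc]
    exact h2 this
  have i3 := (coprime_of_not_dvd hp h4)
  have := Fintype.ofFinite (𝓞 k ⧸ (place hp).asIdeal)
  have cp := card_quotient c hζ hc p
  have cl := card_quotient c hζ hc l
  have hne1 : ((Nat.card (𝓞 k ⧸ (place hl).asIdeal) : ℕ) : 𝓞 k ⧸ (place hp).asIdeal) ≠ 0 := by
    rw [← map_natCast (Ideal.Quotient.mk (place hp).asIdeal)]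
    apply mk_ne_zero
    rw [mem_place]
    have : ¬ p ∣ l * RingOfIntegers.mapRingEquiv c l := by
      rw [hp.dvd_mul, hp.dvd_prime_iff_associated hl]
      rintro (h | h)
      · exact h1 h.symm.dvd
      · exact h4 h
    change ¬ p ∣ ((Nat.card (𝓞 k ⧸ Ideal.span {l}) : ℕ) : 𝓞 k)
    rcases cl with cl | cl <;> rw [cl]
    · exact this
    · rwa [dvd_neg]
  have hne2 : ((Nat.card (𝓞 k ⧸ (place hp).asIdeal) : ℕ) : 𝓞 k ⧸ (place hl).asIdeal) ≠ 0 := by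
    rw [← map_natCast (Ideal.Quotient.mk (place hl).asIdeal)]
    apply mk_ne_zero
    rw [mem_place]
    have : ¬ l ∣ p * RingOfIntegers.mapRingEquiv c p := by
      rw [hl.dvd_mul]
      exact not_or.mpr ⟨h1, h2⟩
    change ¬ l ∣ ((Nat.card (𝓞 k ⧸ Ideal.span {p}) : ℕ) : 𝓞 k)
    rcases cp with cp | cp <;> rw [cp]
    · exact this
    · rwa [dvd_neg]
  have key := fcub_card_mul_jacobiSum hgp.mk_prim hζ.pow_eq_one (Ideal.Quotient.mk (place hl).asIdeal)
    hgl.mk_prim hne1 hne2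
  rw [← map_natCast (Ideal.Quotient.mk (place hl).asIdeal), ← map_mul,
    ← map_natCast (Ideal.Quotient.mk (place hp).asIdeal)] at key
  change rcub ζ (place hl) _ = - rcub ζ (place hp) _ at key
  have l1 : SS ζ (p ^ 2 * RingOfIntegers.mapRingEquiv c p) l = - SS ζ (l * RingOfIntegers.mapRingEquiv c l) p := by
    rw [SS_prime hl h3', SS_prime hp h3]
    have e1 : rcub ζ (place hp) ((Nat.card (𝓞 k ⧸ (place hl).asIdeal) : ℕ) : 𝓞 k) =
        rcub ζ (place hp) (l * RingOfIntegers.mapRingEquiv c l) := by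
      rcases cl with cl | cl
      · exact congrArg _ cl
      · exact (congrArg _ cl).trans (rcub_neg hgp _)
    rw [← e1, ← key]
    have e2 : ((Nat.card (𝓞 k ⧸ (place hp).asIdeal) : ℕ) : 𝓞 k) = p * RingOfIntegers.mapRingEquiv c p ∨
        ((Nat.card (𝓞 k ⧸ (place hp).asIdeal) : ℕ) : 𝓞 k) = -(p * RingOfIntegers.mapRingEquiv c p) := cp
    rcases e2 with e2 | e2 <;> rcases jacobiSum_eq c hζ hc hp h hgp.mk_prim with e3 | e3 <;> rw [e2, e3]
    · congr 1; ring
    · rw [← rcub_neg hgl]; congr 1; ring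
    · rw [← rcub_neg hgl]; congr 1; ring
    · congr 1; ring
  rw [SS_mul_left hζ hl.ne_zero (i1.pow_left) i2, pow_two, SS_mul_left hζ hl.ne_zero i1 i1,
    SS_mul_left hζ hp.ne_zero i1.symm i3.symm] at l1
  have l2 := rcub_conj c hζ hc hcp ((h.conj c).not_dvd_three hζ hcp) l
  rw [conj_conj c hζ hc] at l2
  rw [FS_eq_SS hζ hp.ne_zero hl.ne_zero i1, FS_eq_SS hζ hcp.ne_zero hl.ne_zero i2]
  rw [l2] at l1
  have t3 : (3 : ZMod 3) = 0 := rfl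
  linear_combination l1 - SS ζ p l * t3

lemma FS_conj_conj (hζ : IsPrimitiveRoot ζ 3) (hc : RingOfIntegers.mapRingEquiv c ζ = ζ ^ 2)
    {x y : 𝓞 k} (hx : x ≠ 0) (hy : y ≠ 0) :
    FS ζ (RingOfIntegers.mapRingEquiv c x : k) (RingOfIntegers.mapRingEquiv c y : k) = - FS ζ (x : k) y := by
  have hx' : (x : k) ≠ 0 := by simpa using hx
  have hy' : (y : k) ≠ 0 := by simpa using hy
  have h := FS_map c hζ hx' hy'
  rw [hc, FS_sq hζ (by simpa using hx') (by simpa using hy')] at h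
  rw [← h, neg_neg]; rfl

lemma FS_prime_prime (hζ : IsPrimitiveRoot ζ 3) (hc : RingOfIntegers.mapRingEquiv c ζ = ζ ^ 2)
    {p l : 𝓞 k} (hp : Prime p) (h : Prim p) (hl : Prime l) (h' : Prim l) (h1 : ¬ l ∣ p)
    (h2 : ¬ l ∣ RingOfIntegers.mapRingEquiv c p) : FS ζ (p : k) (l : k) = 0 := by
  have hcp := prime_map c hp
  have hcl := prime_map c hl
  have e1 := FS_conj_left c hζ hc hp h hl h' h1 h2
  have e2 := FS_conj_left c hζ hc hl h' hcp (h.conj c) (fun H => h2 (hcp.associated_of_dvd hl H).symm.dvd)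
    (fun H => h1 (by
      rcases H with ⟨x, hx⟩
      have : p ∣ l := ⟨(RingOfIntegers.mapRingEquiv c).symm x, (RingOfIntegers.mapRingEquiv c).injective (by
        rw [hx, map_mul, RingEquiv.apply_symm_apply])⟩
      exact (hp.associated_of_dvd hl this).symm.dvd))
  have e3 := FS_conj_conj c hζ hc hl.ne_zero hp.ne_zero
  rw [e3, FS_swap, neg_neg, FS_swap (l : k), e1] at e2
  have t3 : (3 : ZMod 3) = 0 := rfl
  linear_combination -e2 + FS ζ (p : k) l * t3

end Eisenstein
section coe
variable {K : Type*} [Field K]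

lemma coe_one : ((1 : 𝓞 K) : K) = 1 := map_one (algebraMap (𝓞 K) K)

lemma coe_zero : ((0 : 𝓞 K) : K) = 0 := map_zero (algebraMap (𝓞 K) K)

lemma coe_neg (x : 𝓞 K) : ((-x : 𝓞 K) : K) = -x := map_neg (algebraMap (𝓞 K) K) x

lemma coe_sub (x y : 𝓞 K) : ((x - y : 𝓞 K) : K) = x - y := map_sub (algebraMap (𝓞 K) K) x y

lemma coe_pow (x : 𝓞 K) (n : ℕ) : ((x ^ n : 𝓞 K) : K) = x ^ n := map_pow (algebraMap (𝓞 K) K) x n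

lemma coe_ne_zero {x : 𝓞 K} (hx : x ≠ 0) : (x : K) ≠ 0 := by simpa using hx

end coe

section Eisenstein
variable {k : Type*} [Field k] [NumberField k] [IsCyclotomicExtension {3} ℚ k] {ζ : 𝓞 k}

lemma exists_unit_prim (hζ : IsPrimitiveRoot ζ 3) {x : 𝓞 k} (hx : ¬ (ζ - 1 ∣ x)) :
    ∃ u : 𝓞 k, IsUnit u ∧ Prim (u * x) := by
  have hu : IsUnit ζ := hζ.isUnit (by norm_num)
  rcases exists_prim_mul hζ hx with h | h | h
  · exact ⟨1, isUnit_one, by rwa [one_mul]⟩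
  · exact ⟨ζ, hu, h⟩
  · exact ⟨ζ ^ 2, hu.pow 2, h⟩

lemma prim_one : Prim (1 : 𝓞 k) := .inl ⟨0, by ring⟩

/-- Primary elements are products of primary primes, up to sign. -/
lemma prim_induction (hζ : IsPrimitiveRoot ζ 3) {Q : 𝓞 k → Prop} (y : 𝓞 k) (h1 : Q 1)
    (hneg : ∀ x, Q x → Q (-x)) (hmul : ∀ x l, Q x → Q l → Q (x * l))
    (hprime : ∀ l, Prime l → Prim l → ¬ l ∣ y → Q l) {x : 𝓞 k} (hx : x ≠ 0) (hp : Prim x)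
    (hy : ∀ l, Prime l → l ∣ x → ¬ l ∣ y) : Q x := by
  have := IsCyclotomicExtension.Rat.three_pid k
  have key : ∀ x : 𝓞 k, x ≠ 0 → ¬ (ζ - 1 ∣ x) → (∀ l, Prime l → l ∣ x → ¬ l ∣ y) →
      ∃ u, IsUnit u ∧ Prim (u * x) ∧ Q (u * x) := by
    intro x
    induction x using induction_on_prime with
    | h₁ => intro h; exact absurd rfl h
    | h₂ x hx =>
      intro _ _ _
      obtain ⟨u, hu⟩ := hx.exists_left_inv
      exact ⟨u, .of_mul_eq_one x hu, hu ▸ prim_one, hu ▸ h1⟩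
    | h₃ x l hx0 hl ih =>
      intro hx hlx hy
      obtain ⟨u, hu, hu1, hu2⟩ := ih hx0 (fun h => hlx (h.mul_left _)) (fun m hm h => hy m hm (h.mul_left _))
      obtain ⟨w, hw, hw1⟩ := exists_unit_prim hζ (x := l) (fun h => hlx (h.mul_right _))
      have ha : Associated l (w * l) := ⟨hw.unit, by rw [mul_comm]; rfl⟩
      have hwl : Prime (w * l) := ha.prime hl
      have e : u * w * (l * x) = u * x * (w * l) := by ring
      refine ⟨u * w, hu.mul hw, ?_, ?_⟩ <;> rw [e]
      · exact hu1.mul hw1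
      · exact hmul _ _ hu2 (hprime _ hwl hw1 (fun h => hy l hl (dvd_mul_right _ _) (ha.dvd.trans h)))
  obtain ⟨u, hu, h2, h3⟩ := key x hx (hp.not_dvd hζ) hy
  rw [mul_comm] at h2
  rcases prim_unit hζ hu (hp.of_mul h2) with rfl | rfl
  · rwa [one_mul] at h3
  · have := hneg _ h3
    rwa [neg_one_mul, neg_neg] at this

variable (c : k ≃+* k)

lemma FS_prime_of_coprime (hζ : IsPrimitiveRoot ζ 3) (hc : RingOfIntegers.mapRingEquiv c ζ = ζ ^ 2)
    {p b : 𝓞 k} (hp : Prime p) (h : Prim p) (hb0 : b ≠ 0) (hb : Prim b)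
    (hpb : ∀ l, Prime l → l ∣ b → ¬ l ∣ p * RingOfIntegers.mapRingEquiv c p) : FS ζ (p : k) (b : k) = 0 := by
  have hp0 : (p : k) ≠ 0 := by simpa using hp.ne_zero
  refine (prim_induction hζ (Q := fun b => b ≠ 0 ∧ FS ζ (p : k) (b : k) = 0) (p * RingOfIntegers.mapRingEquiv c p)
    ⟨one_ne_zero, ?_⟩ ?_ ?_ ?_ hb0 hb hpb).2
  · rw [coe_one]; exact FS_one_right hζ hp0
  · rintro x ⟨hx, h⟩; exact ⟨neg_ne_zero.mpr hx, by rw [coe_neg, FS_neg_right hζ, h]⟩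
  · rintro x l ⟨hx, h⟩ ⟨hl, h'⟩
    exact ⟨mul_ne_zero hx hl, by
      rw [coe_mul, FS_mul_right hζ (by simpa using hx) (by simpa using hl) hp0, h, h', add_zero]⟩
  · intro l hl hl' hn
    exact ⟨hl.ne_zero, FS_prime_prime c hζ hc hp h hl hl' (fun h => hn (h.mul_right _)) fun h => hn (h.mul_left _)⟩

lemma FS_prime_conj (hζ : IsPrimitiveRoot ζ 3) (hc : RingOfIntegers.mapRingEquiv c ζ = ζ ^ 2)
    {p : 𝓞 k} (hp : Prime p) (h : Prim p) : FS ζ (p : k) (RingOfIntegers.mapRingEquiv c p : k) = 0 := by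
  set q := RingOfIntegers.mapRingEquiv c p with hq
  have hqp : Prime q := prime_map c hp
  have hqc : RingOfIntegers.mapRingEquiv c q = p := conj_conj c hζ hc p
  have hqP : Prim q := h.conj c
  have hp0 : (p : k) ≠ 0 := by simpa using hp.ne_zero
  have hq0 : (q : k) ≠ 0 := by simpa using hqp.ne_zero
  by_cases hd : p ∣ q
  · obtain ⟨u, hu⟩ := hp.associated_of_dvd hqp hd
    have hu1 : Prim (u : 𝓞 k) := h.of_mul (hu ▸ hqP)
    rcases prim_unit hζ u.isUnit hu1 with h | h <;> rw [h] at hu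
    · rw [← hu, mul_one, FS_self]
    · rw [← hu, mul_neg_one, coe_neg, FS_neg_right hζ, FS_self]
  have htP : Prim (p + q) := by
    rcases h with ⟨x, h⟩ | ⟨x, h⟩
    · have h' := congrArg (RingOfIntegers.mapRingEquiv c) h
      rw [map_sub, map_mul, map_one, map_ofNat, ← hq] at h'
      exact .inr ⟨x + RingOfIntegers.mapRingEquiv c x + 1, by linear_combination h + h'⟩
    · have h' := congrArg (RingOfIntegers.mapRingEquiv c) h
      rw [map_add, map_mul, map_one, map_ofNat, ← hq] at h'
      exact .inl ⟨x + RingOfIntegers.mapRingEquiv c x - 1, by linear_combination h + h'⟩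
  have ht0 : p + q ≠ 0 := fun h0 => htP.not_dvd hζ (h0 ▸ dvd_zero _)
  have ht0' : (p : k) + q ≠ 0 := by
    intro h; exact ht0 (RingOfIntegers.ext (by rw [coe_add, h, coe_zero]))
  have hco : ∀ l, Prime l → l ∣ p + q → ¬ l ∣ p * q := by
    intro l hl h1 h2
    rcases hl.dvd_or_dvd h2 with h2 | h2
    · exact hd ((hl.associated_of_dvd hp h2).symm.dvd.trans ((dvd_add_right h2).mp h1))
    · have := (dvd_add_left h2).mp h1
      exact hd ((hl.associated_of_dvd hp this).symm.dvd.trans h2)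
  have e1 := FS_prime_of_coprime c hζ hc hp h ht0 htP hco
  have e2 := FS_prime_of_coprime c hζ hc hqp hqP ht0 htP (by rwa [hqc, mul_comm])
  have e3 := FS_steinberg hζ (x := (p : k) / (p + q)) (div_ne_zero hp0 ht0') (by
    rw [one_sub_div ht0', add_sub_cancel_left]; exact div_ne_zero hq0 ht0')
  rw [one_sub_div ht0', add_sub_cancel_left, FS_div_left hζ hp0 ht0' (div_ne_zero hq0 ht0'),
    FS_div_right hζ hq0 ht0' hp0, FS_div_right hζ hq0 ht0' ht0', FS_self, FS_swap ((p : k) + q)] at e3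
  rw [coe_add] at e1 e2
  rw [e1, e2] at e3
  simpa using e3

/-- Cubic reciprocity for primary Eisenstein integers. -/
theorem FS_prim (hζ : IsPrimitiveRoot ζ 3) {a b : 𝓞 k} (ha0 : a ≠ 0) (ha : Prim a) (hb0 : b ≠ 0) (hb : Prim b) :
    FS ζ (a : k) (b : k) = 0 := by
  obtain ⟨c, hc⟩ := exists_conj hζ
  have hpp : ∀ p l : 𝓞 k, Prime p → Prim p → Prime l → Prim l → FS ζ (p : k) (l : k) = 0 := by
    intro p l hp h hl hl'
    have hcl := prime_map c hl
    have hassoc : ∀ {l p : 𝓞 k}, Prime l → Prime p → Prim l → Prim p → l ∣ p → p = l ∨ p = -l := by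
      intro l p hl hp hl' h hd
      obtain ⟨u, hu⟩ := hl.associated_of_dvd hp hd
      rcases prim_unit hζ u.isUnit (hl'.of_mul (hu ▸ h)) with h | h <;> rw [h] at hu
      · left; rw [← hu, mul_one]
      · right; rw [← hu, mul_neg_one]
    by_cases h1 : l ∣ p
    · rcases hassoc hl hp hl' h h1 with rfl | rfl
      · exact FS_self _
      · rw [coe_neg, FS_neg_left hζ, FS_self]
    by_cases h2 : l ∣ RingOfIntegers.mapRingEquiv c p
    · have := FS_prime_conj c hζ hc hp h
      rcases hassoc hl (prime_map c hp) hl' (h.conj c) h2 with h3 | h3 <;> rw [h3] at this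
      · exact this
      · rwa [coe_neg, FS_neg_right hζ] at this
    exact FS_prime_prime c hζ hc hp h hl hl' h1 h2
  have key : ∀ a : 𝓞 k, a ≠ 0 → (∀ l : 𝓞 k, Prime l → Prim l → FS ζ (a : k) (l : k) = 0) →
      ∀ b : 𝓞 k, b ≠ 0 → Prim b → FS ζ (a : k) (b : k) = 0 := by
    intro a ha0 hal b hb0 hb
    have ha0' : (a : k) ≠ 0 := by simpa using ha0
    refine (prim_induction hζ (Q := fun b => b ≠ 0 ∧ FS ζ (a : k) (b : k) = 0) 1
      ⟨one_ne_zero, ?_⟩ ?_ ?_ ?_ hb0 hb fun l hl _ h => hl.not_isUnit (isUnit_of_dvd_one h)).2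
    · rw [coe_one]; exact FS_one_right hζ ha0'
    · rintro x ⟨hx, h⟩; exact ⟨neg_ne_zero.mpr hx, by rw [coe_neg, FS_neg_right hζ, h]⟩
    · rintro x l ⟨hx, h⟩ ⟨hl, h'⟩
      exact ⟨mul_ne_zero hx hl, by
        rw [coe_mul, FS_mul_right hζ (by simpa using hx) (by simpa using hl) ha0', h, h', add_zero]⟩
    · intro l hl hl' _
      exact ⟨hl.ne_zero, hal l hl hl'⟩
  refine key a ha0 (fun l hl hl' => ?_) b hb0 hb
  rw [FS_swap, key l hl.ne_zero (fun m hm hm' => hpp l m hl hl' hm hm') a ha0 ha, neg_zero]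

end Eisenstein
section Eisenstein
variable {k : Type*} [Field k] [NumberField k] [IsCyclotomicExtension {3} ℚ k] {ζ : 𝓞 k}

lemma Prim.ne_zero (hζ : IsPrimitiveRoot ζ 3) {x : 𝓞 k} (hx : Prim x) : x ≠ 0 := by
  rintro rfl; exact hx.not_dvd hζ (dvd_zero _)

lemma Prim.congr {x y : 𝓞 k} (hx : Prim x) (h : 3 ∣ x - y) : Prim y := by
  obtain ⟨t, h⟩ := h
  rcases hx with ⟨s, hx⟩ | ⟨s, hx⟩
  · exact .inl ⟨s - t, by linear_combination hx - h⟩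
  · exact .inr ⟨s - t, by linear_combination hx - h⟩

lemma FS_coe_mul_left (hζ : IsPrimitiveRoot ζ 3) {x y b : 𝓞 k} (hx : x ≠ 0) (hy : y ≠ 0) (hb : b ≠ 0) :
    FS ζ ((x * y : 𝓞 k) : k) (b : k) = FS ζ (x : k) (b : k) + FS ζ (y : k) (b : k) := by
  rw [coe_mul, FS_mul_left hζ (coe_ne_zero hx) (coe_ne_zero hy) (coe_ne_zero hb)]

lemma FS_coe_mul_right (hζ : IsPrimitiveRoot ζ 3) {x y b : 𝓞 k} (hx : x ≠ 0) (hy : y ≠ 0) (hb : b ≠ 0) :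
    FS ζ (b : k) ((x * y : 𝓞 k) : k) = FS ζ (b : k) (x : k) + FS ζ (b : k) (y : k) := by
  rw [coe_mul, FS_mul_right hζ (coe_ne_zero hx) (coe_ne_zero hy) (coe_ne_zero hb)]

lemma FS_coe_pow_left (hζ : IsPrimitiveRoot ζ 3) {x b : 𝓞 k} (hx : x ≠ 0) (hb : b ≠ 0) (n : ℕ) :
    FS ζ ((x ^ n : 𝓞 k) : k) (b : k) = n * FS ζ (x : k) (b : k) := by
  rw [coe_pow, FS_pow_left hζ (coe_ne_zero hx) (coe_ne_zero hb)]

lemma FS_coe_steinberg (hζ : IsPrimitiveRoot ζ 3) {x b : 𝓞 k} (hx : x ≠ 0) (hb : b ≠ 0) (h : b = 1 + x) :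
    FS ζ (x : k) (b : k) = 0 := by
  have e : (b : k) = 1 - -(x : k) := by rw [h, coe_add, coe_one]; ring
  rw [← FS_neg_left hζ, e]
  exact FS_steinberg hζ (neg_ne_zero.mpr (coe_ne_zero hx)) (e ▸ coe_ne_zero hb)

/-- Every class modulo `3` becomes `±1` or `±ζ²` after adding `0` or `±1`. -/
lemma exists_add_prim (hζ : IsPrimitiveRoot ζ 3) (x : 𝓞 k) :
    ∃ e : 𝓞 k, (e = 0 ∨ e = 1 ∨ e = -1) ∧ (Prim (x + e) ∨ Prim (ζ * (x + e))) := by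
  obtain ⟨a, b, rfl⟩ := exists_repr hζ x
  have h := sq_add_self_add_one hζ
  have main : ∀ e : ℤ, (∃ c d : ℤ, ((a + e = 3 * c + 1 ∨ a + e = 3 * c - 1) ∧ b = 3 * d) ∨
      (a + e = 3 * c + 1 ∧ b = 3 * d + 1) ∨ (a + e = 3 * c - 1 ∧ b = 3 * d - 1)) →
      (Prim ((a : 𝓞 k) + (b : 𝓞 k) * ζ + (e : 𝓞 k)) ∨
        Prim (ζ * ((a : 𝓞 k) + (b : 𝓞 k) * ζ + (e : 𝓞 k)))) := by
    rintro e ⟨c, d, ⟨h1 | h1, h2⟩ | ⟨h1, h2⟩ | ⟨h1, h2⟩⟩ <;>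
      have h1' := congrArg (Int.cast : ℤ → 𝓞 k) h1 <;> have h2' := congrArg (Int.cast : ℤ → 𝓞 k) h2 <;>
      push_cast at h1' h2'
    · exact .inl (.inl ⟨c + d * ζ, by linear_combination h1' + ζ * h2'⟩)
    · exact .inl (.inr ⟨c + d * ζ, by linear_combination h1' + ζ * h2'⟩)
    · exact .inr (.inr ⟨ζ * c + d * ζ ^ 2, by linear_combination ζ * h1' + ζ ^ 2 * h2' + h⟩)
    · exact .inr (.inl ⟨ζ * c + d * ζ ^ 2, by linear_combination ζ * h1' + ζ ^ 2 * h2' - h⟩)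
  have : ∃ e : ℤ, (e = 0 ∨ e = 1 ∨ e = -1) ∧ ∃ c d : ℤ, ((a + e = 3 * c + 1 ∨ a + e = 3 * c - 1) ∧ b = 3 * d) ∨
      (a + e = 3 * c + 1 ∧ b = 3 * d + 1) ∨ (a + e = 3 * c - 1 ∧ b = 3 * d - 1) := by
    obtain hb | hb | hb : b % 3 = 0 ∨ b % 3 = 1 ∨ b % 3 = 2 := by omega
    · by_cases ha : a % 3 = 0
      · exact ⟨1, by simp, a / 3, b / 3, by omega⟩
      · refine ⟨0, by simp, ?_⟩
        obtain ha | ha : a % 3 = 1 ∨ a % 3 = 2 := by omega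
        · exact ⟨a / 3, b / 3, by omega⟩
        · exact ⟨a / 3 + 1, b / 3, by omega⟩
    · obtain ha | ha | ha : a % 3 = 0 ∨ a % 3 = 1 ∨ a % 3 = 2 := by omega
      · exact ⟨1, by simp, a / 3, b / 3, by omega⟩
      · exact ⟨0, by simp, a / 3, b / 3, by omega⟩
      · exact ⟨-1, by simp, a / 3, b / 3, by omega⟩
    · obtain ha | ha | ha : a % 3 = 0 ∨ a % 3 = 1 ∨ a % 3 = 2 := by omega
      · exact ⟨-1, by simp, a / 3, b / 3 + 1, by omega⟩
      · exact ⟨1, by simp, a / 3 + 1, b / 3 + 1, by omega⟩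
      · exact ⟨0, by simp, a / 3 + 1, b / 3 + 1, by omega⟩
  obtain ⟨e, he, h0⟩ := this
  exact ⟨e, by rcases he with rfl | rfl | rfl <;> simp, main e h0⟩

lemma three_eq (hζ : IsPrimitiveRoot ζ 3) : (3 : 𝓞 k) = -(ζ ^ 2 * (ζ - 1) ^ 2) := by
  have h := sq_add_self_add_one hζ
  linear_combination (ζ ^ 2 - 3 * ζ + 3) * h

lemma FS_zeta (hζ : IsPrimitiveRoot ζ 3) {b : 𝓞 k} (hb : 81 * (ζ - 1) ∣ b - 1) : FS ζ (ζ : k) (b : k) = 0 := by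
  have hl0 := (lam_prime hζ).ne_zero
  have hz0 : ζ ≠ 0 := hζ.ne_zero (by norm_num)
  have hP : ∀ x : 𝓞 k, Prim (1 + 81 * (ζ - 1) * x) := fun x => .inl ⟨27 * (ζ - 1) * x, by ring⟩
  have e81 : 81 * (ζ - 1) = ζ ^ 2 * (ζ - 1) ^ 9 := by
    have h3 := three_eq hζ
    have : (81 : 𝓞 k) = 3 ^ 4 := by norm_num
    rw [this, h3]
    linear_combination (ζ - 1) ^ 9 * ζ ^ 2 * (ζ ^ 3 + 1) * hζ.pow_eq_one
  have good : ∀ x : 𝓞 k, Prim x ∨ Prim (ζ * x) → FS ζ (ζ : k) ((1 + 81 * (ζ - 1) * x : 𝓞 k) : k) = 0 := by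
    intro x hx
    have hb0 := (hP x).ne_zero hζ
    have hx0 : x ≠ 0 := by
      rcases hx with hx | hx
      · exact hx.ne_zero hζ
      · exact right_ne_zero_of_mul (hx.ne_zero hζ)
    have h := FS_coe_steinberg hζ (x := 81 * (ζ - 1) * x) (mul_ne_zero (mul_ne_zero (by norm_num) hl0) hx0) hb0 rfl
    have hbP := hP x
    generalize 1 + 81 * (ζ - 1) * x = b at h hb0 hbP
    rw [FS_coe_mul_left hζ (mul_ne_zero (by norm_num) hl0) hx0 hb0, e81,
      FS_coe_mul_left hζ (pow_ne_zero _ hz0) (pow_ne_zero _ hl0) hb0, FS_coe_pow_left hζ hz0 hb0,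
      FS_coe_pow_left hζ hl0 hb0] at h
    have c3 : (3 : ZMod 3) = 0 := rfl
    rcases hx with hx | hx
    · rw [FS_prim hζ hx0 hx hb0 hbP] at h
      simp only [Nat.cast_ofNat] at h
      linear_combination 2 * h - (FS ζ (ζ : k) (b : k) + 6 * FS ζ ((ζ - 1 : 𝓞 k) : k) (b : k)) * c3
    · have h1 := FS_prim hζ (mul_ne_zero hz0 hx0) hx hb0 hbP
      rw [FS_coe_mul_left hζ hz0 hx0 hb0] at h1
      simp only [Nat.cast_ofNat] at h
      linear_combination h - h1 - 3 * FS ζ ((ζ - 1 : 𝓞 k) : k) (b : k) * c3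
  obtain ⟨x, hx⟩ := hb
  obtain rfl : b = 1 + 81 * (ζ - 1) * x := by linear_combination hx
  obtain ⟨e, he, h⟩ := exists_add_prim hζ x
  have hx0 := (hP x).ne_zero hζ
  have he0 := (hP e).ne_zero hζ
  have h1 := good (x + e + 81 * (ζ - 1) * x * e) (by
    refine h.imp (fun h => h.congr ⟨-(27 * (ζ - 1) * x * e), by ring⟩)
      (fun h => h.congr ⟨-(ζ * (27 * (ζ - 1) * x * e)), by ring⟩))
  have h2 : FS ζ (ζ : k) ((1 + 81 * (ζ - 1) * e : 𝓞 k) : k) = 0 := by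
    rcases he with rfl | rfl | rfl
    · rw [mul_zero, add_zero, coe_one]; exact FS_one_right hζ (coe_ne_zero hz0)
    · exact good 1 (.inl prim_one)
    · exact good (-1) (.inl (.inr ⟨0, by ring⟩))
  rw [show 1 + 81 * (ζ - 1) * (x + e + 81 * (ζ - 1) * x * e) = (1 + 81 * (ζ - 1) * x) * (1 + 81 * (ζ - 1) * e) by ring,
    FS_coe_mul_right hζ hx0 he0 hz0, h2, add_zero] at h1
  exact h1

lemma FS_of_not_dvd (hζ : IsPrimitiveRoot ζ 3) {a b : 𝓞 k} (ha : ¬ (ζ - 1 ∣ a)) (hb : 81 * (ζ - 1) ∣ b - 1) :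
    FS ζ (a : k) (b : k) = 0 := by
  have hz0 : ζ ≠ 0 := hζ.ne_zero (by norm_num)
  have ha0 : a ≠ 0 := by rintro rfl; exact ha (dvd_zero _)
  have hbP : Prim b := .inl ((Dvd.intro (27 * (ζ - 1)) (by ring)).trans hb)
  have hb0 := hbP.ne_zero hζ
  have hz := FS_zeta hζ hb
  rcases exists_prim_mul hζ ha with h | h | h
  · exact FS_prim hζ ha0 h hb0 hbP
  · have := FS_prim hζ (h.ne_zero hζ) h hb0 hbP
    rwa [FS_coe_mul_left hζ hz0 ha0 hb0, hz, zero_add] at this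
  · have := FS_prim hζ (h.ne_zero hζ) h hb0 hbP
    rwa [FS_coe_mul_left hζ (pow_ne_zero _ hz0) ha0 hb0, FS_coe_pow_left hζ hz0 hb0, hz, mul_zero, zero_add] at this

lemma lam_dvd (hζ : IsPrimitiveRoot ζ 3) : 81 * (ζ - 1) ∣ (243 : 𝓞 k) :=
  ⟨-(ζ ^ 2 * (ζ - 1)), by linear_combination 81 * three_eq hζ⟩

lemma FS_lam (hζ : IsPrimitiveRoot ζ 3) {b : 𝓞 k} (hb : 243 ∣ b - 1) :
    FS ζ ((ζ - 1 : 𝓞 k) : k) (b : k) = 0 := by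
  have hl0 := (lam_prime hζ).ne_zero
  have hz0 : ζ ≠ 0 := hζ.ne_zero (by norm_num)
  have hP : ∀ x : 𝓞 k, Prim (1 + 243 * x) := fun x => .inl ⟨81 * x, by ring⟩
  have e243 : (243 : 𝓞 k) = -(ζ * (ζ - 1) ^ 10) := by
    have h3 := three_eq hζ
    have : (243 : 𝓞 k) = 3 ^ 5 := by norm_num
    rw [this, h3]
    linear_combination -(ζ - 1) ^ 10 * ζ * (ζ ^ 6 + ζ ^ 3 + 1) * hζ.pow_eq_one
  have hd : ∀ x : 𝓞 k, 81 * (ζ - 1) ∣ 1 + 243 * x - 1 := fun x => by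
    rw [add_sub_cancel_left]; exact (lam_dvd hζ).mul_right x
  have good : ∀ x : 𝓞 k, ¬ (ζ - 1 ∣ x) → FS ζ ((ζ - 1 : 𝓞 k) : k) ((1 + 243 * x : 𝓞 k) : k) = 0 := by
    intro x hx
    have hx0 : x ≠ 0 := by rintro rfl; exact hx (dvd_zero _)
    have hb0 := (hP x).ne_zero hζ
    have h := FS_coe_steinberg hζ (x := 243 * x) (mul_ne_zero (by norm_num) hx0) hb0 rfl
    have h1 := FS_of_not_dvd hζ hx (hd x)
    have h2 := FS_zeta hζ (hd x)
    generalize 1 + 243 * x = b at h hb0 h1 h2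
    rw [FS_coe_mul_left hζ (by norm_num) hx0 hb0, h1, e243, coe_neg, FS_neg_left hζ,
      FS_coe_mul_left hζ hz0 (pow_ne_zero _ hl0) hb0, FS_coe_pow_left hζ hl0 hb0, h2] at h
    have c3 : (3 : ZMod 3) = 0 := rfl
    simp only [Nat.cast_ofNat] at h
    linear_combination h - 3 * FS ζ ((ζ - 1 : 𝓞 k) : k) (b : k) * c3
  obtain ⟨x, hx⟩ := hb
  obtain rfl : b = 1 + 243 * x := by linear_combination hx
  by_cases h : ζ - 1 ∣ x
  · have hn : ¬ (ζ - 1 ∣ 1) := fun h => (lam_prime hζ).not_isUnit (isUnit_of_dvd_one h)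
    have h1 := good (1 + 244 * x) (by rwa [dvd_add_left (h.mul_left _)])
    rw [show 1 + 243 * (1 + 244 * x) = (1 + 243 * x) * (1 + 243 * 1) by ring,
      FS_coe_mul_right hζ ((hP x).ne_zero hζ) ((hP 1).ne_zero hζ) hl0, good 1 hn, add_zero] at h1
    exact h1
  · exact good x h

lemma FS_int (hζ : IsPrimitiveRoot ζ 3) {a b : 𝓞 k} (ha : a ≠ 0) (hb : 243 ∣ b - 1) :
    FS ζ (a : k) (b : k) = 0 := by
  have hl0 := (lam_prime hζ).ne_zero
  have hbP : Prim b := .inl ((Dvd.intro 81 (by ring)).trans hb)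
  have hb0 := hbP.ne_zero hζ
  obtain ⟨x, hx, hx'⟩ := (FiniteMultiplicity.of_not_isUnit (lam_prime hζ).not_isUnit ha).exists_eq_pow_mul_and_not_dvd
  have hx0 : x ≠ 0 := by rintro rfl; exact hx' (dvd_zero _)
  rw [hx, FS_coe_mul_left hζ (pow_ne_zero _ hl0) hx0 hb0, FS_coe_pow_left hζ hl0 hb0, FS_lam hζ hb,
    FS_of_not_dvd hζ hx' ((lam_dvd hζ).trans hb), mul_zero, add_zero]

lemma FS_field (hζ : IsPrimitiveRoot ζ 3) {a : k} {b : 𝓞 k} (ha : a ≠ 0) (hb : 243 ∣ b - 1) :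
    FS ζ a (b : k) = 0 := by
  have hbP : Prim b := .inl ((Dvd.intro 81 (by ring)).trans hb)
  obtain ⟨x, y, hy, rfl⟩ := IsFractionRing.div_surjective (A := 𝓞 k) a
  have hy0 := nonZeroDivisors.ne_zero hy
  have hx0 : x ≠ 0 := by rintro rfl; simp at ha
  have := FS_div_left hζ (coe_ne_zero hx0) (coe_ne_zero hy0) (coe_ne_zero (hbP.ne_zero hζ))
  rw [FS_int hζ hx0 hb, FS_int hζ hy0 hb, sub_zero] at this
  exact this

/-- The sum of the tame symbols away from `3` is trivial near `1` for the `(ζ - 1)`-adic topology. -/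
lemma smallTrivial {Ω : Type*} [NormedField Ω] {σ : k →+* Ω} (hζ : IsPrimitiveRoot ζ 3)
    (h1 : ∀ x : 𝓞 k, ‖σ x‖ ≤ 1) (h2 : ∀ x : 𝓞 k, ‖σ x‖ < 1 ↔ ζ - 1 ∣ x) : SmallTrivial ζ σ := by
  have := IsCyclotomicExtension.Rat.three_pid k
  have hl := lam_prime hζ
  have hn : ¬ (ζ - 1 ∣ 1) := fun h => hl.not_isUnit (isUnit_of_dvd_one h)
  have hl1 := (h2 (ζ - 1)).mpr dvd_rfl
  have hl0 : 0 < ‖σ ((ζ - 1 : 𝓞 k) : k)‖ := norm_pos_iff.mpr ((map_ne_zero σ).mpr (coe_ne_zero hl.ne_zero))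
  set r := ‖σ ((ζ - 1 : 𝓞 k) : k)‖ with hr
  have hunit : ∀ x : 𝓞 k, ¬ (ζ - 1 ∣ x) → ‖σ x‖ = 1 := fun x hx =>
    le_antisymm (h1 x) (not_lt.mp fun h => hx ((h2 x).mp h))
  have hpow : ∀ (n : ℕ) (s : 𝓞 k), ‖σ s‖ < r ^ n → (ζ - 1) ^ n ∣ s := by
    intro n s hs
    by_cases hs0 : s = 0
    · rw [hs0]; exact dvd_zero _
    obtain ⟨x, hx, hx'⟩ := (FiniteMultiplicity.of_not_isUnit hl.not_isUnit hs0).exists_eq_pow_mul_and_not_dvd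
    rw [hx, coe_mul, coe_pow, map_mul, map_pow, norm_mul, norm_pow, hunit x hx', mul_one, ← hr] at hs
    rw [hx]
    exact ((pow_dvd_pow _ ((pow_lt_pow_iff_right_of_lt_one₀ hl0 hl1).mp hs).le)).mul_right _
  have d243 : (243 : 𝓞 k) ∣ (ζ - 1) ^ 10 := ⟨- ζ ^ 5, by
    have := lam_sq hζ
    linear_combination ((ζ - 1) ^ 8 + (ζ - 1) ^ 6 * (-3 * ζ) + (ζ - 1) ^ 4 * (-3 * ζ) ^ 2
      + (ζ - 1) ^ 2 * (-3 * ζ) ^ 3 + (-3 * ζ) ^ 4) * this⟩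
  refine ⟨r ^ 10, pow_pos hl0 10, fun a b ha hb hab => ?_⟩
  obtain ⟨p, q, hpq, hbq⟩ := IsFractionRing.exists_reduced_fraction (A := 𝓞 k) b
  obtain ⟨q, hq⟩ := q
  have hq0 : (q : k) ≠ 0 := coe_ne_zero (nonZeroDivisors.ne_zero hq)
  have hbq : b = (p : k) / q := by rw [← hbq, IsFractionRing.mk'_eq_div]
  have hp0 : p ≠ 0 := by rintro rfl; rw [coe_zero, zero_div] at hbq; exact hb hbq
  have hsq : ‖σ ((p - q : 𝓞 k) : k)‖ < r ^ 10 * ‖σ (q : k)‖ := by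
    have e : σ ((p - q : 𝓞 k) : k) = (σ b - 1) * σ q := by
      rw [hbq, coe_sub, map_sub, map_div₀]
      have := (map_ne_zero σ).mpr hq0
      field_simp
    rw [e, norm_mul]
    exact mul_lt_mul_of_pos_right hab (norm_pos_iff.mpr ((map_ne_zero σ).mpr hq0))
  have hs := hpow 10 (p - q) (hsq.trans_le (mul_le_of_le_one_right (pow_nonneg hl0.le _) (h1 q)))
  have hlq : ¬ (ζ - 1 ∣ q) := by
    intro h
    have h' : ζ - 1 ∣ p := (dvd_sub_left h).mp ((dvd_pow_self _ (by norm_num)).trans hs)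
    exact hl.not_isUnit (hpq h' h)
  obtain ⟨u, t, hut⟩ := ((hl.irreducible.coprime_iff_not_dvd.mpr hlq).pow_left (m := 10))
  have ht0 : t ≠ 0 := by
    rintro rfl
    rw [zero_mul, add_zero] at hut
    exact hl.not_isUnit (isUnit_of_dvd_one ((dvd_pow_self (ζ - 1) (by norm_num : 10 ≠ 0)).mul_left u |>.trans hut.dvd))
  have k1 : FS ζ a ((q * t : 𝓞 k) : k) = 0 := FS_field hζ ha (d243.trans ⟨-u, by linear_combination hut⟩)
  have k2 : FS ζ a ((p * t : 𝓞 k) : k) = 0 := FS_field hζ ha (d243.trans (by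
    obtain ⟨w, hw⟩ := hs
    exact ⟨-u + w * t, by linear_combination hut + t * hw⟩))
  rw [coe_mul, FS_mul_right hζ hq0 (coe_ne_zero ht0) ha] at k1
  rw [coe_mul, FS_mul_right hζ (coe_ne_zero hp0) (coe_ne_zero ht0) ha] at k2
  rw [hbq, FS_div_right hζ (coe_ne_zero hp0) hq0 ha]
  linear_combination k2 - k1

end Eisenstein
section Reduction
variable {M : Type*} [Field M] [NumberField M] {ζ : 𝓞 M}

lemma exists_FS_near_one (hζ : IsPrimitiveRoot ζ 3) {γ : M} (hγ : γ ≠ 0) :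
    ∃ N, ∀ α : 𝓞 M, α ≠ 0 → 3 ^ N ∣ α - 1 → FS ζ γ (α : M) = 0 := by
  have hζM : IsPrimitiveRoot (ζ : M) 3 := hζ.map_of_injective RingOfIntegers.coe_injective
  let k := IntermediateField.adjoin ℚ {(ζ : M)}
  have hcyc : IsCyclotomicExtension {3} ℚ k := hζM.intermediateField_adjoin_isCyclotomicExtension ℚ
  let z : k := ⟨(ζ : M), IntermediateField.mem_adjoin_simple_self ℚ _⟩
  have hz : IsPrimitiveRoot z 3 := IsPrimitiveRoot.of_map_of_injective (f := algebraMap k M) hζM (algebraMap k M).injective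
  let w : 𝓞 k := hz.toInteger
  have hw : IsPrimitiveRoot w 3 := hz.toInteger_isPrimitiveRoot
  have hwζ : algebraMap (𝓞 k) (𝓞 M) w = ζ := RingOfIntegers.ext rfl
  let v := place (lam_prime hw)
  have hv : ∀ x : 𝓞 k, ‖FinitePlace.embedding v (x : k)‖ < 1 ↔ w - 1 ∣ x := fun x =>
    (FinitePlace.norm_lt_one_iff_mem k v x).trans (mem_place _)
  have hle : ∀ x : 𝓞 k, ‖FinitePlace.embedding v (x : k)‖ ≤ 1 := fun x => FinitePlace.norm_le_one k v x
  have hs : SmallTrivial w (FinitePlace.embedding v) := smallTrivial hw hle hv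
  have h3 : ‖FinitePlace.embedding v (3 : k)‖ < 1 := by
    have := (hv 3).mpr ((dvd_pow_self _ two_ne_zero).trans ((three_dvd_iff hw 3).mp dvd_rfl))
    simpa only [map_ofNat] using this
  obtain ⟨N, hN⟩ := FS_near_one (L := M) hs hw h3 hle hγ
  exact ⟨N, fun α h0 h => hwζ ▸ hN α h0 h⟩

/-- Integers congruent to `1` modulo `27` are `3`-adic cubes. -/
lemma exists_cube_approx {R : Type*} [CommRing R] {α : R} (hα : 27 ∣ α - 1) (n : ℕ) :
    ∃ δ, 3 ∣ δ - 1 ∧ 3 ^ (n + 3) ∣ α - δ ^ 3 := by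
  induction n with
  | zero => exact ⟨1, by simp, by norm_num; exact hα⟩
  | succ n ih =>
    obtain ⟨δ, ⟨s, hs⟩, ⟨x, hx⟩⟩ := ih
    obtain rfl : δ = 1 + 3 * s := by linear_combination hs
    refine ⟨1 + 3 * s + 3 ^ (n + 2) * x, ⟨s + 3 ^ (n + 1) * x, by ring⟩,
      -(2 * s + 3 * s ^ 2) * x - (1 + 3 * s) * 3 ^ (n + 1) * x ^ 2 - 3 ^ (2 * n + 2) * x ^ 3, ?_⟩
    linear_combination hx

lemma not_isUnit_three : ¬ IsUnit (3 : 𝓞 M) := by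
  intro h
  have h2 := NumberField.isUnit_iff_norm.mp h
  rw [RingOfIntegers.coe_norm, show ((3 : 𝓞 M) : M) = 3 from map_ofNat (algebraMap (𝓞 M) M) 3] at h2
  have h3 : Algebra.norm ℚ (3 : M) = 3 ^ Module.finrank ℚ M := by
    have := Algebra.norm_algebraMap (S := M) (3 : ℚ)
    rwa [map_ofNat] at this
  rw [h3, abs_of_nonneg (by positivity)] at h2
  exact (one_lt_pow₀ (by norm_num : (1 : ℚ) < 3) Module.finrank_pos.ne').ne' h2

lemma ne_zero_of_three_dvd {α : 𝓞 M} (h : 3 ∣ α - 1) : α ≠ 0 := by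
  rintro rfl
  exact not_isUnit_three (isUnit_of_dvd_one (by simpa using h))

lemma FS_right_of_dvd (hζ : IsPrimitiveRoot ζ 3) {γ : M} (hγ : γ ≠ 0) {α : 𝓞 M} (hα : 27 ∣ α - 1) :
    FS ζ γ (α : M) = 0 := by
  have hα0 : α ≠ 0 := ne_zero_of_three_dvd ((Dvd.intro 9 (by norm_num)).trans hα)
  obtain ⟨N, hN⟩ := exists_FS_near_one hζ hγ
  obtain ⟨δ, ⟨s, hs⟩, hδ⟩ := exists_cube_approx hα N
  obtain ⟨u, t, hut⟩ : IsCoprime (3 ^ (N + 1) : 𝓞 M) δ := IsCoprime.pow_left ⟨-s, 1, by linear_combination hs⟩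
  have hd : (3 : 𝓞 M) ^ N ∣ α * t ^ 3 - 1 := by
    obtain ⟨x, hx⟩ := (pow_dvd_pow 3 (by omega : N ≤ N + 3)).trans hδ
    refine ⟨x * t ^ 3 - 3 * u * ((t * δ) ^ 2 + t * δ + 1), ?_⟩
    linear_combination t ^ 3 * hx + ((t * δ) ^ 2 + t * δ + 1) * hut
  have ht0 : t ≠ 0 := by
    rintro rfl
    exact not_isUnit_three (isUnit_of_dvd_one (α := 𝓞 M) ⟨u * 3 ^ N, by linear_combination -hut⟩)
  have h := hN _ (mul_ne_zero hα0 (pow_ne_zero 3 ht0)) hd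
  rw [coe_mul, coe_pow, FS_mul_right hζ (coe_ne_zero hα0) (pow_ne_zero 3 (coe_ne_zero ht0)) hγ, FS_swap γ (_ ^ 3),
    FS_pow_left hζ (coe_ne_zero ht0) hγ, show ((3 : ℕ) : ZMod 3) = 0 from rfl, zero_mul, neg_zero, add_zero] at h
  exact h

lemma isCoprime_three_iff {b : 𝓞 M} : IsCoprime 3 b ↔ Ideal.span {(3 : 𝓞 M)} ⊔ Ideal.span {b} = ⊤ := by
  rw [← Ideal.isCoprime_span_singleton_iff, Ideal.isCoprime_iff_sup_eq]

lemma ne_zero_of_isCoprime_three {b : 𝓞 M} (h : IsCoprime 3 b) : b ≠ 0 := by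
  rintro rfl
  exact not_isUnit_three (isCoprime_zero_right.mp h)

lemma exists_inv_of_isCoprime {b m : 𝓞 M} (h : IsCoprime m b) (hm : ¬ IsUnit m) : ∃ t ≠ 0, m ∣ b * t - 1 := by
  obtain ⟨u, t, hut⟩ := h
  refine ⟨t, ?_, -u, by linear_combination hut⟩
  rintro rfl
  exact hm (isUnit_of_dvd_one ⟨u, by linear_combination -hut⟩)

lemma not_isUnit_mul_three (x : 𝓞 M) : ¬ IsUnit (27 * x) := fun h =>
  not_isUnit_three (isUnit_of_dvd_unit ⟨9 * x, by ring⟩ h)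

lemma FS_congr_right (hζ : IsPrimitiveRoot ζ 3) {γ : M} (hγ : γ ≠ 0) {b b' : 𝓞 M} (hb : IsCoprime 3 b)
    (h : 27 ∣ b - b') : FS ζ γ (b : M) = FS ζ γ (b' : M) := by
  obtain ⟨x, hx⟩ := h
  have hb' : IsCoprime 3 b' := by
    obtain ⟨u, t, h⟩ := hb
    exact ⟨u + 9 * x * t, t, by linear_combination h - t * hx⟩
  have e27 : (3 : 𝓞 M) ^ 3 = 27 := by norm_num
  obtain ⟨t, ht0, y, hy⟩ := exists_inv_of_isCoprime (e27 ▸ hb.pow_left) (by simpa using not_isUnit_mul_three (1 : 𝓞 M))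
  have h1 := FS_right_of_dvd hζ hγ ⟨y, hy⟩
  have h2 := FS_right_of_dvd hζ hγ (α := b' * t) ⟨y - x * t, by linear_combination hy - t * hx⟩
  rw [coe_mul, FS_mul_right hζ (coe_ne_zero (ne_zero_of_isCoprime_three hb)) (coe_ne_zero ht0) hγ] at h1
  rw [coe_mul, FS_mul_right hζ (coe_ne_zero (ne_zero_of_isCoprime_three hb')) (coe_ne_zero ht0) hγ] at h2
  linear_combination h1 - h2

/-- The residue symbol `SS ζ α b` depends only on `b` modulo `27 * α`. -/
lemma SS_congr_right (hζ : IsPrimitiveRoot ζ 3) {α b b' : 𝓞 M} (hα : α ≠ 0) (hb : IsCoprime 3 b)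
    (hab : IsCoprime α b) (h : 27 * α ∣ b - b') : SS ζ α b = SS ζ α b' := by
  have one : ∀ γ : 𝓞 M, 27 * α ∣ γ - 1 → SS ζ α γ = 0 := by
    rintro γ ⟨x, hx⟩
    have h1 := FS_right_of_dvd hζ (coe_ne_zero hα) (α := γ) ⟨α * x, by linear_combination hx⟩
    have hγ0 : γ ≠ 0 := ne_zero_of_three_dvd ⟨9 * α * x, by linear_combination hx⟩
    rw [FS_eq_SS hζ hα hγ0 ⟨-(27 * x), 1, by linear_combination hx⟩,
      SS_congr (a := γ) (a' := 1) ⟨27 * x, by linear_combination hx⟩, SS_one_left hζ, sub_zero] at h1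
    exact h1
  have e27 : (3 : 𝓞 M) ^ 3 = 27 := by norm_num
  obtain ⟨t, ht0, y, hy⟩ := exists_inv_of_isCoprime ((e27 ▸ hb.pow_left (m := 3)).mul_left hab) (not_isUnit_mul_three α)
  obtain ⟨x, hx⟩ := h
  have hb' : b' ≠ 0 := by
    rintro rfl
    exact not_isUnit_three (isUnit_of_dvd_one (α := 𝓞 M) ⟨9 * α * (x * t - y), by linear_combination t * hx - hy⟩)
  have h1 := one (b * t) ⟨y, hy⟩
  have h2 := one (b' * t) ⟨y - x * t, by linear_combination hy - t * hx⟩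
  rw [SS_mul_right (ne_zero_of_isCoprime_three hb) ht0] at h1
  rw [SS_mul_right hb' ht0] at h2
  linear_combination h1 - h2

end Reduction
section Symbol
variable {M : Type*} [Field M] [NumberField M] {ζ : 𝓞 M} {χ : 𝓞 M → Ideal (𝓞 M) → 𝓞 M}

lemma rcub_spec {v : HeightOneSpectrum (𝓞 M)} (hg : Good ζ v) {a : 𝓞 M} (ha : a ∉ v.asIdeal) :
    ζ ^ (rcub ζ v a).val - a ^ ((Nat.card (𝓞 M ⧸ v.asIdeal) - 1) / 3) ∈ v.asIdeal := by
  rw [← Ideal.Quotient.eq, map_pow, map_pow, rcub, fcub_spec hg.mk_prim (mk_ne_zero ha)]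

lemma symbol_place (hχ : IsCubicResidueSymbol ζ χ) {v : HeightOneSpectrum (𝓞 M)} (hg : Good ζ v) {a : 𝓞 M}
    (ha : a ∉ v.asIdeal) : χ a v.asIdeal = ζ ^ (rcub ζ v a).val := by
  obtain ⟨h1, h2⟩ := (hχ.1 a v.asIdeal v.isPrime hg.three).2 ha
  obtain ⟨c, hc⟩ : ∃ c : ZMod 3, χ a v.asIdeal = ζ ^ c.val := by
    rcases h1 with h | h | h
    · exact ⟨0, by rw [h, ZMod.val_zero, pow_zero]⟩
    · exact ⟨1, by rw [h]; exact (pow_one ζ).symm⟩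
    · exact ⟨2, h⟩
  have h := sub_mem h2 (rcub_spec hg ha)
  rw [sub_sub_sub_cancel_right, hc, ← Ideal.Quotient.eq, map_pow, map_pow] at h
  rw [hc, pow_val_inj hg.mk_prim h]

lemma ord_eq_multiplicity {b : 𝓞 M} (hb : b ≠ 0) (v : HeightOneSpectrum (𝓞 M)) :
    ord v (b : M) = multiplicity v.asIdeal (Ideal.span {b}) := by
  have hf : FiniteMultiplicity v.asIdeal (Ideal.span {b}) :=
    .of_prime_left v.prime (by simpa using hb)
  obtain ⟨n, hn⟩ := Int.eq_ofNat_of_zero_le (ord_nonneg (v := v) hb)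
  rw [hn, Int.ofNat_inj]
  refine le_antisymm ?_ ?_
  · rw [← hf.pow_dvd_iff_le_multiplicity, Ideal.dvd_span_singleton, mem_pow_iff hb, hn]
  · have := (mem_pow_iff (v := v) hb (multiplicity v.asIdeal (Ideal.span {b}))).mp
      (Ideal.dvd_span_singleton.mp (pow_multiplicity_dvd _ _))
    rw [hn] at this
    exact_mod_cast this

/-- The cubic residue symbol of `a` modulo an ideal, written additively. -/
noncomputable def idealSymbol (ζ a : 𝓞 M) (I : Ideal (𝓞 M)) : ZMod 3 :=
  ∑ᶠ v : HeightOneSpectrum (𝓞 M), rcub ζ v a * (multiplicity v.asIdeal I : ZMod 3)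

lemma finite_idealSymbol (a : 𝓞 M) {I : Ideal (𝓞 M)} (hI : I ≠ 0) : (Function.support fun
    v : HeightOneSpectrum (𝓞 M) => rcub ζ v a * (multiplicity v.asIdeal I : ZMod 3)).Finite := by
  refine (Ideal.finite_factors hI).subset fun v hv => ?_
  by_contra hn
  exact hv (by simp only [multiplicity_eq_zero.mpr hn, Nat.cast_zero, mul_zero])

lemma idealSymbol_mul (a : 𝓞 M) {I J : Ideal (𝓞 M)} (hI : I ≠ 0) (hJ : J ≠ 0) :
    idealSymbol ζ a (I * J) = idealSymbol ζ a I + idealSymbol ζ a J := by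
  rw [idealSymbol, idealSymbol, idealSymbol, ← finsum_add_distrib (finite_idealSymbol a hI) (finite_idealSymbol a hJ)]
  refine finsum_congr fun v => ?_
  rw [multiplicity_mul v.prime (.of_prime_left v.prime (mul_ne_zero hI hJ))]
  push_cast; ring

lemma idealSymbol_top (a : 𝓞 M) : idealSymbol ζ a ⊤ = 0 := by
  rw [idealSymbol, ← finsum_zero (α := HeightOneSpectrum (𝓞 M))]
  refine finsum_congr fun v => ?_
  rw [← Ideal.one_eq_top, multiplicity_of_one_right v.prime.not_isUnit, Nat.cast_zero, mul_zero]

lemma idealSymbol_place (a : 𝓞 M) (v : HeightOneSpectrum (𝓞 M)) : idealSymbol ζ a v.asIdeal = rcub ζ v a := by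
  rw [idealSymbol, finsum_eq_single _ v, multiplicity_self, Nat.cast_one, mul_one]
  intro w hw
  have : ¬ w.asIdeal ∣ v.asIdeal := by
    intro h
    exact hw (HeightOneSpectrum.ext (v.isMaximal.eq_of_le w.isPrime.ne_top (Ideal.le_of_dvd h)).symm)
  rw [multiplicity_eq_zero.mpr this, Nat.cast_zero, mul_zero]

lemma idealSymbol_span (a : 𝓞 M) {b : 𝓞 M} (hb : IsCoprime 3 b) :
    idealSymbol ζ a (Ideal.span {b}) = SS ζ a b := by
  refine finsum_congr fun v => ?_
  have hb0 := ne_zero_of_isCoprime_three hb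
  have h := ord_eq_multiplicity hb0 v
  by_cases h3 : (3 : 𝓞 M) ∈ v.asIdeal
  · rw [ord_of_notMem (coprime_notMem hb h3)] at h
    rw [if_pos h3, show multiplicity v.asIdeal (Ideal.span {b}) = 0 by exact_mod_cast h.symm, Nat.cast_zero, mul_zero]
  · rw [if_neg h3, h, Int.cast_natCast]

lemma symbol_eq (hζ : IsPrimitiveRoot ζ 3) (hχ : IsCubicResidueSymbol ζ χ) {a : 𝓞 M} {I : Ideal (𝓞 M)} (hI : I ≠ 0)
    (h3 : Ideal.span {3} ⊔ I = ⊤) (ha : ∀ v : HeightOneSpectrum (𝓞 M), v.asIdeal ∣ I → a ∉ v.asIdeal) :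
    χ a I = ζ ^ (idealSymbol ζ a I).val := by
  induction I using UniqueFactorizationMonoid.induction_on_prime with
  | h₁ => exact absurd rfl hI
  | h₂ I h =>
    rw [Ideal.isUnit_iff.mp h, hχ.2.1, idealSymbol_top, ZMod.val_zero, pow_zero]
  | h₃ I P hI0 hP ih =>
    let v : HeightOneSpectrum (𝓞 M) := ⟨P, Ideal.isPrime_of_prime hP, hP.ne_zero⟩
    have hI3 : Ideal.span {3} ⊔ I = ⊤ := top_le_iff.mp (h3 ▸ sup_le_sup_left Ideal.mul_le_right _)
    have hP3 : Ideal.span {3} ⊔ P = ⊤ := top_le_iff.mp (h3 ▸ sup_le_sup_left Ideal.mul_le_left _)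
    have hg : Good ζ v := ⟨hζ, fun h => by
      rw [sup_eq_right.mpr ((Ideal.span_singleton_le_iff_mem _).mpr h)] at hP3
      exact v.isPrime.ne_top hP3⟩
    rw [hχ.2.2 a P I hP3 hI3, ih hI0 hI3 fun w hw => ha w (hw.mul_left _), idealSymbol_mul a hP.ne_zero hI0,
      pow_val_add hζ.pow_eq_one]
    congr 1
    exact (symbol_place hχ hg (ha v (dvd_mul_right _ _))).trans (by rw [← idealSymbol_place])

lemma symbol_eq_zero (hχ : IsCubicResidueSymbol ζ χ) {a : 𝓞 M} {I : Ideal (𝓞 M)}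
    (h3 : Ideal.span {3} ⊔ I = ⊤) {v : HeightOneSpectrum (𝓞 M)} (hv : v.asIdeal ∣ I) (ha : a ∈ v.asIdeal) :
    χ a I = 0 := by
  obtain ⟨J, rfl⟩ := hv
  have hJ3 : Ideal.span {3} ⊔ J = ⊤ := top_le_iff.mp (h3 ▸ sup_le_sup_left Ideal.mul_le_right _)
  have hP3 : Ideal.span {3} ⊔ v.asIdeal = ⊤ := top_le_iff.mp (h3 ▸ sup_le_sup_left Ideal.mul_le_left _)
  have hn : (3 : 𝓞 M) ∉ v.asIdeal := fun h => by
    rw [sup_eq_right.mpr ((Ideal.span_singleton_le_iff_mem _).mpr h)] at hP3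
    exact v.isPrime.ne_top hP3
  rw [hχ.2.2 a _ J hP3 hJ3, (hχ.1 a v.asIdeal v.isPrime hn).1 ha, zero_mul]

lemma symbol_of_isCoprime (hζ : IsPrimitiveRoot ζ 3) (hχ : IsCubicResidueSymbol ζ χ) {a b : 𝓞 M}
    (hb : IsCoprime 3 b) (hab : IsCoprime a b) : χ a (Ideal.span {b}) = ζ ^ (SS ζ a b).val := by
  rw [symbol_eq hζ hχ (by simpa using ne_zero_of_isCoprime_three hb) (isCoprime_three_iff.mp hb)
    fun v hv ha => coprime_notMem hab ha (Ideal.dvd_span_singleton.mp hv), idealSymbol_span a hb]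

lemma symbol_of_not_isCoprime (hχ : IsCubicResidueSymbol ζ χ) {a b : 𝓞 M} (ha : a ≠ 0)
    (hb : IsCoprime 3 b) (hab : ¬ IsCoprime a b) : χ a (Ideal.span {b}) = 0 := by
  obtain ⟨v, hav, hbv⟩ : ∃ v : HeightOneSpectrum (𝓞 M), a ∈ v.asIdeal ∧ b ∈ v.asIdeal := by
    by_contra! h
    exact hab (coprime_of_forall ha h)
  exact symbol_eq_zero hχ (isCoprime_three_iff.mp hb) (Ideal.dvd_span_singleton.mpr hbv) hav

end Symbol
end CubicRec

open CubicRec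

/-- **Weak cubic reciprocity** (Proposition 3.1 of the paper).  Let `M` be a number field
containing a primitive third root of unity `ζ`.  (1) For `α ≠ 0`, the symbol `(α/β)_{M,3}`
depends only on `β` modulo `27αO_M`.  (2) There is `μ`, depending only on the classes of
`α` and `β` modulo `27O_M` and valued in `{1, ζ, ζ²}`, with
`(α/β)_{M,3} = μ·(β/α)_{M,3}` for `α, β` coprime to `3`. -/
theorem stmt_14 (M : Type*) [Field M] [NumberField M]
    (ζ : 𝓞 M) (hζ3 : ζ ^ 3 = 1) (hζ1 : ζ ≠ 1)
    (χ : 𝓞 M → Ideal (𝓞 M) → 𝓞 M) (hχ : IsCubicResidueSymbol ζ χ) :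
    (∀ α : 𝓞 M, α ≠ 0 → ∀ β β' : 𝓞 M,
      Ideal.span {(3 : 𝓞 M)} ⊔ Ideal.span {β} = ⊤ →
      Ideal.span {(3 : 𝓞 M)} ⊔ Ideal.span {β'} = ⊤ →
      β - β' ∈ Ideal.span {27 * α} →
      χ α (Ideal.span {β}) = χ α (Ideal.span {β'})) ∧
    (∃ μ : (𝓞 M ⧸ Ideal.span {(27 : 𝓞 M)}) → (𝓞 M ⧸ Ideal.span {(27 : 𝓞 M)}) → 𝓞 M,
      (∀ a b, μ a b = 1 ∨ μ a b = ζ ∨ μ a b = ζ ^ 2) ∧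
      ∀ α β : 𝓞 M,
        Ideal.span {(3 : 𝓞 M)} ⊔ Ideal.span {α} = ⊤ →
        Ideal.span {(3 : 𝓞 M)} ⊔ Ideal.span {β} = ⊤ →
        χ α (Ideal.span {β}) =
          μ (Ideal.Quotient.mk (Ideal.span {(27 : 𝓞 M)}) α)
            (Ideal.Quotient.mk (Ideal.span {(27 : 𝓞 M)}) β) * χ β (Ideal.span {α})) := by
  have hζ : IsPrimitiveRoot ζ 3 := isPrimitiveRoot_of_ne_one hζ3 hζ1
  simp only [← isCoprime_three_iff, Ideal.mem_span_singleton]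
  refine ⟨fun α hα β β' hβ hβ' h => ?_, ?_⟩
  · have hiff : IsCoprime α β ↔ IsCoprime α β' := by
      obtain ⟨x, hx⟩ := h
      obtain rfl : β = β' + α * (27 * x) := by linear_combination hx
      exact IsCoprime.add_mul_left_right_iff
    by_cases hc : IsCoprime α β
    · rw [symbol_of_isCoprime hζ hχ hβ hc, symbol_of_isCoprime hζ hχ hβ' (hiff.mp hc), SS_congr_right hζ hα hβ hc h]
    · rw [symbol_of_not_isCoprime hχ hα hβ hc, symbol_of_not_isCoprime hχ hα hβ' (mt hiff.mpr hc)]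
  · have hout : ∀ α : 𝓞 M, 27 ∣ α - (Ideal.Quotient.mk (Ideal.span {(27 : 𝓞 M)}) α).out := fun α => by
      rw [← Ideal.mem_span_singleton, ← Ideal.Quotient.eq]
      exact (Quotient.out_eq _).symm
    refine ⟨fun a b => ζ ^ (FS ζ (a.out : M) (b.out : M)).val, fun a b => ?_, fun α β hα hβ => ?_⟩
    · beta_reduce
      generalize FS ζ (a.out : M) (b.out : M) = c
      fin_cases c
      · exact .inl (pow_zero ζ)
      · exact .inr (.inl (pow_one ζ))
      · exact .inr (.inr rfl)
    have hα0 := ne_zero_of_isCoprime_three hα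
    have hβ0 := ne_zero_of_isCoprime_three hβ
    by_cases hc : IsCoprime α β
    · have ho0 : (Ideal.Quotient.mk (Ideal.span {(27 : 𝓞 M)}) β).out ≠ 0 := by
        intro h
        obtain ⟨x, hx⟩ := hout β
        obtain ⟨u, t, hut⟩ := hβ
        rw [h] at hx
        exact not_isUnit_three (M := M) (.of_mul_eq_one (u + t * (9 * x)) (by linear_combination hut - t * hx))
      rw [symbol_of_isCoprime hζ hχ hβ hc, symbol_of_isCoprime hζ hχ hα hc.symm, ← pow_val_add hζ3, FS_swap,
        ← FS_congr_right hζ (coe_ne_zero ho0) hα (hout α), ← FS_swap, ← FS_congr_right hζ (coe_ne_zero hα0) hβ (hout β),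
        FS_eq_SS hζ hα0 hβ0 hc, sub_add_cancel]
    · rw [symbol_of_not_isCoprime hχ hα0 hβ hc, symbol_of_not_isCoprime hχ hβ0 hα fun h => hc h.symm, mul_zero]
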